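/- There exists a constant C > 0, independent of n, such that for every n ∈ ℤ: (a) for every f ∈ h^1_n(ℝ^d) and every φ ∈ C_c^∞(ℝ^d), |∫_{ℝ^d} f φ| ≤ C ‖f‖_{h^1_n} ‖φ‖_{bmo_n}; and (b) for every linear functional T : C_c^∞(ℝ^d) → ℝ and every M ≥ 0 such that |T(φ)| ≤ M ‖φ‖_{bmo_n} for all φ ∈ C_c^∞(ℝ^d), there exists f ∈ h^1_n(ℝ^d) with ‖f‖_{h^1_n} ≤ C M and T(φ) = ∫_{ℝ^d} f φ for all φ ∈ C_c^∞(ℝ^d). -/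

import Mathlib

open MeasureTheory Metric Real Filter Topology NNReal ENNReal

noncomputable section

abbrev E (d : ℕ) := EuclideanSpace ℝ (Fin d)

/-- The auxiliary function ρ associated with the potential `V`. -/
def rho (d : ℕ) (V : E d → ℝ) (x : E d) : ℝ :=
  sSup {r : ℝ | 0 < r ∧ r ^ ((2:ℝ) - (d:ℝ)) * (∫ y in ball x r, V y) ≤ 1}

/-- The reverse Hölder class `RH_{d/2}`. -/
def IsRH (d : ℕ) (V : E d → ℝ) : Prop :=
  ∃ C : ℝ, 0 < C ∧ ∀ (x : E d) (r : ℝ), 0 < r →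
    ((volume (ball x r)).toReal⁻¹ * ∫ y in ball x r, (V y) ^ ((d:ℝ)/2)) ^ ((2:ℝ)/(d:ℝ)) ≤
      C * ((volume (ball x r)).toReal⁻¹ * ∫ y in ball x r, V y)

/-- The set `𝓑_n = {x : 2^{-(n+1)/2} < ρ(x) ≤ 2^{-n/2}}`. -/
def Bset (d : ℕ) (V : E d → ℝ) (n : ℤ) : Set (E d) :=
  {x | (2:ℝ) ^ (-((n:ℝ)+1)/2) < rho d V x ∧ rho d V x ≤ (2:ℝ) ^ (-(n:ℝ)/2)}

/-- Average of `f` over the ball `B(x,r)`. -/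
def ballAvg (d : ℕ) (f : E d → ℝ) (x : E d) (r : ℝ) : ℝ :=
  (volume (ball x r)).toReal⁻¹ * ∫ y in ball x r, f y

/-- Mean oscillation of `f` over the ball `B(x,r)`. -/
def oscB (d : ℕ) (f : E d → ℝ) (x : E d) (r : ℝ) : ℝ :=
  ballAvg d (fun y => |f y - ballAvg d f x r|) x r

/-- The BMO seminorm, as an extended nonnegative real. -/
def bmoNormE (d : ℕ) (f : E d → ℝ) : ℝ≥0∞ :=
  ⨆ (x : E d) (r : ℝ) (_ : 0 < r), ENNReal.ofReal (oscB d f x r)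

/-- The `bmo_n` norm, as an extended nonnegative real. -/
def bmonNorm (d : ℕ) (n : ℤ) (f : E d → ℝ) : ℝ≥0∞ :=
  bmoNormE d f +
    ⨆ (x : E d) (r : ℝ) (_ : (2:ℝ) ^ (-(n:ℝ)/2) ≤ r),
      ENNReal.ofReal (ballAvg d (fun y => |f y|) x r)

/-- The `BMO_L` norm, as an extended nonnegative real. -/
def bmoLNorm (d : ℕ) (V : E d → ℝ) (f : E d → ℝ) : ℝ≥0∞ :=
  bmoNormE d f +
    ⨆ (x : E d) (r : ℝ) (_ : rho d V x ≤ r),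
      ENNReal.ofReal (ballAvg d (fun y => |f y|) x r)

/-- The Gauss function `P(x) = (4π)^{-d/2} e^{-|x|²/4}`. -/
def gaussP (d : ℕ) (x : E d) : ℝ := (4 * π) ^ (-(d:ℝ)/2) * Real.exp (-(‖x‖^2)/4)

/-- The local maximal function `𝓜_n f(x) = sup_{0<t<2^{-n/2}} |P_t * f(x)|`. -/
def MnMax (d : ℕ) (n : ℤ) (f : E d → ℝ) (x : E d) : ℝ≥0∞ :=
  ⨆ (t : ℝ) (_ : 0 < t ∧ t < (2:ℝ) ^ (-(n:ℝ)/2)),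
    ENNReal.ofReal |∫ z, t ^ (-(d:ℝ)) * gaussP d (t⁻¹ • (x - z)) * f z|

/-- The `h^1_n` norm `‖𝓜_n f‖_{L¹}`, as an extended nonnegative real. -/
def h1nNorm (d : ℕ) (n : ℤ) (f : E d → ℝ) : ℝ≥0∞ := ∫⁻ x, MnMax d n f x

/-- Membership in the local Hardy space `h^1_n`. -/
def Memh1n (d : ℕ) (n : ℤ) (f : E d → ℝ) : Prop :=
  Integrable f volume ∧ h1nNorm d n f < ⊤

/-- `(H^1_L, q)`-atoms related to the ball `B(x₀, r)`, with `L`-constant `CL`. -/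
def IsHLAtom (d : ℕ) (V : E d → ℝ) (CL : ℝ) (q : ℝ≥0∞) (a : E d → ℝ) (x₀ : E d) (r : ℝ) :
    Prop :=
  r ≤ CL * rho d V x₀ ∧ Function.support a ⊆ ball x₀ r ∧
    eLpNorm a q volume ≤ (volume (ball x₀ r)) ^ (1 / q.toReal - 1) ∧
    (r ≤ rho d V x₀ / CL → (∫ x, a x) = 0)

/-- polynomial weight -/
def wt (d : ℕ) (N : ℕ) (x : E d) : ℝ := ((1 + ‖x‖) ^ N)⁻¹

/-- dilated Gauss kernel -/
def pk (d : ℕ) (t : ℝ) (x : E d) : ℝ := t ^ (-(d:ℝ)) * gaussP d (t⁻¹ • x)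

lemma wt_pos (d N : ℕ) (x : E d) : 0 < wt d N x := by
  unfold wt; positivity

lemma wt_le_one (d N : ℕ) (x : E d) : wt d N x ≤ 1 := by
  unfold wt
  apply inv_le_one_of_one_le₀
  apply one_le_pow₀
  linarith [norm_nonneg x]

lemma wt_anti (d : ℕ) {N M : ℕ} (h : N ≤ M) (x : E d) : wt d M x ≤ wt d N x := by
  unfold wt
  apply inv_anti₀ (by positivity)
  apply pow_le_pow_right₀ _ h
  linarith [norm_nonneg x]

lemma wt_mul_pow (d N k : ℕ) (x : E d) : wt d (N + k) x * (1 + ‖x‖) ^ k = wt d N x := by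
  unfold wt
  have : (0:ℝ) < 1 + ‖x‖ := by positivity
  field_simp
  ring

lemma wt_peetre (d N : ℕ) (x y : E d) : wt d N y ≤ (1 + ‖x - y‖) ^ N * wt d N x := by
  unfold wt
  have hx : (0:ℝ) < 1 + ‖x‖ := by positivity
  have hy : (0:ℝ) < 1 + ‖y‖ := by positivity
  rw [← div_eq_mul_inv, le_div_iff₀ (by positivity), inv_mul_le_iff₀ (by positivity), ← mul_pow]
  apply pow_le_pow_left₀ hx.le
  have : ‖x‖ ≤ ‖x - y‖ + ‖y‖ := by simpa using norm_add_le (x - y) y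
  nlinarith [norm_nonneg (x-y), norm_nonneg y]

lemma wt_continuous (d N : ℕ) : Continuous (wt d N) := by
  unfold wt
  apply Continuous.inv₀
  · fun_prop
  · intro x; positivity

lemma wt_integrable (d : ℕ) {N : ℕ} (hN : d + 1 ≤ N) : Integrable (wt d N) := by
  have h1 : Integrable (fun x : E d => (1 + ‖x‖) ^ (-((d:ℝ)+1))) :=
    integrable_one_add_norm (by simp)
  refine h1.mono' (wt_continuous d N).aestronglyMeasurable ?_
  filter_upwards with x
  rw [Real.norm_of_nonneg (wt_pos d N x).le]
  refine (wt_anti d hN x).trans (le_of_eq ?_)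
  unfold wt
  rw [Real.rpow_neg (by positivity)]
  congr 1
  rw [← Real.rpow_natCast]; push_cast; rfl

def JJ (d : ℕ) : ℝ := ∫ x : E d, wt d (d+1) x

lemma JJ_nonneg (d : ℕ) : 0 ≤ JJ d := integral_nonneg fun x => (wt_pos d _ x).le

lemma integrable_scaled {d : ℕ} {f : E d → ℝ} (hf : Integrable f) {s : ℝ} (hs : 0 < s) (x : E d) :
    Integrable (fun y => f (s⁻¹ • (x - y))) := by
  have := (hf.comp_smul (R := s⁻¹) (by positivity))
  exact this.comp_sub_left x

lemma integral_scaled {d : ℕ} (f : E d → ℝ) {s : ℝ} (hs : 0 < s) (x : E d) :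
    ∫ y, f (s⁻¹ • (x - y)) = s ^ d * ∫ y, f y := by
  rw [integral_sub_left_eq_self (fun y => f (s⁻¹ • y)) volume x, Measure.integral_comp_inv_smul]
  simp [abs_of_pos hs]

lemma norm_sub_swap_smul {d : ℕ} (s : ℝ) (x y : E d) : ‖s • (x - y)‖ = ‖s • (y - x)‖ := by
  rw [norm_smul, norm_smul, norm_sub_rev]

lemma wt_swap (d N : ℕ) (s : ℝ) (x y : E d) : wt d N (s • (x - y)) = wt d N (s • (y - x)) := by
  unfold wt; rw [norm_sub_swap_smul]

lemma wt_conv (d N : ℕ) {s r : ℝ} (hs : 0 < s) (hsr : s ≤ r) (x z : E d) :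
    Integrable (fun y => (s^d)⁻¹ * wt d (N+d+1) (s⁻¹ • (x - y)) * wt d N (r⁻¹ • (y - z))) ∧
    ∫ y, (s^d)⁻¹ * wt d (N+d+1) (s⁻¹ • (x - y)) * wt d N (r⁻¹ • (y - z))
      ≤ JJ d * wt d N (r⁻¹ • (x - z)) := by
  have hr : 0 < r := hs.trans_le hsr
  have hi : Integrable (fun y => wt d (d+1) (s⁻¹ • (x - y))) :=
    integrable_scaled (wt_integrable d le_rfl) hs x
  have hi2 := (hi.const_mul ((s^d)⁻¹)).mul_const (wt d N (r⁻¹ • (x - z)))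
  have hb : ∀ y, (s^d)⁻¹ * wt d (N+d+1) (s⁻¹ • (x - y)) * wt d N (r⁻¹ • (y - z)) ≤
      (s^d)⁻¹ * wt d (d+1) (s⁻¹ • (x - y)) * wt d N (r⁻¹ • (x - z)) := by
    intro y
    have h1 := wt_peetre d N (r⁻¹ • (x - z)) (r⁻¹ • (y - z))
    have h2 : r⁻¹ • (x - z) - r⁻¹ • (y - z) = r⁻¹ • (x - y) := by
      rw [← smul_sub]; congr 1; abel
    rw [h2] at h1
    have h3 : ‖r⁻¹ • (x-y)‖ ≤ ‖s⁻¹ • (x-y)‖ := by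
      rw [norm_smul, norm_smul]
      gcongr
      rw [Real.norm_of_nonneg (by positivity), Real.norm_of_nonneg (by positivity)]
      exact inv_anti₀ hs hsr
    have h4 : (1 + ‖r⁻¹ • (x-y)‖)^N ≤ (1 + ‖s⁻¹ • (x-y)‖)^N := by gcongr
    have h5 := wt_mul_pow d (d+1) N (s⁻¹ • (x - y))
    have h6 : wt d (N+d+1) (s⁻¹ • (x - y)) = wt d (d+1+N) (s⁻¹ • (x - y)) := by
      congr 1; ring
    rw [h6, ← h5]
    have h7 : wt d N (r⁻¹ • (y - z)) ≤ (1 + ‖s⁻¹ • (x-y)‖)^N * wt d N (r⁻¹ • (x - z)) :=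
      h1.trans (mul_le_mul_of_nonneg_right h4 (wt_pos _ _ _).le)
    have := mul_le_mul_of_nonneg_left h7
      (mul_nonneg (inv_nonneg.2 (pow_nonneg hs.le d)) (wt_pos d (d+1+N) (s⁻¹ • (x - y))).le)
    calc _ ≤ _ := this
      _ = _ := by ring
  have hI : Integrable (fun y => (s^d)⁻¹ * wt d (N+d+1) (s⁻¹ • (x - y)) * wt d N (r⁻¹ • (y - z))) := by
    refine hi2.mono' ?_ ?_
    · apply Continuous.aestronglyMeasurable
      have := wt_continuous d (N+d+1)
      have := wt_continuous d N
      fun_prop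
    · filter_upwards with y
      rw [Real.norm_of_nonneg]
      · exact hb y
      · have := wt_pos d (N+d+1) (s⁻¹ • (x - y))
        have := wt_pos d (N) (r⁻¹ • (y - z))
        positivity
  refine ⟨hI, ?_⟩
  refine (integral_mono hI hi2 hb).trans (le_of_eq ?_)
  rw [integral_mul_const, integral_const_mul, integral_scaled (wt d (d+1)) hs x]
  unfold JJ
  field_simp

/-- constant for Gaussian decay -/
def CG (d M : ℕ) : ℝ := (4 * π) ^ (-(d:ℝ)/2) * (4 * (2 ^ (M+1) * (M+1).factorial * 2))

lemma CG_pos (d M : ℕ) : 0 < CG d M := by unfold CG; positivity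

lemma exp_decay (M : ℕ) {r : ℝ} (hr : 0 ≤ r) :
    Real.exp (-(r^2)/8) ≤ (2 ^ M * M.factorial * 4) * ((1+r)^M)⁻¹ := by
  have h1 := Real.pow_div_factorial_le_exp ((1+r)/2) (by positivity) M
  have h2 : Real.exp (-(r^2)/8) ≤ Real.exp (-((1+r)/2)) * Real.exp 1 := by
    rw [← Real.exp_add]
    apply Real.exp_le_exp.2
    nlinarith [sq_nonneg (r-2)]
  have h3 : Real.exp 1 ≤ 4 := by linarith [Real.exp_one_lt_d9]
  have h4 : Real.exp (-((1+r)/2)) ≤ (2 ^ M * M.factorial) * ((1+r)^M)⁻¹ := by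
    rw [Real.exp_neg, ← div_eq_mul_inv]
    apply (inv_le_comm₀ (by positivity) (by positivity)).2
    rw [inv_div]
    refine le_trans (le_of_eq ?_) h1
    rw [div_pow]; field_simp
  calc _ ≤ _ := h2
    _ ≤ ((2 ^ M * M.factorial) * ((1+r)^M)⁻¹) * 4 := by gcongr
    _ = _ := by ring

lemma gauss_le (d M : ℕ) (x : E d) : gaussP d x ≤ CG d M * wt d M x := by
  unfold gaussP CG
  rw [mul_assoc]
  apply mul_le_mul_of_nonneg_left _ (by positivity)
  have h1 : Real.exp (-(‖x‖^2)/4) ≤ Real.exp (-(‖x‖^2)/8) :=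
    Real.exp_le_exp.2 (by nlinarith [sq_nonneg ‖x‖])
  refine h1.trans ((exp_decay (M) (norm_nonneg x)).trans ?_)
  have : (2:ℝ) ^ M * M.factorial * 4 ≤ (4 * (2 ^ (M+1) * (M+1).factorial * 2)) := by
    rw [Nat.factorial_succ, pow_succ]
    push_cast
    have : (0:ℝ) < 2 ^ M * M.factorial := by positivity
    have hM : (0:ℝ) ≤ M := by positivity
    nlinarith [mul_nonneg this.le hM]
  exact mul_le_mul_of_nonneg_right this (wt_pos d M x).le

lemma gauss_nonneg (d : ℕ) (x : E d) : 0 ≤ gaussP d x := by unfold gaussP; positivity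

lemma exp_diff {a b c : ℝ} (ha : c ≤ a) (hb : c ≤ b) :
    |Real.exp (-a) - Real.exp (-b)| ≤ |a - b| * Real.exp (-c) := by
  wlog h : a ≤ b generalizing a b
  · rw [abs_sub_comm, abs_sub_comm a b]; exact this hb ha (le_of_not_ge h)
  have h1 : Real.exp (-b) ≤ Real.exp (-a) := Real.exp_le_exp.2 (by linarith)
  rw [abs_of_nonneg (by linarith), abs_of_nonpos (by linarith)]
  have h2 := Real.add_one_le_exp (-(b-a))
  have h3 : Real.exp (-b) = Real.exp (-a) * Real.exp (-(b-a)) := by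
    rw [← Real.exp_add]; congr 1; ring
  have h4 : Real.exp (-a) ≤ Real.exp (-c) := Real.exp_le_exp.2 (by linarith)
  rw [h3]
  nlinarith [Real.exp_pos (-a)]

lemma gauss_lip (d M : ℕ) (x y : E d) (h : ‖x - y‖ ≤ 1) :
    |gaussP d x - gaussP d y| ≤ CG d M * ‖x - y‖ * wt d M x := by
  unfold gaussP CG
  rw [← mul_sub, abs_mul, abs_of_nonneg (by positivity), mul_assoc, mul_assoc]
  apply mul_le_mul_of_nonneg_left _ (by positivity)
  have hxy : ‖x‖ ≤ ‖x - y‖ + ‖y‖ := by simpa using norm_add_le (x - y) y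
  have hyx : ‖y‖ ≤ ‖x - y‖ + ‖x‖ := by
    have := norm_add_le (y - x) x
    rw [norm_sub_rev]; simpa using this
  have h0 := norm_nonneg x
  have h0' := norm_nonneg y
  have h0'' := norm_nonneg (x - y)
  have e := exp_diff (a := ‖x‖^2/4) (b := ‖y‖^2/4) (c := ‖x‖^2/8 - 1/4) (by nlinarith)
    (by nlinarith [sq_nonneg (‖x‖-2)])
  rw [neg_div, neg_div]
  refine e.trans ?_
  have e1 : |‖x‖^2/4 - ‖y‖^2/4| ≤ ‖x-y‖ * (1 + ‖x‖) / 2 := by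
    have : ‖x‖^2/4 - ‖y‖^2/4 = (‖x‖-‖y‖) * (‖x‖+‖y‖) / 4 := by ring
    rw [this, abs_div, abs_mul, abs_of_nonneg (by positivity : 0 ≤ ‖x‖+‖y‖)]
    have : |‖x‖ - ‖y‖| ≤ ‖x-y‖ := abs_norm_sub_norm_le x y
    rw [abs_of_pos (by norm_num : (0:ℝ) < 4)]
    have : |‖x‖ - ‖y‖| * (‖x‖+‖y‖) ≤ ‖x-y‖ * (2 * (1+‖x‖)) := by gcongr; linarith
    linarith
  have e2 : Real.exp (-(‖x‖^2/8 - 1/4)) ≤ 2 * Real.exp (-(‖x‖^2)/8) := by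
    have : -(‖x‖^2/8 - 1/4) = 1/4 + (-(‖x‖^2)/8) := by ring
    rw [this, Real.exp_add]
    have : Real.exp (1/4) ≤ 2 := by
      have h1 : Real.exp (1/4) ^ 4 = Real.exp 1 := by rw [← Real.exp_nat_mul]; norm_num
      by_contra hc
      push Not at hc
      have : (2:ℝ)^4 < Real.exp (1/4)^4 := by gcongr
      linarith [Real.exp_one_lt_d9]
    gcongr
  have e3 := exp_decay (M+1) h0
  have e4 : (1 + ‖x‖) * ((1+‖x‖)^(M+1))⁻¹ = wt d M x := by
    unfold wt; rw [pow_succ]; field_simp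
  calc _ ≤ (‖x-y‖ * (1 + ‖x‖) / 2) * (2 * ((2 ^ (M+1) * (M+1).factorial * 4) * ((1+‖x‖)^(M+1))⁻¹)) := by
        gcongr
        exact e2.trans (by linarith)
    _ = ‖x-y‖ * (2 ^ (M+1) * (M+1).factorial * 4) * ((1 + ‖x‖) * ((1+‖x‖)^(M+1))⁻¹) := by ring
    _ ≤ _ := by
        rw [e4]
        have := wt_pos d M x
        have : 0 ≤ ‖x-y‖ * (2 ^ (M+1) * (M+1).factorial * 4) * wt d M x := by positivity
        nlinarith

lemma gauss_continuous (d : ℕ) : Continuous (gaussP d) := by unfold gaussP; fun_prop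

lemma gauss_integrable (d : ℕ) : Integrable (gaussP d) := by
  refine ((wt_integrable d (le_refl (d+1))).const_mul (CG d (d+1))).mono'
    (gauss_continuous d).aestronglyMeasurable ?_
  filter_upwards with x
  rw [Real.norm_of_nonneg (gauss_nonneg d x)]
  exact gauss_le d (d+1) x

lemma gauss_integral (d : ℕ) : ∫ x, gaussP d x = 1 := by
  unfold gaussP
  rw [integral_const_mul]
  have := GaussianFourier.integral_rexp_neg_mul_sq_norm (V := E d) (b := 1/4) (by norm_num)
  have h2 : ∀ v : E d, -(‖v‖^2)/4 = -(1/4) * ‖v‖^2 := fun v => by ring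
  simp_rw [h2, this]
  simp only [finrank_euclideanSpace, Fintype.card_fin]
  have : π / (1/4) = 4 * π := by ring
  rw [this, ← Real.rpow_add (by positivity)]
  have : -(d:ℝ)/2 + d/2 = 0 := by ring
  rw [this, Real.rpow_zero]

lemma pk_eq (d : ℕ) {t : ℝ} (ht : 0 < t) (x : E d) : pk d t x = (t^d)⁻¹ * gaussP d (t⁻¹ • x) := by
  unfold pk; rw [Real.rpow_neg ht.le, Real.rpow_natCast]

lemma pk_nonneg (d : ℕ) {t : ℝ} (ht : 0 < t) (x : E d) : 0 ≤ pk d t x := by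
  rw [pk_eq d ht]; exact mul_nonneg (by positivity) (gauss_nonneg d _)

lemma pk_continuous (d : ℕ) (t : ℝ) : Continuous (pk d t) := by
  unfold pk
  have := gauss_continuous d
  fun_prop

lemma pk_le (d M : ℕ) {t : ℝ} (ht : 0 < t) (x : E d) :
    pk d t x ≤ CG d M * ((t^d)⁻¹ * wt d M (t⁻¹ • x)) := by
  rw [pk_eq d ht]
  have := mul_le_mul_of_nonneg_left (gauss_le d M (t⁻¹ • x)) (by positivity : 0 ≤ (t^d)⁻¹)
  linarith

lemma pk_bdd (d : ℕ) {t : ℝ} (ht : 0 < t) (x : E d) : pk d t x ≤ CG d 0 * (t^d)⁻¹ := by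
  refine (pk_le d 0 ht x).trans ?_
  unfold wt; simp

lemma pk_lip (d M : ℕ) {t : ℝ} (ht : 0 < t) (x y : E d) (h : ‖x - y‖ ≤ t) :
    |pk d t x - pk d t y| ≤ CG d M * (‖x - y‖ / t) * ((t^d)⁻¹ * wt d M (t⁻¹ • x)) := by
  rw [pk_eq d ht, pk_eq d ht, ← mul_sub, abs_mul, abs_of_pos (by positivity : 0 < (t^d)⁻¹)]
  have hn : ‖t⁻¹ • x - t⁻¹ • y‖ = ‖x - y‖ / t := by
    rw [← smul_sub, norm_smul, Real.norm_of_nonneg (by positivity)]; field_simp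
  have := gauss_lip d M (t⁻¹ • x) (t⁻¹ • y) (by rw [hn]; exact (div_le_one ht).2 h)
  rw [hn] at this
  have := mul_le_mul_of_nonneg_left this (by positivity : 0 ≤ (t^d)⁻¹)
  linarith

lemma pk_integrable (d : ℕ) {t : ℝ} (ht : 0 < t) (x : E d) : Integrable (fun y => pk d t (x - y)) := by
  simp_rw [pk_eq d ht]
  exact (integrable_scaled (gauss_integrable d) ht x).const_mul _

lemma pk_integral (d : ℕ) {t : ℝ} (ht : 0 < t) (x : E d) : ∫ y, pk d t (x - y) = 1 := by
  simp_rw [pk_eq d ht]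
  rw [integral_const_mul, integral_scaled _ ht x, gauss_integral]
  field_simp

lemma pk_symm (d : ℕ) (t : ℝ) (x : E d) : pk d t (-x) = pk d t x := by
  unfold pk gaussP; simp

lemma ennreal_geo {θ : ℝ} (hθ : 0 < θ) (a : ℝ≥0∞) :
    ∑' k : ℤ, (if (2:ℝ≥0∞)^k < a then ((2:ℝ≥0∞)^k)^θ else 0) ≤
      (1 - (2:ℝ≥0∞)^(-θ))⁻¹ * a^θ := by
  have hc : (2:ℝ≥0∞)^(-θ) < 1 := by
    rw [ENNReal.rpow_neg]
    exact ENNReal.inv_lt_one.2 (ENNReal.one_lt_rpow (by norm_num) hθ)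
  have hc0 : (1 - (2:ℝ≥0∞)^(-θ))⁻¹ ≠ 0 := by
    apply ENNReal.inv_ne_zero.2
    exact (lt_of_le_of_lt tsub_le_self ENNReal.one_lt_top).ne
  rcases eq_or_ne a 0 with rfl | ha0
  · simp
  rcases eq_or_ne a ∞ with rfl | hat
  · rw [ENNReal.top_rpow_of_pos hθ, ENNReal.mul_top hc0]; exact le_top
  obtain ⟨K, hK1, hK2⟩ := ENNReal.exists_mem_Ioc_zpow ha0 hat (y := 2) (by norm_num) (by norm_num)
  have h1 : ∀ k : ℤ, (if (2:ℝ≥0∞)^k < a then ((2:ℝ≥0∞)^k)^θ else 0) ≤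
      (if k ≤ K then ((2:ℝ≥0∞)^k)^θ else 0) := by
    intro k
    by_cases hk : k ≤ K
    · rw [if_pos hk]; split_ifs <;> simp
    · rw [if_neg hk, if_neg]
      push Not at hk ⊢
      exact hK2.trans (ENNReal.zpow_le_of_le (by norm_num) (by omega))
  refine (ENNReal.tsum_le_tsum h1).trans ?_
  rw [← (Equiv.subLeft K).tsum_eq]
  have h2 : ∀ k : ℤ, (if (Equiv.subLeft K) k ≤ K then ((2:ℝ≥0∞)^((Equiv.subLeft K) k))^θ else 0)
      = if 0 ≤ k then ((2:ℝ≥0∞)^(K - k))^θ else 0 := by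
    intro k; simp
  simp_rw [h2]
  have h3 : ∑' k : ℤ, (if 0 ≤ k then ((2:ℝ≥0∞)^(K - k))^θ else 0) =
      ∑' n : ℕ, ((2:ℝ≥0∞)^(K - (n:ℤ)))^θ := by
    rw [← (Nat.cast_injective (R := ℤ)).tsum_eq]
    · simp
    · intro k hk
      simp only [Function.mem_support, ne_eq, ite_eq_right_iff, Classical.not_imp] at hk
      exact ⟨k.toNat, by simp [hk.1]⟩
  rw [h3]
  have h4 : ∀ n : ℕ, ((2:ℝ≥0∞)^(K - (n:ℤ)))^θ = ((2:ℝ≥0∞)^K)^θ * ((2:ℝ≥0∞)^(-θ))^n := by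
    intro n
    rw [sub_eq_add_neg, ENNReal.zpow_add (by norm_num) (by norm_num), ENNReal.mul_rpow_of_nonneg _ _ hθ.le]
    congr 1
    rw [← ENNReal.rpow_intCast, ← ENNReal.rpow_natCast, ← ENNReal.rpow_mul, ← ENNReal.rpow_mul]
    congr 1; push_cast; ring
  simp_rw [h4]
  rw [ENNReal.tsum_mul_left, ENNReal.tsum_geometric, mul_comm]
  gcongr

lemma ennreal_le_sum {q : ℝ} (hq : 0 < q) (a : ℝ≥0∞) :
    a^q ≤ ∑' k : ℤ, (if (2:ℝ≥0∞)^k < a then ((2:ℝ≥0∞)^(k+1))^q else 0) := by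
  rcases eq_or_ne a 0 with rfl | ha0
  · simp [hq]
  rcases eq_or_ne a ∞ with rfl | hat
  · rw [ENNReal.top_rpow_of_pos hq]
    refine le_of_eq (Eq.symm ?_)
    refine ENNReal.eq_top_of_forall_nnreal_le fun x => ?_
    have hx : ((x:ℝ≥0∞))^(q⁻¹) ≠ ∞ := ENNReal.rpow_ne_top_of_nonneg (by positivity) (by simp)
    obtain ⟨n, hn⟩ := ENNReal.exists_nat_gt hx
    refine le_trans ?_ (ENNReal.le_tsum (n:ℤ))
    have h1 : (2:ℝ≥0∞)^(n:ℤ) < ∞ := by simp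
    rw [if_pos h1]
    have h2 : (x:ℝ≥0∞) = ((x:ℝ≥0∞)^(q⁻¹))^q := by
      rw [← ENNReal.rpow_mul, inv_mul_cancel₀ hq.ne', ENNReal.rpow_one]
    rw [h2]
    gcongr
    refine hn.le.trans ?_
    have : (n:ℝ≥0∞) ≤ (2:ℝ≥0∞)^(n+1) := by
      exact_mod_cast (Nat.lt_two_pow_self (n := n)).le.trans (Nat.pow_le_pow_right (by norm_num) (by omega))
    exact_mod_cast this
  obtain ⟨K, hK1, hK2⟩ := ENNReal.exists_mem_Ioc_zpow ha0 hat (y := 2) (by norm_num) (by norm_num)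
  refine le_trans ?_ (ENNReal.le_tsum K)
  rw [if_pos hK1]
  gcongr

/-- Hardy–Littlewood maximal function -/
def HL (d : ℕ) (g : E d → ℝ≥0∞) (x : E d) : ℝ≥0∞ :=
  ⨆ (r : ℝ) (_ : 0 < r), (volume (ball x r))⁻¹ * ∫⁻ y in ball x r, g y

lemma vol_ball (d : ℕ) (x : E d) {r : ℝ} (hr : 0 < r) :
    volume (ball x r) = ENNReal.ofReal (r^d) * volume (ball (0:E d) 1) := by
  rw [Measure.addHaar_ball_of_pos _ _ hr]; simp

lemma vol_ball_ne_zero (d : ℕ) (x : E d) {r : ℝ} (hr : 0 < r) : volume (ball x r) ≠ 0 :=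
  (measure_ball_pos volume x hr).ne'

lemma vol_ball_ne_top (d : ℕ) (x : E d) (r : ℝ) : volume (ball x r) ≠ ∞ :=
  measure_ball_lt_top.ne

lemma HL_lsc_aux (d : ℕ) (g : E d → ℝ≥0∞) (r : ℝ) :
    LowerSemicontinuous (fun x : E d => ∫⁻ y in ball x r, g y) := by
  intro x a ha
  have hU : ball x r = ⋃ n : ℕ, ball x (r - 1/((n:ℝ)+1)) := by
    ext y
    simp only [mem_ball, Set.mem_iUnion]
    constructor
    · intro h
      obtain ⟨n, hn⟩ := exists_nat_one_div_lt (sub_pos.2 h)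
      exact ⟨n, by linarith⟩
    · rintro ⟨n, hn⟩
      have : 0 < 1/((n:ℝ)+1) := by positivity
      linarith
  have hmono : Monotone fun n : ℕ => ball x (r - 1/((n:ℝ)+1)) := by
    intro n m hnm
    apply ball_subset_ball
    have : 1/((m:ℝ)+1) ≤ 1/((n:ℝ)+1) := one_div_le_one_div_of_le (by positivity) (by
      have : (n:ℝ) ≤ m := by exact_mod_cast hnm
      linarith)
    linarith
  have h1 : ∫⁻ y in ball x r, g y = ⨆ n : ℕ, ∫⁻ y in ball x (r - 1/((n:ℝ)+1)), g y := by
    conv_lhs => rw [hU]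
    exact setLIntegral_iUnion_of_directed g hmono.directed_le
  simp only at ha
  rw [h1] at ha
  obtain ⟨n, hn⟩ := lt_iSup_iff.1 ha
  have hp : 0 < 1/((n:ℝ)+1) := by positivity
  filter_upwards [ball_mem_nhds x hp] with z hz
  refine hn.trans_le (lintegral_mono_set ?_)
  apply ball_subset_ball'
  rw [dist_comm]
  have := mem_ball.1 hz
  linarith

lemma HL_lsc (d : ℕ) (g : E d → ℝ≥0∞) : LowerSemicontinuous (HL d g) := by
  unfold HL
  refine lowerSemicontinuous_iSup fun r => lowerSemicontinuous_iSup fun hr => ?_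
  have h : ∀ x : E d, volume (ball x r) = volume (ball (0:E d) r) := fun x => by
    rw [vol_ball d x hr, vol_ball d 0 hr]
  simp_rw [h]
  intro x a ha
  have hc0 := vol_ball_ne_zero d (0:E d) hr
  have hct := vol_ball_ne_top d (0:E d) r
  have h1 : ∀ y, a < (volume (ball (0:E d) r))⁻¹ * y ↔ a * volume (ball (0:E d) r) < y := by
    intro y
    rw [mul_comm, ← div_eq_mul_inv, ENNReal.lt_div_iff_mul_lt (Or.inl hc0) (Or.inl hct)]
  simp only [h1] at ha ⊢
  exact HL_lsc_aux d g r x _ ha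

lemma HL_weak_aux (d : ℕ) (g : E d → ℝ≥0∞) (l : ℝ≥0∞) (ρ : ℝ) :
    l * volume {x : E d | ∃ r, 0 < r ∧ r ≤ ρ ∧ l * volume (ball x r) ≤ ∫⁻ y in ball x r, g y} ≤
      4^d * ∫⁻ y, g y := by
  set S := {x : E d | ∃ r, 0 < r ∧ r ≤ ρ ∧ l * volume (ball x r) ≤ ∫⁻ y in ball x r, g y} with hS
  choose! r hr0 hrρ hr using (fun x (hx : x ∈ S) => hx)
  obtain ⟨u, huS, hud, hcov⟩ := Vitali.exists_disjoint_subfamily_covering_enlargement_closedBall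
    S id r ρ hrρ 4 (by norm_num)
  have hud' : u.PairwiseDisjoint fun a => ball a (r a) := by
    intro a ha b hb hab
    exact (hud ha hb hab).mono ball_subset_closedBall ball_subset_closedBall
  have hcount : u.Countable := by
    refine hud'.countable_of_isOpen (fun _ _ => isOpen_ball) ?_
    intro a ha
    exact ⟨a, mem_ball_self (hr0 a (huS ha))⟩
  have hsub : S ⊆ ⋃ b ∈ u, closedBall b (4 * r b) := by
    intro x hx
    obtain ⟨b, hb, hxb⟩ := hcov x hx
    exact Set.mem_biUnion hb (hxb (mem_closedBall_self (hr0 x hx).le))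
  have : Countable u := hcount.to_subtype
  calc l * volume S ≤ l * ∑' b : u, volume (closedBall (b:E d) (4 * r b)) := by
        gcongr
        exact (measure_mono hsub).trans (measure_biUnion_le volume hcount _)
    _ = ∑' b : u, 4^d * (l * volume (ball (b:E d) (r b))) := by
        rw [← ENNReal.tsum_mul_left]
        congr 1; ext b
        have hb := hr0 b (huS b.2)
        rw [Measure.addHaar_closedBall _ _ (by positivity), vol_ball d _ hb]
        simp only [finrank_euclideanSpace, Fintype.card_fin]
        rw [mul_pow, ENNReal.ofReal_mul (by positivity), ENNReal.ofReal_pow (by norm_num)]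
        simp only [ENNReal.ofReal_ofNat]
        ring
    _ ≤ ∑' b : u, 4^d * ∫⁻ y in ball (b:E d) (r b), g y := by
        gcongr with b
        exact hr b (huS b.2)
    _ = 4^d * ∫⁻ y in ⋃ b : u, ball (b:E d) (r b), g y := by
        rw [ENNReal.tsum_mul_left, lintegral_iUnion (fun _ => measurableSet_ball)]
        intro a b hab
        exact hud' a.2 b.2 (fun h => hab (Subtype.ext h))
    _ ≤ _ := by
        gcongr
        exact Measure.restrict_le_self

lemma HL_weak (d : ℕ) (g : E d → ℝ≥0∞) (l : ℝ≥0∞) :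
    l * volume {x : E d | l < HL d g x} ≤ 4^d * ∫⁻ y, g y := by
  have hsub : {x : E d | l < HL d g x} ⊆ ⋃ n : ℕ, {x : E d | ∃ r, 0 < r ∧ r ≤ (n:ℝ) ∧
      l * volume (ball x r) ≤ ∫⁻ y in ball x r, g y} := by
    intro x hx
    simp only [HL, Set.mem_ofPred_eq, lt_iSup_iff] at hx
    obtain ⟨r, hr, h⟩ := hx
    obtain ⟨n, hn⟩ := exists_nat_ge r
    refine Set.mem_iUnion.2 ⟨n, r, hr, hn, ?_⟩
    rw [mul_comm (_)⁻¹, ← div_eq_mul_inv, ENNReal.lt_div_iff_mul_lt (Or.inl (vol_ball_ne_zero d x hr))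
      (Or.inl (vol_ball_ne_top d x r))] at h
    exact h.le
  have hmono : Monotone fun n : ℕ => {x : E d | ∃ r, 0 < r ∧ r ≤ (n:ℝ) ∧
      l * volume (ball x r) ≤ ∫⁻ y in ball x r, g y} := by
    rintro n m hnm x ⟨r, h0, h1, h2⟩
    exact ⟨r, h0, h1.trans (by exact_mod_cast hnm), h2⟩
  calc _ ≤ l * ⨆ n : ℕ, volume {x : E d | ∃ r, 0 < r ∧ r ≤ (n:ℝ) ∧
      l * volume (ball x r) ≤ ∫⁻ y in ball x r, g y} := by
        rw [← hmono.measure_iUnion]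
        gcongr
    _ ≤ _ := by
        rw [ENNReal.mul_iSup]
        exact iSup_le fun n => HL_weak_aux d g l n

lemma HL_split (d : ℕ) (g : E d → ℝ≥0∞) (l : ℝ≥0∞) (x : E d) :
    HL d g x ≤ HL d ({y | l < g y}.indicator g) x + l := by
  unfold HL
  refine iSup₂_le fun r hr => ?_
  have h1 : ∫⁻ y in ball x r, g y ≤
      ∫⁻ y in ball x r, ({y | l < g y}.indicator g y + l) := by
    apply lintegral_mono
    intro y
    by_cases h : l < g y
    · simp [Set.indicator, h]
    · simp only [Set.indicator, Set.mem_ofPred_eq, h, if_false, zero_add]; exact not_lt.1 h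
  rw [lintegral_add_right _ measurable_const, setLIntegral_const] at h1
  calc _ ≤ (volume (ball x r))⁻¹ * (∫⁻ y in ball x r, {y | l < g y}.indicator g y) +
        (volume (ball x r))⁻¹ * (l * volume (ball x r)) := by
        rw [← mul_add]; gcongr
    _ ≤ _ := by
        gcongr
        · exact le_iSup₂_of_le r hr le_rfl
        · rw [mul_comm l, ← mul_assoc, ENNReal.inv_mul_cancel (vol_ball_ne_zero d x hr)
            (vol_ball_ne_top d x r), one_mul]

/-- strong type bound -/
lemma HL_strong (d : ℕ) {θ : ℝ} (hθ : 0 < θ) : ∃ C : ℝ≥0∞, C ≠ ∞ ∧ ∀ g : E d → ℝ≥0∞, Measurable g →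
    ∫⁻ x, (HL d g x)^(1+θ) ≤ C * ∫⁻ x, (g x)^(1+θ) := by
  have hcc : (2:ℝ≥0∞)^(-θ) < 1 := by
    rw [ENNReal.rpow_neg]
    exact ENNReal.inv_lt_one.2 (ENNReal.one_lt_rpow (by norm_num) hθ)
  refine ⟨2^(1+θ) * (2 * 4^d) * (2^θ * (1 - (2:ℝ≥0∞)^(-θ))⁻¹), ?_, ?_⟩
  · refine ENNReal.mul_ne_top (ENNReal.mul_ne_top ?_ ?_) (ENNReal.mul_ne_top ?_ ?_)
    · exact ENNReal.rpow_ne_top_of_nonneg (by positivity) (by norm_num)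
    · exact ENNReal.mul_ne_top (by norm_num) (ENNReal.pow_ne_top (by norm_num))
    · exact ENNReal.rpow_ne_top_of_nonneg (by positivity) (by norm_num)
    · exact ENNReal.inv_ne_top.2 (tsub_pos_of_lt hcc).ne'
  intro g hg
  have hHLm : Measurable (HL d g) := (HL_lsc d g).measurable
  have two0 : ∀ k : ℤ, (2:ℝ≥0∞)^k ≠ 0 := fun k => (ENNReal.zpow_pos (by norm_num) (by norm_num) k).ne'
  have twot : ∀ k : ℤ, (2:ℝ≥0∞)^k ≠ ∞ := fun k => (ENNReal.zpow_lt_top (by norm_num) (by norm_num) k).ne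
  have hk : ∀ k : ℤ, volume {x | (2:ℝ≥0∞)^k < HL d g x} ≤
      2 * 4^d * ((2:ℝ≥0∞)^k)⁻¹ * ∫⁻ y, {y | (2:ℝ≥0∞)^(k-1) < g y}.indicator g y := by
    intro k
    have e : (2:ℝ≥0∞)^k = 2^(k-1) + 2^(k-1) := by
      conv_lhs => rw [show k = (k-1)+1 by ring, ENNReal.zpow_add (by norm_num) (by norm_num)]
      simp [mul_two]
    have h1 : {x | (2:ℝ≥0∞)^k < HL d g x} ⊆
        {x | (2:ℝ≥0∞)^(k-1) < HL d ({y | (2:ℝ≥0∞)^(k-1) < g y}.indicator g) x} := by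
      intro x hx
      have := lt_of_lt_of_le hx (HL_split d g ((2:ℝ≥0∞)^(k-1)) x)
      rw [e] at this
      exact (ENNReal.add_lt_add_iff_right (twot _)).1 this
    have h2 := HL_weak d ({y | (2:ℝ≥0∞)^(k-1) < g y}.indicator g) ((2:ℝ≥0∞)^(k-1))
    have h3 : volume {x | (2:ℝ≥0∞)^k < HL d g x} ≤ ((2:ℝ≥0∞)^(k-1))⁻¹ * 
        (4^d * ∫⁻ y, {y | (2:ℝ≥0∞)^(k-1) < g y}.indicator g y) := by
      refine (measure_mono h1).trans ?_
      rw [← ENNReal.div_eq_inv_mul, ENNReal.le_div_iff_mul_le (Or.inl (two0 _)) (Or.inl (twot _)), mul_comm]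
      exact h2
    refine h3.trans (le_of_eq ?_)
    have e2 : ((2:ℝ≥0∞)^(k-1))⁻¹ = 2 * ((2:ℝ≥0∞)^k)⁻¹ := by
      conv_rhs => rw [show k = (k-1)+1 by ring, ENNReal.zpow_add (by norm_num) (by norm_num)]
      rw [zpow_one, ENNReal.mul_inv (Or.inl (two0 _)) (Or.inl (twot _)), mul_comm, mul_assoc,
        ENNReal.inv_mul_cancel (by norm_num) (by norm_num), mul_one]
    rw [e2]; ring
  have hq : 0 < 1 + θ := by positivity
  calc ∫⁻ x, (HL d g x)^(1+θ) ≤ ∫⁻ x, ∑' k : ℤ,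
        (if (2:ℝ≥0∞)^k < HL d g x then ((2:ℝ≥0∞)^(k+1))^(1+θ) else 0) :=
        lintegral_mono fun x => ennreal_le_sum hq _
    _ = ∑' k : ℤ, ((2:ℝ≥0∞)^(k+1))^(1+θ) * volume {x | (2:ℝ≥0∞)^k < HL d g x} := by
        rw [lintegral_tsum]
        · congr 1; ext k
          have : ∀ x, (if (2:ℝ≥0∞)^k < HL d g x then ((2:ℝ≥0∞)^(k+1))^(1+θ) else 0) =
            {x | (2:ℝ≥0∞)^k < HL d g x}.indicator (fun _ => ((2:ℝ≥0∞)^(k+1))^(1+θ)) x := by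
            intro x; simp [Set.indicator]
          simp_rw [this]
          rw [lintegral_indicator (measurableSet_lt measurable_const hHLm), setLIntegral_const]
        · intro k
          exact (Measurable.ite (measurableSet_lt measurable_const hHLm) measurable_const
            measurable_const).aemeasurable
    _ ≤ ∑' k : ℤ, ((2:ℝ≥0∞)^(k+1))^(1+θ) * 
          (2 * 4^d * ((2:ℝ≥0∞)^k)⁻¹ * ∫⁻ y, {y | (2:ℝ≥0∞)^(k-1) < g y}.indicator g y) := by
        gcongr with k; exact hk k
    _ = ∑' k : ℤ, 2^(1+θ) * (2 * 4^d) * (2^θ * ∫⁻ y, g y * 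
          (if (2:ℝ≥0∞)^(k-1) < g y then ((2:ℝ≥0∞)^(k-1))^θ else 0)) := by
        congr 1; ext k
        have e1 : ∫⁻ y, g y * (if (2:ℝ≥0∞)^(k-1) < g y then ((2:ℝ≥0∞)^(k-1))^θ else 0) = 
            ((2:ℝ≥0∞)^(k-1))^θ * ∫⁻ y, {y | (2:ℝ≥0∞)^(k-1) < g y}.indicator g y := by
          rw [← lintegral_const_mul _ (hg.indicator (measurableSet_lt measurable_const hg))]
          congr 1; ext y
          by_cases h : (2:ℝ≥0∞)^(k-1) < g y
          · simp [Set.indicator, h, mul_comm]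
          · simp [Set.indicator, h]
        rw [e1]
        have e2 : ((2:ℝ≥0∞)^(k+1))^(1+θ) = 2^(1+θ) * (((2:ℝ≥0∞)^k) * ((2:ℝ≥0∞)^k)^θ) := by
          rw [ENNReal.zpow_add (by norm_num) (by norm_num), ENNReal.mul_rpow_of_nonneg _ _ hq.le,
            ENNReal.rpow_add_of_nonneg 1 θ (by norm_num) hθ.le, ENNReal.rpow_one]
          simp [mul_comm]
        have e3 : ((2:ℝ≥0∞)^k)^θ = 2^θ * ((2:ℝ≥0∞)^(k-1))^θ := by
          conv_lhs => rw [show k = (k-1)+1 by ring, ENNReal.zpow_add (by norm_num) (by norm_num),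
            ENNReal.mul_rpow_of_nonneg _ _ hθ.le]
          simp [mul_comm]
        rw [e2, e3]
        have e4 : (2:ℝ≥0∞)^k * ((2:ℝ≥0∞)^k)⁻¹ = 1 := ENNReal.mul_inv_cancel (two0 k) (twot k)
        calc _ = 2 ^ (1 + θ) * (2 * 4 ^ d) * (2 ^ θ * ((2 ^ (k - 1)) ^ θ * ∫⁻ y, {y | (2:ℝ≥0∞)^(k-1) < g y}.indicator g y)) * ((2:ℝ≥0∞)^k * ((2:ℝ≥0∞)^k)⁻¹) := by ring
          _ = _ := by rw [e4, mul_one]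
    _ = 2^(1+θ) * (2 * 4^d) * (2^θ * ∑' k : ℤ, ∫⁻ y, g y * 
          (if (2:ℝ≥0∞)^k < g y then ((2:ℝ≥0∞)^k)^θ else 0)) := by
        rw [ENNReal.tsum_mul_left, ENNReal.tsum_mul_left]
        congr 2
        exact (Equiv.subRight (1:ℤ)).tsum_eq (fun k => ∫⁻ y, g y * 
          (if (2:ℝ≥0∞)^k < g y then ((2:ℝ≥0∞)^k)^θ else 0))
    _ = 2^(1+θ) * (2 * 4^d) * (2^θ * ∫⁻ y, g y * ∑' k : ℤ, 
          (if (2:ℝ≥0∞)^k < g y then ((2:ℝ≥0∞)^k)^θ else 0)) := by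
        rw [← lintegral_tsum]
        · simp_rw [ENNReal.tsum_mul_left]
        · intro k
          exact (hg.mul (Measurable.ite (measurableSet_lt measurable_const hg) measurable_const
            measurable_const)).aemeasurable
    _ ≤ 2^(1+θ) * (2 * 4^d) * (2^θ * ∫⁻ y, (1 - (2:ℝ≥0∞)^(-θ))⁻¹ * (g y)^(1+θ)) := by
        refine mul_le_mul_right (mul_le_mul_right (lintegral_mono fun y => ?_) _) _
        rw [ENNReal.rpow_add_of_nonneg 1 θ (by norm_num) hθ.le, ENNReal.rpow_one]
        calc _ ≤ g y * ((1 - (2:ℝ≥0∞)^(-θ))⁻¹ * (g y)^θ) := by gcongr; exact ennreal_geo hθ _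
          _ = _ := by ring
    _ = _ := by
        rw [lintegral_const_mul _ (hg.pow_const _)]; ring

/-- class of weighted Lipschitz bumps -/
structure BC (d : ℕ) (z : E d) (r κ ρ : ℝ) (b : E d → ℝ) : Prop where
  size : ∀ x, |b x| ≤ κ * wt d (d+2) (r⁻¹ • (x - z))
  lip : ∀ x y, |b x - b y| ≤ κ * (‖x - y‖ / ρ) *
    (wt d (d+2) (r⁻¹ • (x - z)) + wt d (d+2) (r⁻¹ • (y - z)))

lemma BC.continuous {d : ℕ} {z : E d} {r κ ρ : ℝ} {b : E d → ℝ} (hκ : 0 ≤ κ) (hρ : 0 < ρ)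
    (h : BC d z r κ ρ b) : Continuous b := by
  have : LipschitzWith (Real.toNNReal (κ / ρ * 2)) b := by
    apply LipschitzWith.of_dist_le_mul
    intro x y
    rw [Real.dist_eq, dist_eq_norm, Real.coe_toNNReal _ (by positivity)]
    refine (h.lip x y).trans ?_
    have h1 := wt_le_one d (d+2) (r⁻¹ • (x - z))
    have h2 := wt_le_one d (d+2) (r⁻¹ • (y - z))
    calc _ ≤ κ * (‖x - y‖ / ρ) * 2 := by gcongr; linarith
      _ = _ := by ring
  exact this.continuous

lemma wt_integrable_scaled {d : ℕ} {N : ℕ} (hN : d + 1 ≤ N) {r : ℝ} (hr : 0 < r) (z : E d) :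
    Integrable (fun y => wt d N (r⁻¹ • (y - z))) := by
  have := integrable_scaled (wt_integrable d hN) hr z
  refine this.congr ?_
  filter_upwards with y
  exact wt_swap d N _ _ _

lemma BC.integrable {d : ℕ} {z : E d} {r κ ρ : ℝ} {b : E d → ℝ} (hκ : 0 ≤ κ) (hρ : 0 < ρ) (hr : 0 < r)
    (h : BC d z r κ ρ b) : Integrable b := by
  refine ((wt_integrable_scaled (N := d+2) (by omega) hr z).const_mul κ).mono'
    (h.continuous hκ hρ).aestronglyMeasurable ?_
  filter_upwards with x
  exact h.size x

def CU (d : ℕ) : ℝ := 1 + 2 * (CG d (2*d+4) * 2^(2*d+4) * JJ d)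

lemma CU_pos (d : ℕ) : 0 < CU d := by
  unfold CU
  have := CG_pos d (2*d+4)
  have := JJ_nonneg d
  positivity

/-- averaged approximation -/
def avgOp (d : ℕ) (s : ℝ) (p : E d → E d) (b : E d → ℝ) (x : E d) : ℝ :=
  ∫ y, b y * pk d s (x - p y)

section step
variable {d : ℕ} {z : E d} {r κ ρ h s : ℝ} {b : E d → ℝ} {p : E d → E d}

lemma avg_integrable (hs : 0 < s) (hbi : Integrable b) (hp : Measurable p) (x : E d) :
    Integrable (fun y => b y * pk d s (x - p y)) := by
  refine hbi.mul_bdd (c := CG d 0 * (s^d)⁻¹) ?_ ?_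
  · exact ((pk_continuous d s).measurable.comp (measurable_const.sub hp)).aestronglyMeasurable
  · filter_upwards with y
    rw [Real.norm_of_nonneg (pk_nonneg d hs _)]
    exact pk_bdd d hs _

lemma step_aux (hκ : 0 ≤ κ) (hs : 0 < s) (hsr : s ≤ r) {c : ℝ} (hc : 0 ≤ c) (F : E d → ℝ) (x : E d)
    (hF : ∀ y, |F y| ≤ c * ((s^d)⁻¹ * wt d (2*d+3) (s⁻¹ • (x - y))) * (κ * wt d (d+2) (r⁻¹ • (y - z)))) :
    |∫ y, F y| ≤ κ * (c * JJ d) * wt d (d+2) (r⁻¹ • (x - z)) := by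
  have h1 := wt_conv d (d+2) hs hsr x z
  have e : d + 2 + d + 1 = 2*d+3 := by ring
  rw [e] at h1
  have h2 := norm_integral_le_of_norm_le (f := F) (h1.1.const_mul (c*κ)) (by
    filter_upwards with y
    refine (hF y).trans (le_of_eq ?_); ring)
  rw [integral_const_mul] at h2
  refine h2.trans ?_
  have := mul_le_mul_of_nonneg_left h1.2 (mul_nonneg hc hκ)
  linarith

lemma wt_norm_mul (d N : ℕ) (u : E d) : ‖u‖ * wt d (N+1) u ≤ wt d N u := by
  have h1 := wt_mul_pow d N 1 u
  rw [pow_one] at h1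
  have := wt_pos d (N+1) u
  nlinarith [norm_nonneg u]

lemma step_size (hκ : 0 ≤ κ) (hρ : 0 < ρ) (hh : 0 < h) (hhs : h ≤ s) (hsr : s ≤ r)
    (hb : BC d z r κ ρ b) (hp : Measurable p) (hph : ∀ y, ‖p y - y‖ ≤ h) (x : E d) :
    |b x - avgOp d s p b x| ≤ κ * (CU d * (s/ρ + h/s)) * wt d (d+2) (r⁻¹ • (x - z)) := by
  have hs : 0 < s := hh.trans_le hhs
  have hr : 0 < r := hs.trans_le hsr
  have hbi := hb.integrable hκ hρ hr
  have hCG := CG_pos d (2*d+4)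
  have hJ := JJ_nonneg d
  set w := fun x => wt d (d+2) (r⁻¹ • (x - z)) with hw
  have hw0 : ∀ x, 0 < w x := fun x => wt_pos _ _ _
  have i1 : Integrable (fun y => b x * pk d s (x - y)) := (pk_integrable d hs x).const_mul _
  have i2 : Integrable (fun y => b y * pk d s (x - y)) := avg_integrable hs hbi measurable_id x
  have i3 := avg_integrable hs hbi hp x
  have e : b x - avgOp d s p b x = (∫ y, (b x - b y) * pk d s (x - y)) +
      ∫ y, b y * (pk d s (x - y) - pk d s (x - p y)) := by
    simp only [sub_mul, mul_sub]
    rw [integral_sub i1 i2, integral_sub i2 i3, integral_const_mul, pk_integral d hs, avgOp]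
    simp
  have b1 : |∫ y, b y * (pk d s (x - y) - pk d s (x - p y))| ≤
      κ * ((CG d (2*d+4) * (h/s)) * JJ d) * w x := by
    refine step_aux hκ hs hsr (by positivity) _ x fun y => ?_
    rw [abs_mul]
    have e1 : ‖(x - y) - (x - p y)‖ = ‖p y - y‖ := by congr 1; abel
    have h1 := pk_lip d (2*d+4) hs (x - y) (x - p y) (by rw [e1]; exact (hph y).trans hhs)
    rw [e1] at h1
    have h2 : |pk d s (x - y) - pk d s (x - p y)| ≤
        CG d (2*d+4) * (h/s) * ((s^d)⁻¹ * wt d (2*d+3) (s⁻¹ • (x - y))) := by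
      refine h1.trans ?_
      have := hph y
      have h3 := wt_anti d (by omega : 2*d+3 ≤ 2*d+4) (s⁻¹ • (x - y))
      have h4 := wt_pos d (2*d+4) (s⁻¹ • (x - y))
      gcongr
    have := mul_le_mul (hb.size y) h2 (abs_nonneg _) (mul_nonneg hκ (hw0 y).le)
    linarith
  have i4 : Integrable (fun y => (b x - b y) * pk d s (x - y)) := by
    simp only [sub_mul]; exact i1.sub i2
  have hker : ∀ y, ‖x - y‖ / ρ * pk d s (x - y) ≤
      (s/ρ) * CG d (2*d+4) * ((s^d)⁻¹ * wt d (2*d+3) (s⁻¹ • (x - y))) := by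
    intro y
    have h1 := pk_le d (2*d+4) hs (x - y)
    have h2 := wt_norm_mul d (2*d+3) (s⁻¹ • (x - y))
    have h3 : ‖s⁻¹ • (x - y)‖ = ‖x - y‖ / s := by
      rw [norm_smul, Real.norm_of_nonneg (by positivity)]; field_simp
    rw [h3] at h2
    calc _ ≤ ‖x - y‖ / ρ * (CG d (2*d+4) * ((s^d)⁻¹ * wt d (2*d+4) (s⁻¹ • (x - y)))) := by gcongr
      _ = (s/ρ) * CG d (2*d+4) * ((s^d)⁻¹ * (‖x - y‖ / s * wt d (2*d+4) (s⁻¹ • (x - y)))) := by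
        field_simp
      _ ≤ _ := by gcongr
  have b2 : |∫ y, (b x - b y) * pk d s (x - y)| ≤ κ * (2 * (s/ρ) * CG d (2*d+4) * JJ d) * w x := by
    have h1 := wt_conv d (d+2) hs hsr x z
    have e : d + 2 + d + 1 = 2*d+3 := by ring
    rw [e] at h1
    have h0 := wt_conv d (d+2) hs hsr x x
    rw [e] at h0
    have iw : Integrable (fun y => (s^d)⁻¹ * wt d (2*d+3) (s⁻¹ • (x - y))) :=
      (integrable_scaled (wt_integrable d (by omega)) hs x).const_mul _
    have hle : ∫ y, (s^d)⁻¹ * wt d (2*d+3) (s⁻¹ • (x - y)) ≤ JJ d := by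
      have i5 : Integrable (fun y => (s^d)⁻¹ * wt d (d+1) (s⁻¹ • (x - y))) :=
        (integrable_scaled (wt_integrable d (by omega)) hs x).const_mul _
      refine (integral_mono iw i5 (fun y => ?_)).trans (le_of_eq ?_)
      · exact mul_le_mul_of_nonneg_left (wt_anti d (by omega) _) (by positivity)
      · rw [integral_const_mul, integral_scaled _ hs x]; unfold JJ; field_simp
    have h2 := norm_integral_le_of_norm_le (f := fun y => (b x - b y) * pk d s (x - y))
      (((iw.const_mul (w x)).add h1.1).const_mul (κ * ((s/ρ) * CG d (2*d+4)))) (by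
      filter_upwards with y
      rw [norm_mul, Real.norm_of_nonneg (pk_nonneg d hs _), Real.norm_eq_abs]
      have h3 := mul_le_mul_of_nonneg_right (hb.lip x y) (pk_nonneg d hs (x - y))
      have h4 := mul_le_mul_of_nonneg_left (hker y)
        (mul_nonneg hκ (add_nonneg (hw0 x).le (hw0 y).le))
      simp only [hw, Pi.add_apply] at h4 ⊢
      linarith)
    rw [integral_const_mul] at h2
    simp only [Pi.add_apply] at h2
    rw [integral_add (iw.const_mul (w x)) h1.1, integral_const_mul] at h2
    refine h2.trans ?_
    have h5 : w x * (∫ y, (s^d)⁻¹ * wt d (2*d+3) (s⁻¹ • (x - y))) +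
        ∫ y, (s^d)⁻¹ * wt d (2*d+3) (s⁻¹ • (x - y)) * wt d (d+2) (r⁻¹ • (y - z)) ≤ 2 * JJ d * w x := by
      have := mul_le_mul_of_nonneg_left hle (hw0 x).le
      have := h1.2
      simp only [hw] at this ⊢
      linarith
    have := mul_le_mul_of_nonneg_left h5 (by positivity : 0 ≤ κ * ((s/ρ) * CG d (2*d+4)))
    linarith
  rw [e]
  refine (abs_add_le _ _).trans ((add_le_add b2 b1).trans ?_)
  have hpos := hw0 x
  have hCU : 2 * (CG d (2*d+4) * JJ d) ≤ CU d := by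
    unfold CU
    have : (1:ℝ) ≤ 2^(2*d+4) := one_le_pow₀ (by norm_num)
    have h0 : 0 ≤ CG d (2*d+4) * JJ d := by positivity
    nlinarith
  have h6 : 2 * (s/ρ) * CG d (2*d+4) * JJ d + (CG d (2*d+4) * (h/s)) * JJ d ≤
      CU d * (s/ρ + h/s) := by
    have : 0 ≤ s/ρ := by positivity
    have : 0 ≤ h/s := by positivity
    have h0 : 0 ≤ CG d (2*d+4) * JJ d := by positivity
    nlinarith
  calc _ = κ * (2 * (s/ρ) * CG d (2*d+4) * JJ d + (CG d (2*d+4) * (h/s)) * JJ d) * w x := by ring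
    _ ≤ _ := by gcongr

lemma step_BC (hκ : 0 ≤ κ) (hρ : 0 < ρ) (hh : 0 < h) (hhs : h ≤ s) (hsr : s ≤ r)
    (hb : BC d z r κ ρ b) (hp : Measurable p) (hph : ∀ y, ‖p y - y‖ ≤ h) :
    BC d z r (κ * (CU d * (s/ρ + h/s))) h (fun x => b x - avgOp d s p b x) := by
  have hs : 0 < s := hh.trans_le hhs
  have hr : 0 < r := hs.trans_le hsr
  have hbi := hb.integrable hκ hρ hr
  have hCG := CG_pos d (2*d+4)
  have hJ := JJ_nonneg d
  have hCU := CU_pos d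
  refine ⟨step_size hκ hρ hh hhs hsr hb hp hph, fun x y => ?_⟩
  have hwx := wt_pos d (d+2) (r⁻¹ • (x - z))
  have hwy := wt_pos d (d+2) (r⁻¹ • (y - z))
  by_cases hxy : h ≤ ‖x - y‖
  · have h1 := step_size hκ hρ hh hhs hsr hb hp hph x
    have h2 := step_size hκ hρ hh hhs hsr hb hp hph y
    refine (abs_sub _ _).trans ((add_le_add h1 h2).trans ?_)
    rw [← mul_add]
    apply mul_le_mul_of_nonneg_right _ (by positivity)
    have : 1 ≤ ‖x-y‖/h := (one_le_div hh).2 hxy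
    have h0 : 0 ≤ κ * (CU d * (s/ρ + h/s)) := by positivity
    nlinarith
  push Not at hxy
  have key : |∫ v, b v * (pk d s (x - p v) - pk d s (y - p v))| ≤
      κ * ((CG d (2*d+4) * (‖x-y‖/s) * 2^(2*d+4)) * JJ d) * wt d (d+2) (r⁻¹ • (x - z)) := by
    refine step_aux hκ hs hsr (by positivity) _ x fun v => ?_
    rw [abs_mul]
    have e1 : ‖(x - p v) - (y - p v)‖ = ‖x - y‖ := by congr 1; abel
    have h1 := pk_lip d (2*d+4) hs (x - p v) (y - p v) (by rw [e1]; exact hxy.le.trans hhs)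
    rw [e1] at h1
    have h2 := wt_peetre d (2*d+4) (s⁻¹ • (x - v)) (s⁻¹ • (x - p v))
    have h3 : ‖s⁻¹ • (x - v) - s⁻¹ • (x - p v)‖ ≤ 1 := by
      rw [← smul_sub, norm_smul, Real.norm_of_nonneg (by positivity), inv_mul_le_iff₀ hs, mul_one]
      have : x - v - (x - p v) = p v - v := by abel
      rw [this]; exact (hph v).trans hhs
    have h4 : (1 + ‖s⁻¹ • (x - v) - s⁻¹ • (x - p v)‖)^(2*d+4) ≤ 2^(2*d+4) := by
      gcongr; linarith
    have h5 : wt d (2*d+4) (s⁻¹ • (x - p v)) ≤ 2^(2*d+4) * wt d (2*d+3) (s⁻¹ • (x - v)) := by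
      refine h2.trans ?_
      have := wt_anti d (by omega : 2*d+3 ≤ 2*d+4) (s⁻¹ • (x - v))
      have := wt_pos d (2*d+4) (s⁻¹ • (x - v))
      gcongr
    have h6 : |pk d s (x - p v) - pk d s (y - p v)| ≤
        CG d (2*d+4) * (‖x-y‖/s) * 2^(2*d+4) * ((s^d)⁻¹ * wt d (2*d+3) (s⁻¹ • (x - v))) := by
      refine h1.trans ?_
      have := mul_le_mul_of_nonneg_left h5 (by positivity : 0 ≤ CG d (2*d+4) * (‖x-y‖/s) * (s^d)⁻¹)
      linarith
    have := mul_le_mul (hb.size v) h6 (abs_nonneg _) (mul_nonneg hκ (wt_pos d (d+2) (r⁻¹ • (v - z))).le)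
    linarith
  have e : (b x - avgOp d s p b x) - (b y - avgOp d s p b y) =
      (b x - b y) - ∫ v, b v * (pk d s (x - p v) - pk d s (y - p v)) := by
    simp only [mul_sub]
    rw [integral_sub (avg_integrable hs hbi hp x) (avg_integrable hs hbi hp y)]
    unfold avgOp; ring
  rw [e]
  refine (abs_sub _ _).trans ((add_le_add (hb.lip x y) key).trans ?_)
  have hn := norm_nonneg (x-y)
  have h7 : κ * ((CG d (2*d+4) * (‖x-y‖/s) * 2^(2*d+4)) * JJ d) * wt d (d+2) (r⁻¹ • (x - z)) ≤
     κ * ((CG d (2*d+4) * (‖x-y‖/s) * 2^(2*d+4)) * JJ d) * (wt d (d+2) (r⁻¹ • (x - z)) + wt d (d+2) (r⁻¹ • (y - z))) := by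
    gcongr; linarith
  have h8 : ‖x-y‖/ρ ≤ (s/ρ) * (‖x-y‖/h) := by
    rw [div_mul_div_comm, div_le_div_iff₀ hρ (by positivity)]
    have : ‖x-y‖ * h ≤ s * ‖x-y‖ := by rw [mul_comm]; gcongr
    nlinarith
  have h9 : ‖x-y‖/s = (h/s) * (‖x-y‖/h) := by field_simp
  refine (add_le_add le_rfl h7).trans ?_
  rw [← add_mul]
  apply mul_le_mul_of_nonneg_right _ (by positivity)
  rw [h9]
  set P := CG d (2*d+4) * 2^(2*d+4) * JJ d with hP
  have hP0 : 0 ≤ P := by positivity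
  have hCUe : CU d = 1 + 2 * P := rfl
  have hq : 0 ≤ ‖x-y‖/h := by positivity
  calc _ = κ * (‖x-y‖/ρ + P * ((h/s) * (‖x-y‖/h))) := by rw [hP]; ring
    _ ≤ κ * ((s/ρ) * (‖x-y‖/h) + P * ((h/s) * (‖x-y‖/h))) := by gcongr
    _ = κ * (((s/ρ) + P * (h/s)) * (‖x-y‖/h)) := by ring
    _ ≤ κ * ((CU d * (s/ρ + h/s)) * (‖x-y‖/h)) := by
        gcongr
        rw [hCUe]
        have : 0 ≤ s/ρ := by positivity
        have : 0 ≤ h/s := by positivity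
        nlinarith
    _ = _ := by ring
end step

/-- grid index -/
def idx (d : ℕ) (l : ℝ) (y : E d) : Fin d → ℤ := fun i => ⌊y i / l⌋

lemma idx_measurable (d : ℕ) (l : ℝ) : Measurable (idx d l) := by
  unfold idx
  refine measurable_pi_lambda _ fun i => ?_
  refine Int.measurable_floor.comp ?_
  have : Continuous (fun y : E d => y i / l) := by fun_prop
  exact this.measurable

/-- grid cube -/
def cub (d : ℕ) (l : ℝ) (y : E d) : Set (E d) := {v | idx d l v = idx d l y}

lemma cub_measurable (d : ℕ) (l : ℝ) (y : E d) : MeasurableSet (cub d l y) :=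
  (idx_measurable d l) (measurableSet_singleton (idx d l y))

lemma cub_rel_measurable (d : ℕ) (l : ℝ) :
    MeasurableSet {q : E d × E d | idx d l q.2 = idx d l q.1} :=
  measurableSet_eq_fun ((idx_measurable d l).comp measurable_snd)
    ((idx_measurable d l).comp measurable_fst)

lemma cub_vol (d : ℕ) {l : ℝ} (hl : 0 < l) (y : E d) : volume (cub d l y) = ENNReal.ofReal (l^d) := by
  have h := EuclideanSpace.volume_preserving_symm_measurableEquiv_toLp (Fin d)
  have e : cub d l y = (MeasurableEquiv.toLp 2 (Fin d → ℝ)).symm ⁻¹'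
      (Set.univ.pi fun i => Set.Ico (l * idx d l y i) (l * idx d l y i + l)) := by
    ext v
    simp only [cub, Set.mem_ofPred_eq, Set.mem_preimage, Set.mem_univ_pi, Set.mem_Ico, funext_iff]
    refine forall_congr' fun i => ?_
    have hv : (MeasurableEquiv.toLp 2 (Fin d → ℝ)).symm v i = v i := rfl
    rw [hv]
    conv_lhs => unfold idx
    rw [Int.floor_eq_iff]
    rw [le_div_iff₀ hl, div_lt_iff₀ hl]
    have : ((⌊y i / l⌋ : ℤ) : ℝ) = (idx d l y i : ℝ) := rfl
    rw [this]
    constructor <;> rintro ⟨h1, h2⟩ <;> constructor <;> linarith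
  rw [e, h.measure_preimage (MeasurableSet.univ_pi fun i => measurableSet_Ico).nullMeasurableSet,
    Real.volume_pi_Ico]
  simp [ENNReal.ofReal_pow hl.le]

lemma cub_norm (d : ℕ) {h : ℝ} (hh : 0 < h) (y v : E d) (hv : v ∈ cub d (h/(d+1)) y) : ‖v - y‖ ≤ h := by
  have hl : 0 < h/((d:ℝ)+1) := by positivity
  have h1 : ∀ i, ‖(v - y) i‖ ≤ h/((d:ℝ)+1) := by
    intro i
    have := congrFun hv i
    unfold idx at this
    have h2 : |v i / (h/((d:ℝ)+1)) - y i / (h/((d:ℝ)+1))| < 1 := Int.abs_sub_lt_one_of_floor_eq_floor this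
    have h3 : v i / (h/((d:ℝ)+1)) - y i / (h/((d:ℝ)+1)) = (v i - y i) / (h/((d:ℝ)+1)) := (_root_.sub_div _ _ _).symm
    rw [h3, abs_div, abs_of_pos hl, div_lt_one hl] at h2
    simpa using h2.le
  have h2 : ‖v - y‖^2 ≤ h^2 := by
    rw [EuclideanSpace.norm_sq_eq]
    calc _ ≤ ∑ i : Fin d, (h/((d:ℝ)+1))^2 := Finset.sum_le_sum fun i _ =>
          pow_le_pow_left₀ (norm_nonneg _) (h1 i) 2
      _ = d * (h/((d:ℝ)+1))^2 := by simp
      _ ≤ h^2 := by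
        rw [div_pow, mul_div_assoc', div_le_iff₀ (by positivity)]
        have : (d:ℝ) ≤ ((d:ℝ)+1)^2 := by nlinarith [(Nat.cast_nonneg d : (0:ℝ) ≤ d)]
        nlinarith [sq_nonneg h]
  exact le_of_sq_le_sq h2 hh.le

/-- average over the grid cube -/
def cavg (d : ℕ) (l : ℝ) (g : E d → ℝ≥0∞) (y : E d) : ℝ≥0∞ :=
  (ENNReal.ofReal (l^d))⁻¹ * ∫⁻ v in cub d l y, g v

lemma cub_select (d : ℕ) {l : ℝ} (hl : 0 < l) (g : E d → ℝ≥0∞) (hg : Measurable g) :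
    ∃ p : E d → E d, Measurable p ∧ ∀ y, p y ∈ cub d l y ∧ g (p y) ≤ cavg d l g y := by
  classical
  have key : ∀ j : Fin d → ℤ, ∃ q : E d, ∀ y, idx d l y = j → q ∈ cub d l y ∧ g q ≤ cavg d l g y := by
    intro j
    by_cases hj : ∃ y, idx d l y = j
    · obtain ⟨y, rfl⟩ := hj
      obtain ⟨q, hq, hq2⟩ := exists_le_setLAverage (μ := volume) (s := cub d l y) (f := g)
        (by rw [cub_vol d hl]; simp; positivity) (by rw [cub_vol d hl]; simp) hg.aemeasurable
      refine ⟨q, fun y' hy' => ?_⟩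
      have e : cub d l y' = cub d l y := by unfold cub; rw [hy']
      rw [e]
      refine ⟨hq, ?_⟩
      rw [setLAverage_eq, cub_vol d hl] at hq2
      unfold cavg
      rw [e, mul_comm, ← div_eq_mul_inv]
      exact hq2
    · exact ⟨0, fun y hy => absurd ⟨y, hy⟩ hj⟩
  choose q hq using key
  refine ⟨fun y => q (idx d l y), ?_, fun y => hq _ y rfl⟩
  exact (measurable_of_countable q).comp (idx_measurable d l)

lemma wt_annuli (d : ℕ) (u : E d) :
    ENNReal.ofReal (wt d (d+1) u) ≤ ∑' j : ℕ, (if ‖u‖ < 2^j then ENNReal.ofReal (2^(d+1) * ((2^j)^(d+1))⁻¹) else 0) := by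
  classical
  have hex : ∃ j : ℕ, ‖u‖ < 2^j := pow_unbounded_of_one_lt _ (by norm_num)
  set j := Nat.find hex with hj
  have h1 : ‖u‖ < 2^j := Nat.find_spec hex
  refine le_trans ?_ (ENNReal.le_tsum j)
  rw [if_pos h1]
  apply ENNReal.ofReal_le_ofReal
  unfold wt
  rw [← div_eq_mul_inv, inv_eq_one_div, div_le_div_iff₀ (by positivity) (by positivity), one_mul, ← mul_pow]
  apply pow_le_pow_left₀ (by positivity)
  rcases Nat.eq_zero_or_pos j with h0 | h0
  · rw [h0]; simp; linarith [norm_nonneg u]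
  · have h2 := Nat.find_min hex (m := j - 1) (by omega)
    push Not at h2
    have : (2:ℝ)^j = 2 * 2^(j-1) := by
      conv_lhs => rw [show j = (j-1)+1 by omega, pow_succ]
      ring
    rw [this]; linarith

lemma HL_ball (d : ℕ) (g : E d → ℝ≥0∞) (z : E d) {r : ℝ} (hr : 0 < r) :
    ∫⁻ y in ball z r, g y ≤ ENNReal.ofReal (r^d) * volume (ball (0:E d) 1) * HL d g z := by
  have h1 : (volume (ball z r))⁻¹ * ∫⁻ y in ball z r, g y ≤ HL d g z :=
    le_iSup₂ (f := fun (r : ℝ) (_ : 0 < r) => (volume (ball z r))⁻¹ * ∫⁻ y in ball z r, g y) r hr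
  rw [← vol_ball d z hr]
  rwa [ENNReal.inv_mul_le_iff (vol_ball_ne_zero d z hr) (vol_ball_ne_top d z r)] at h1

lemma wt_HL (d : ℕ) (g : E d → ℝ≥0∞) (hg : Measurable g) (z : E d) {r : ℝ} (hr : 0 < r) :
    ∫⁻ y, ENNReal.ofReal (wt d (d+1) (r⁻¹ • (y - z))) * g y ≤
      ENNReal.ofReal (2^(d+2)) * ENNReal.ofReal (r^d) * volume (ball (0:E d) 1) * HL d g z := by
  have hmem : ∀ (y : E d) (j : ℕ), ‖r⁻¹ • (y - z)‖ < 2^j ↔ y ∈ ball z (2^j * r) := by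
    intro y j
    rw [mem_ball, dist_eq_norm, norm_smul, Real.norm_of_nonneg (by positivity), inv_mul_lt_iff₀ hr, mul_comm]
  calc _ ≤ ∫⁻ y, ∑' j : ℕ, (if ‖r⁻¹ • (y - z)‖ < 2^j then ENNReal.ofReal (2^(d+1) * ((2^j)^(d+1))⁻¹) else 0) * g y := by
        apply lintegral_mono
        intro y
        simp only
        rw [ENNReal.tsum_mul_right]
        gcongr
        exact wt_annuli d _
    _ = ∑' j : ℕ, ENNReal.ofReal (2^(d+1) * ((2^j)^(d+1))⁻¹) * ∫⁻ y in ball z (2^j*r), g y := by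
        rw [lintegral_tsum]
        · congr 1; ext j
          rw [← lintegral_const_mul _ hg, ← lintegral_indicator measurableSet_ball]
          congr 1; ext y
          by_cases h : y ∈ ball z (2^j * r)
          · rw [Set.indicator_of_mem h, if_pos ((hmem y j).2 h)]
          · rw [Set.indicator_of_notMem h, if_neg (fun h' => h ((hmem y j).1 h')), zero_mul]
        · intro j
          refine (Measurable.mul ?_ hg).aemeasurable
          refine Measurable.ite ?_ measurable_const measurable_const
          simp_rw [hmem]
          exact measurableSet_ball
    _ ≤ ∑' j : ℕ, ENNReal.ofReal (2^(d+1)) * ENNReal.ofReal (r^d) * volume (ball (0:E d) 1) * HL d g z * 2⁻¹^j := by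
        apply ENNReal.tsum_le_tsum
        intro j
        have h1 := HL_ball d g z (r := 2^j*r) (by positivity)
        have e2 : (2⁻¹ : ℝ≥0∞)^j = ENNReal.ofReal ((2^j)⁻¹) := by
          rw [ENNReal.ofReal_inv_of_pos (by positivity), ENNReal.ofReal_pow (by norm_num), ENNReal.inv_pow]
          simp
        calc _ ≤ ENNReal.ofReal (2^(d+1) * ((2^j)^(d+1))⁻¹) * (ENNReal.ofReal ((2^j*r)^d) * volume (ball (0:E d) 1) * HL d g z) := by gcongr
          _ = ENNReal.ofReal (2^(d+1) * ((2^j)^(d+1))⁻¹ * (2^j*r)^d) * (volume (ball (0:E d) 1) * HL d g z) := by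
            rw [ENNReal.ofReal_mul (p := 2^(d+1) * ((2^j)^(d+1))⁻¹) (by positivity)]; ring
          _ = ENNReal.ofReal (2^(d+1) * r^d * (2^j)⁻¹) * (volume (ball (0:E d) 1) * HL d g z) := by
            congr 2
            rw [mul_pow]; field_simp; ring
          _ = _ := by
            rw [ENNReal.ofReal_mul (by positivity), ENNReal.ofReal_mul (by positivity), e2]; ring
          _ ≤ _ := le_rfl
    _ = _ := by
        rw [ENNReal.tsum_mul_left, ENNReal.tsum_geometric]
        have : (1 - (2⁻¹:ℝ≥0∞))⁻¹ = 2 := by rw [ENNReal.one_sub_inv_two, inv_inv]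
        rw [this, pow_succ 2 (d+1), ENNReal.ofReal_mul (by positivity)]
        simp only [ENNReal.ofReal_ofNat]; ring

lemma cavg_measurable (d : ℕ) (l : ℝ) (g : E d → ℝ≥0∞) (hg : Measurable g) : Measurable (cavg d l g) := by
  unfold cavg
  have : ∀ y, ∫⁻ v in cub d l y, g v = ∫⁻ v, {q : E d × E d | idx d l q.2 = idx d l q.1}.indicator
      (fun q => g q.2) (y, v) := by
    intro y
    rw [← lintegral_indicator (cub_measurable d l y)]
    rfl
  simp_rw [this]
  refine Measurable.const_mul ?_ _
  exact (((hg.comp measurable_snd).indicator (cub_rel_measurable d l))).lintegral_prod_right'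

lemma cavg_tonelli (d : ℕ) {h r : ℝ} (hh : 0 < h) (hhr : h ≤ r) (z : E d) (g : E d → ℝ≥0∞) (hg : Measurable g) :
    ∫⁻ y, ENNReal.ofReal (wt d (d+1) (r⁻¹ • (y - z))) * cavg d (h/(d+1)) g y ≤
      ENNReal.ofReal (2^(d+1)) * ∫⁻ y, ENNReal.ofReal (wt d (d+1) (r⁻¹ • (y - z))) * g y := by
  have hr : 0 < r := hh.trans_le hhr
  set l := h/((d:ℝ)+1) with hl
  have hl0 : 0 < l := by positivity
  set S := {q : E d × E d | idx d l q.2 = idx d l q.1} with hS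
  have hSm : MeasurableSet S := cub_rel_measurable d l
  set w : E d → ℝ≥0∞ := fun y => ENNReal.ofReal (wt d (d+1) (r⁻¹ • (y - z))) with hw
  have hwm : Measurable w := by
    have : Continuous (fun y : E d => wt d (d+1) (r⁻¹ • (y - z))) := (wt_continuous d (d+1)).comp (by fun_prop)
    exact this.measurable.ennreal_ofReal
  set c := (ENNReal.ofReal (l^d))⁻¹ with hc
  have hmeas : Measurable (fun q : E d × E d => S.indicator (fun q => w q.1 * (c * g q.2)) q) := by
    refine Measurable.indicator ?_ hSm
    exact (hwm.comp measurable_fst).mul ((hg.comp measurable_snd).const_mul _)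
  have e1 : ∀ y, w y * cavg d l g y = ∫⁻ v, S.indicator (fun q => w q.1 * (c * g q.2)) (y, v) := by
    intro y
    unfold cavg
    rw [← lintegral_const_mul _ hg, ← lintegral_const_mul _ (hg.const_mul _), ← lintegral_indicator (cub_measurable d l y)]
    rfl
  calc _ = ∫⁻ y, ∫⁻ v, S.indicator (fun q => w q.1 * (c * g q.2)) (y, v) := by
        exact lintegral_congr e1
    _ = ∫⁻ v, ∫⁻ y, S.indicator (fun q => w q.1 * (c * g q.2)) (y, v) := by
        exact lintegral_lintegral_swap (f := fun y v => S.indicator (fun q => w q.1 * (c * g q.2)) (y, v)) hmeas.aemeasurable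
    _ ≤ ∫⁻ v, ENNReal.ofReal (2^(d+1)) * (w v * g v) := by
        apply lintegral_mono
        intro v
        simp only
        have : ∀ y, S.indicator (fun q => w q.1 * (c * g q.2)) (y, v) ≤
            (cub d l v).indicator (fun _ => ENNReal.ofReal (2^(d+1)) * w v * (c * g v)) y := by
          intro y
          by_cases hy : y ∈ cub d l v
          · rw [Set.indicator_of_mem hy]
            refine (Set.indicator_le_self _ _ _).trans ?_
            simp only
            gcongr
            rw [hw]; simp only
            rw [← ENNReal.ofReal_mul (by positivity)]
            apply ENNReal.ofReal_le_ofReal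
            have h1 := wt_peetre d (d+1) (r⁻¹ • (v - z)) (r⁻¹ • (y - z))
            refine h1.trans ?_
            have h2 : ‖r⁻¹ • (v - z) - r⁻¹ • (y - z)‖ ≤ 1 := by
              rw [← smul_sub, norm_smul, Real.norm_of_nonneg (by positivity), inv_mul_le_iff₀ hr, mul_one]
              have e : v - z - (y - z) = -(y - v) := by abel
              rw [e, norm_neg]
              exact (cub_norm d hh v y hy).trans hhr
            have := (wt_pos d (d+1) (r⁻¹ • (v - z))).le
            gcongr
            linarith
          · rw [Set.indicator_of_notMem hy, Set.indicator_of_notMem]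
            intro h'
            exact hy (Eq.symm h')
        refine (lintegral_mono this).trans ?_
        rw [lintegral_indicator (cub_measurable d l v), lintegral_const, Measure.restrict_apply MeasurableSet.univ,
          Set.univ_inter, cub_vol d hl0]
        have hcc : c * ENNReal.ofReal (l^d) = 1 := ENNReal.inv_mul_cancel (by simp; positivity) (by simp)
        calc _ = ENNReal.ofReal (2^(d+1)) * w v * g v * (c * ENNReal.ofReal (l^d)) := by ring
          _ ≤ _ := by rw [hcc, mul_one, mul_assoc]
    _ = _ := lintegral_const_mul _ (hwm.mul hg)

/-- unit ball volume -/
def VD (d : ℕ) : ℝ≥0∞ := volume (ball (0:E d) 1)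

lemma VD_ne_top (d : ℕ) : VD d ≠ ∞ := vol_ball_ne_top d 0 1
lemma VD_ne_zero (d : ℕ) : VD d ≠ 0 := vol_ball_ne_zero d 0 one_pos

lemma cavg_le (d : ℕ) {h r : ℝ} (hh : 0 < h) (hhr : h ≤ r) (z : E d) (g : E d → ℝ≥0∞) (y : E d) :
    cavg d (h/(d+1)) g y ≤ ENNReal.ofReal ((2*(d+1)*(r/h))^d) * VD d * HL d g z *
      ENNReal.ofReal ((1 + ‖r⁻¹ • (y - z)‖)^d) := by
  have hr : 0 < r := hh.trans_le hhr
  have hl0 : 0 < h/((d:ℝ)+1) := by positivity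
  have hnorm : ‖r⁻¹ • (y - z)‖ = ‖y - z‖ / r := by
    rw [norm_smul, Real.norm_of_nonneg (by positivity)]; field_simp
  set D := 2 * r * (1 + ‖r⁻¹ • (y - z)‖) with hD
  have hD0 : 0 < D := by positivity
  have hDe : D = 2 * r + 2 * ‖y - z‖ := by rw [hD, hnorm]; field_simp
  have hsub : cub d (h/(d+1)) y ⊆ ball z D := by
    intro v hv
    have h1 := cub_norm d hh y v hv
    rw [mem_ball, dist_eq_norm, hDe]
    have : ‖v - z‖ ≤ ‖v - y‖ + ‖y - z‖ := norm_sub_le_norm_sub_add_norm_sub v y z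
    linarith [norm_nonneg (y - z)]
  unfold cavg
  have h2 := (lintegral_mono_set hsub).trans (HL_ball d g z hD0)
  calc _ ≤ (ENNReal.ofReal ((h/((d:ℝ)+1))^d))⁻¹ * (ENNReal.ofReal (D^d) * volume (ball (0:E d) 1) * HL d g z) := by gcongr
    _ = ENNReal.ofReal (((h/((d:ℝ)+1))^d)⁻¹ * D^d) * VD d * HL d g z := by
      rw [ENNReal.ofReal_mul (by positivity), ENNReal.ofReal_inv_of_pos (by positivity)]
      unfold VD; ring
    _ = _ := by
      have : ((h/((d:ℝ)+1))^d)⁻¹ * D^d = (2*(d+1)*(r/h))^d * (1 + ‖r⁻¹ • (y - z)‖)^d := by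
        rw [← inv_pow, ← mul_pow, ← mul_pow]; congr 1; rw [hD]; field_simp
      rw [this, ENNReal.ofReal_mul (by positivity)]; ring

lemma IK_bound (d : ℕ) {θ : ℝ} (hθ : 0 < θ) (hdθ : d * θ ≤ 1) {h r : ℝ} (hh : 0 < h) (hhr : h ≤ r) (z : E d)
    (g : E d → ℝ≥0∞) (hg : Measurable g) :
    ∫⁻ y, ENNReal.ofReal (wt d (d+2) (r⁻¹ • (y - z))) * (cavg d (h/(d+1)) g y)^(1+θ) ≤
      (ENNReal.ofReal ((2*(d+1)*(r/h))^d) * VD d)^θ *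
      (ENNReal.ofReal (2^(d+1)) * ENNReal.ofReal (2^(d+2)) * ENNReal.ofReal (r^d) * VD d) * (HL d g z)^(1+θ) := by
  have hr : 0 < r := hh.trans_le hhr
  have hwm : Measurable (fun y : E d => ENNReal.ofReal (wt d (d+1) (r⁻¹ • (y - z)))) := by
    have : Continuous (fun y : E d => wt d (d+1) (r⁻¹ • (y - z))) := (wt_continuous d (d+1)).comp (by fun_prop)
    exact this.measurable.ennreal_ofReal
  set A := ENNReal.ofReal ((2*(d+1)*(r/h))^d) * VD d with hA
  set H := HL d g z
  have hadd : ∀ a : ℝ≥0∞, a^(1+θ) = a^θ * a := fun a => by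
    rw [add_comm, ENNReal.rpow_add_of_nonneg _ _ hθ.le zero_le_one, ENNReal.rpow_one]
  have pt : ∀ y, ENNReal.ofReal (wt d (d+2) (r⁻¹ • (y - z))) * (cavg d (h/(d+1)) g y)^(1+θ) ≤
      (A^θ * H^θ) * (ENNReal.ofReal (wt d (d+1) (r⁻¹ • (y - z))) * cavg d (h/(d+1)) g y) := by
    intro y
    set u := r⁻¹ • (y - z)
    have h1 : (cavg d (h/(d+1)) g y)^θ ≤ A^θ * H^θ * ENNReal.ofReal (1 + ‖u‖) := by
      refine (ENNReal.rpow_le_rpow (cavg_le d hh hhr z g y) hθ.le).trans ?_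
      rw [ENNReal.mul_rpow_of_nonneg _ _ hθ.le, ENNReal.mul_rpow_of_nonneg _ _ hθ.le]
      gcongr
      rw [ENNReal.ofReal_rpow_of_nonneg (by positivity) hθ.le]
      apply ENNReal.ofReal_le_ofReal
      rw [← Real.rpow_natCast, ← Real.rpow_mul (by positivity)]
      have h1 : 1 ≤ 1 + ‖u‖ := by linarith [norm_nonneg u]
      calc _ ≤ (1 + ‖u‖)^(1:ℝ) := Real.rpow_le_rpow_of_exponent_le h1 hdθ
        _ = _ := by simp
    rw [hadd]
    have e : wt d (d+2) u * (1 + ‖u‖) = wt d (d+1) u := by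
      have := wt_mul_pow d (d+1) 1 u
      simpa using this
    calc _ ≤ ENNReal.ofReal (wt d (d+2) u) * ((A^θ * H^θ * ENNReal.ofReal (1 + ‖u‖)) * cavg d (h/(d+1)) g y) := by gcongr
      _ = (A^θ * H^θ) * ((ENNReal.ofReal (wt d (d+2) u) * ENNReal.ofReal (1 + ‖u‖)) * cavg d (h/(d+1)) g y) := by ring
      _ = _ := by rw [← ENNReal.ofReal_mul (wt_pos _ _ _).le, e]
  refine (lintegral_mono pt).trans ?_
  refine (lintegral_const_mul _ (hwm.mul (cavg_measurable d _ g hg))).le.trans ?_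
  refine (mul_le_mul_right ((cavg_tonelli d hh hhr z g hg).trans (mul_le_mul_right (wt_HL d g hg z hr) _)) _).trans ?_
  rw [hadd]
  apply le_of_eq
  unfold VD
  ring

/-- heat-type average -/
def Pf (d : ℕ) (t : ℝ) (f : E d → ℝ) (x : E d) : ℝ := ∫ z, pk d t (x - z) * f z

/-- the scale of level n -/
def RR (n : ℤ) : ℝ := (2:ℝ) ^ (-(n:ℝ)/2)

lemma RR_pos (n : ℤ) : 0 < RR n := by unfold RR; positivity

lemma Pf_le (d : ℕ) (n : ℤ) (f : E d → ℝ) {t : ℝ} (ht : 0 < t) (htR : t < RR n) (x : E d) :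
    ENNReal.ofReal |Pf d t f x| ≤ MnMax d n f x :=
  le_iSup₂ (f := fun (t : ℝ) (_ : 0 < t ∧ t < (2:ℝ) ^ (-(n:ℝ)/2)) =>
    ENNReal.ofReal |∫ z, t ^ (-(d:ℝ)) * gaussP d (t⁻¹ • (x - z)) * f z|) t ⟨ht, htR⟩

lemma Pf_continuous (d : ℕ) {f : E d → ℝ} (hf : Integrable f) {t : ℝ} (ht : 0 < t) : Continuous (Pf d t f) := by
  unfold Pf
  refine continuous_of_dominated (bound := fun z => CG d 0 * (t^d)⁻¹ * |f z|) ?_ ?_ ?_ ?_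
  · intro x
    exact (((pk_continuous d t).comp (by fun_prop)).aestronglyMeasurable).mul hf.aestronglyMeasurable
  · intro x
    filter_upwards with z
    rw [norm_mul, Real.norm_of_nonneg (pk_nonneg d ht _)]
    exact mul_le_mul_of_nonneg_right (pk_bdd d ht _) (abs_nonneg _)
  · exact hf.abs.const_mul _
  · filter_upwards with z
    exact ((pk_continuous d t).comp (by fun_prop)).mul continuous_const

lemma MnMax_lsc (d : ℕ) (n : ℤ) {f : E d → ℝ} (hf : Integrable f) : LowerSemicontinuous (MnMax d n f) := by
  unfold MnMax
  refine lowerSemicontinuous_iSup fun t => lowerSemicontinuous_iSup fun ht => ?_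
  have : Continuous (fun x => ENNReal.ofReal |Pf d t f x|) :=
    ENNReal.continuous_ofReal.comp (Pf_continuous d hf ht.1).abs
  exact this.lowerSemicontinuous

lemma fubini_step (d : ℕ) (n : ℤ) {f b : E d → ℝ} (hf : Integrable f) (hb : Integrable b) {s : ℝ} (hs : 0 < s) (hsR : s < RR n)
    {p : E d → E d} (hp : Measurable p) :
    Integrable (fun x => f x * avgOp d s p b x) ∧
    ENNReal.ofReal |∫ x, f x * avgOp d s p b x| ≤ ∫⁻ y, ENNReal.ofReal |b y| * MnMax d n f (p y) := by
  have hi : Integrable (Function.uncurry fun x y => f x * (b y * pk d s (x - p y))) (volume.prod volume) := by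
    have h1 := (hf.mul_prod hb).mul_bdd (f := fun q : E d × E d => f q.1 * b q.2) (g := fun q : E d × E d => pk d s (q.1 - p q.2)) (c := CG d 0 * (s^d)⁻¹)
      ((pk_continuous d s).measurable.comp (measurable_fst.sub (hp.comp measurable_snd))).aestronglyMeasurable
      (by
        filter_upwards with q
        rw [Real.norm_of_nonneg (pk_nonneg d hs _)]
        exact pk_bdd d hs _)
    refine h1.congr ?_
    filter_upwards with q
    simp only [Function.uncurry]; ring
  have e0 : ∀ x, f x * avgOp d s p b x = ∫ y, f x * (b y * pk d s (x - p y)) := fun x => by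
    unfold avgOp; rw [integral_const_mul]
  constructor
  · simp_rw [e0]
    exact hi.integral_prod_left
  · simp_rw [e0]
    rw [integral_integral_swap hi]
    have e1 : ∀ y, ∫ x, f x * (b y * pk d s (x - p y)) = b y * Pf d s f (p y) := by
      intro y
      unfold Pf
      rw [← integral_const_mul]
      congr 1; ext x
      rw [← pk_symm d s (x - p y), neg_sub]; ring
    simp_rw [e1]
    have := enorm_integral_le_lintegral_enorm (μ := volume) (fun y => b y * Pf d s f (p y))
    rw [← ofReal_norm, Real.norm_eq_abs] at this
    refine this.trans (lintegral_mono fun y => ?_)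
    simp only
    rw [← ofReal_norm, Real.norm_eq_abs, abs_mul, ENNReal.ofReal_mul (abs_nonneg _)]
    gcongr
    exact Pf_le d n f hs hsR _

lemma uch_induct (d : ℕ) (n : ℤ) {θ A : ℝ} (hθ : 0 < θ) (hdθ : d * θ ≤ 1) (hA : 1 < A) 
    {f : E d → ℝ} (hf : Integrable f) {r : ℝ} (hr : 0 < r) (hrR : r ≤ RR n) (z : E d)
    (q Y e : ℝ≥0∞)
    (he : e = ENNReal.ofReal (CU d * (2 / A)))
    (hq : q = ENNReal.ofReal ((A^2)^d)^θ)
    (hY : Y = q * (ENNReal.ofReal ((2*(d+1))^d) * VD d)^θ *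
      (ENNReal.ofReal (2^(d+1)) * ENNReal.ofReal (2^(d+2)) * ENNReal.ofReal (r^d) * VD d) * (HL d (fun x => (MnMax d n f x)^(1/(1+θ))) z)^(1+θ))
    (K : ℕ) : ∀ (k : ℕ) (κ : ℝ) (b : E d → ℝ), 0 ≤ κ → BC d z r κ (((A^2)⁻¹)^k * r) b →
    ENNReal.ofReal |∫ x, f x * b x| ≤ ENNReal.ofReal κ * (q^k * Y * ∑ j ∈ Finset.range K, (e*q)^j + e^K * ∫⁻ x, ENNReal.ofReal |f x|) := by
  set g : E d → ℝ≥0∞ := fun x => (MnMax d n f x)^(1/(1+θ)) with hg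
  have hgm : Measurable g := (MnMax_lsc d n hf).measurable.pow_const _
  have hgp : ∀ x, g x ^ (1+θ) = MnMax d n f x := fun x => by
    rw [hg]; simp only
    rw [← ENNReal.rpow_mul, one_div, inv_mul_cancel₀ (by positivity), ENNReal.rpow_one]
  have hA0 : 0 < A := by linarith
  have hCU := CU_pos d
  induction K with
  | zero =>
    intro k κ b hκ hb
    simp only [Finset.range_zero, Finset.sum_empty, mul_zero, pow_zero, one_mul, zero_add]
    have := enorm_integral_le_lintegral_enorm (μ := volume) (fun y => f y * b y)
    rw [← ofReal_norm, Real.norm_eq_abs] at this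
    refine this.trans ?_
    rw [← lintegral_const_mul' _ _ ENNReal.ofReal_ne_top]
    refine lintegral_mono fun y => ?_
    simp only
    rw [← ofReal_norm, Real.norm_eq_abs, abs_mul, mul_comm, ENNReal.ofReal_mul (abs_nonneg _)]
    gcongr
    refine (hb.size y).trans ?_
    have := wt_le_one d (d+2) (r⁻¹ • (y - z))
    nlinarith
  | succ K ih =>
    intro k κ b hκ hb
    set ρ := ((A^2)⁻¹)^k * r with hρ
    set h := ((A^2)⁻¹)^(k+1) * r with hh
    have hη1 : (A^2)⁻¹ ≤ 1 := inv_le_one_of_one_le₀ (by nlinarith)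
    have hρ0 : 0 < ρ := by positivity
    have hh0 : 0 < h := by positivity
    have hhρ : h = (A^2)⁻¹ * ρ := by rw [hh, hρ, pow_succ]; ring
    have hρr : ρ ≤ r := by
      rw [hρ]
      have : ((A^2)⁻¹)^k ≤ 1 := pow_le_one₀ (by positivity) hη1
      nlinarith
    have hs_eq : A * h = A⁻¹ * ρ := by rw [hhρ]; field_simp
    have hA1 : A⁻¹ < 1 := inv_lt_one_of_one_lt₀ hA
    have hsr : A * h < r := by rw [hs_eq]; nlinarith
    have hhs : h ≤ A * h := by nlinarith
    have hhr : h ≤ r := by linarith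
    obtain ⟨p, hpm, hp⟩ := cub_select d (l := h/((d:ℝ)+1)) (by positivity) g hgm
    have hph : ∀ y, ‖p y - y‖ ≤ h := fun y => cub_norm d hh0 y (p y) (hp y).1
    have hBC := step_BC hκ hρ0 hh0 hhs hsr.le hb hpm hph
    have e1 : A*h/ρ + h/(A*h) = 2 / A := by rw [hs_eq, hhρ]; field_simp; norm_num
    rw [e1] at hBC
    have ih' := ih (k+1) _ _ (by positivity) hBC
    have hbi := hb.integrable hκ hρ0 hr
    obtain ⟨hi, hF⟩ := fubini_step d n hf hbi (by positivity : 0 < A*h) (hsr.trans_le hrR) hpm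
    have hfb : Integrable (fun x => f x * b x) := by
      refine hf.mul_bdd (c := κ) (hb.continuous hκ hρ0).aestronglyMeasurable ?_
      filter_upwards with y
      refine (hb.size y).trans ?_
      have := wt_le_one d (d+2) (r⁻¹ • (y - z))
      nlinarith
    have e2 : ∫ x, f x * b x = (∫ x, f x * avgOp d (A*h) p b x) + ∫ x, f x * (b x - avgOp d (A*h) p b x) := by
      simp_rw [mul_sub]
      rw [integral_sub hfb hi]; ring
    have hI : ∫⁻ y, ENNReal.ofReal |b y| * MnMax d n f (p y) ≤ ENNReal.ofReal κ * (q^k * Y) := by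
      calc _ ≤ ∫⁻ y, ENNReal.ofReal κ * (ENNReal.ofReal (wt d (d+2) (r⁻¹ • (y - z))) * (cavg d (h/(d+1)) g y)^(1+θ)) := by
            refine lintegral_mono fun y => ?_
            simp only
            rw [← mul_assoc, ← ENNReal.ofReal_mul hκ, ← hgp]
            gcongr
            · exact hb.size y
            · exact (hp y).2
        _ = ENNReal.ofReal κ * ∫⁻ y, (ENNReal.ofReal (wt d (d+2) (r⁻¹ • (y - z))) * (cavg d (h/(d+1)) g y)^(1+θ)) :=
            lintegral_const_mul' _ _ ENNReal.ofReal_ne_top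
        _ ≤ ENNReal.ofReal κ * (q^k * Y) := by
            gcongr
            refine (IK_bound d hθ hdθ hh0 hhr z g hgm).trans (le_of_eq ?_)
            rw [hY]
            have e3 : (2*((d:ℝ)+1)*(r/h))^d = (2*((d:ℝ)+1))^d * ((A^2)^d)^(k+1) := by
              rw [mul_pow]; congr 1
              rw [← pow_mul, mul_comm d, pow_mul]; congr 1
              rw [hh, inv_pow]; field_simp
            have e4 : (ENNReal.ofReal ((2*((d:ℝ)+1)*(r/h))^d) * VD d)^θ = q^(k+1) * (ENNReal.ofReal ((2*(d+1))^d) * VD d)^θ := by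
              rw [e3, ENNReal.ofReal_mul (by positivity), hq]
              rw [mul_right_comm, ENNReal.mul_rpow_of_nonneg _ _ hθ.le, mul_comm]
              congr 1
              rw [ENNReal.ofReal_pow (by positivity), ← ENNReal.rpow_natCast, ← ENNReal.rpow_mul,
                ← ENNReal.rpow_natCast, ← ENNReal.rpow_mul, mul_comm θ]
            rw [e4, pow_succ]; ring
    rw [e2]
    refine (ENNReal.ofReal_le_ofReal (abs_add_le _ _)).trans ?_
    rw [ENNReal.ofReal_add (abs_nonneg _) (abs_nonneg _)]
    refine (add_le_add (hF.trans hI) ih').trans (le_of_eq ?_)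
    rw [ENNReal.ofReal_mul hκ, ← he, Finset.sum_range_succ']
    have : ∑ j ∈ Finset.range K, (e*q)^(j+1) = e * q * ∑ j ∈ Finset.range K, (e*q)^j := by
      rw [Finset.mul_sum]; congr 1; ext j; rw [pow_succ]; ring
    rw [this]; ring

lemma exists_theta (d : ℕ) {B : ℝ} (hB : 1 ≤ B) : ∃ θ : ℝ, 0 < θ ∧ d * θ ≤ 1 ∧ B^θ ≤ 3/2 := by
  have h1 : Tendsto (fun θ : ℝ => B^θ) (𝓝 0) (𝓝 (B^(0:ℝ))) :=
    (Real.continuous_const_rpow (by linarith)).tendsto 0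
  rw [Real.rpow_zero] at h1
  have h2 : Tendsto (fun θ : ℝ => d * θ) (𝓝 0) (𝓝 (d * 0)) := (continuous_const.mul continuous_id).tendsto 0
  rw [mul_zero] at h2
  have h3 := (h1.eventually (ge_mem_nhds (by norm_num : (1:ℝ) < 3/2))).and (h2.eventually (ge_mem_nhds zero_lt_one))
  obtain ⟨ε, hε, h⟩ := Metric.eventually_nhds_iff.1 h3
  have h4 := @h (ε/2) (by rw [Real.dist_eq]; simp; rw [abs_of_pos (by linarith)]; linarith)
  exact ⟨ε/2, by positivity, h4.2, h4.1⟩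

lemma uch (d : ℕ) : ∃ (C : ℝ≥0∞) (θ : ℝ), C ≠ ∞ ∧ 0 < θ ∧ ∀ (n : ℤ) (f : E d → ℝ), Integrable f →
    ∀ (r : ℝ) (z : E d) (b : E d → ℝ), 0 < r → r ≤ RR n → BC d z r 1 r b →
    ENNReal.ofReal |∫ x, f x * b x| ≤ C * ENNReal.ofReal (r^d) * (HL d (fun x => (MnMax d n f x)^(1/(1+θ))) z)^(1+θ) := by
  have hCU := CU_pos d
  set A := 4 * CU d + 2 with hA
  have hA1 : 1 < A := by linarith
  obtain ⟨θ, hθ, hdθ, hB⟩ := exists_theta d (B := (A^2)^d) (one_le_pow₀ (by nlinarith))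
  set q : ℝ≥0∞ := ENNReal.ofReal ((A^2)^d)^θ with hq
  have hq1 : q ≤ ENNReal.ofReal (3/2) := by
    rw [hq, ENNReal.ofReal_rpow_of_nonneg (by positivity) hθ.le]
    exact ENNReal.ofReal_le_ofReal hB
  have hqt : q ≠ ∞ := ne_top_of_le_ne_top ENNReal.ofReal_ne_top hq1
  set e : ℝ≥0∞ := ENNReal.ofReal (CU d * (2 / A)) with he
  have he1 : e ≤ ENNReal.ofReal (1/2) := by
    apply ENNReal.ofReal_le_ofReal
    rw [mul_div_assoc', div_le_div_iff₀ (by linarith) (by norm_num)]; linarith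
  have heq : e * q ≤ ENNReal.ofReal (3/4) := by
    refine (mul_le_mul' he1 hq1).trans ?_
    rw [← ENNReal.ofReal_mul (by norm_num)]; norm_num
  set c0 := q * (ENNReal.ofReal ((2*(d+1))^d) * VD d)^θ *
      (ENNReal.ofReal (2^(d+1)) * ENNReal.ofReal (2^(d+2)) * VD d) with hc0
  have hVt := VD_ne_top d
  refine ⟨c0 * 4, θ, ?_, hθ, ?_⟩
  · have h1 : (ENNReal.ofReal ((2*(d+1))^d) * VD d)^θ ≠ ∞ :=
      ENNReal.rpow_ne_top_of_nonneg hθ.le (ENNReal.mul_ne_top ENNReal.ofReal_ne_top hVt)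
    refine ENNReal.mul_ne_top (ENNReal.mul_ne_top (ENNReal.mul_ne_top hqt h1) (ENNReal.mul_ne_top (ENNReal.mul_ne_top ENNReal.ofReal_ne_top ENNReal.ofReal_ne_top) hVt)) (by norm_num)
  intro n f hf r z b hr hrR hb
  set H := (HL d (fun x => (MnMax d n f x)^(1/(1+θ))) z)^(1+θ) with hH
  have key := fun K => uch_induct d n hθ hdθ hA1 hf hr hrR z q _ e he hq rfl K 0 1 b zero_le_one (by simpa using hb)
  have hF : ∫⁻ x, ENNReal.ofReal |f x| ≠ ∞ := by
    have := hf.2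
    simp only [HasFiniteIntegral, ← ofReal_norm, Real.norm_eq_abs] at this
    exact this.ne
  set F := ∫⁻ x, ENNReal.ofReal |f x| with hFd
  have hlim : Tendsto (fun K : ℕ => c0 * 4 * ENNReal.ofReal (r^d) * H + e^K * F) atTop (𝓝 (c0 * 4 * ENNReal.ofReal (r^d) * H + 0 * F)) := by
    refine Tendsto.add tendsto_const_nhds (ENNReal.Tendsto.mul_const ?_ (Or.inr hF))
    refine ENNReal.tendsto_pow_atTop_nhds_zero_of_lt_one (he1.trans_lt ?_)
    rw [ENNReal.ofReal_lt_one]; norm_num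
  rw [zero_mul, add_zero] at hlim
  refine ge_of_tendsto' hlim fun K => (key K).trans ?_
  simp only [ENNReal.ofReal_one, one_mul, pow_zero]
  refine add_le_add ?_ le_rfl
  have hsum : ∑ j ∈ Finset.range K, (e*q)^j ≤ 4 := by
    refine (ENNReal.sum_le_tsum _).trans ?_
    rw [ENNReal.tsum_geometric]
    calc _ ≤ (1 - ENNReal.ofReal (3/4))⁻¹ := by gcongr
      _ = 4 := by
        rw [← ENNReal.ofReal_one, ← ENNReal.ofReal_sub _ (by norm_num), ← ENNReal.ofReal_inv_of_pos (by norm_num)]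
        norm_num
  refine (mul_le_mul_right hsum _).trans (le_of_eq ?_)
  rw [hc0]; ring

lemma bump_BC (d : ℕ) (z : E d) {r : ℝ} (hr : 0 < r) (b : E d → ℝ) (h1 : ∀ x, |b x| ≤ 1)
    (h0 : ∀ x, x ∉ ball z r → b x = 0) (hL : ∀ x y, |b x - b y| ≤ ‖x - y‖/r) :
    BC d z r 1 r (fun x => (2^(d+2))⁻¹ * b x) := by
  have hw : ∀ x ∈ ball z r, ((2:ℝ)^(d+2))⁻¹ ≤ wt d (d+2) (r⁻¹ • (x - z)) := by
    intro x hx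
    unfold wt
    apply inv_anti₀ (by positivity)
    apply pow_le_pow_left₀ (by positivity)
    rw [norm_smul, Real.norm_of_nonneg (by positivity)]
    rw [mem_ball, dist_eq_norm] at hx
    have : r⁻¹ * ‖x - z‖ ≤ 1 := by rw [inv_mul_le_iff₀ hr]; linarith
    linarith
  have hwp := fun x => wt_pos d (d+2) (r⁻¹ • (x - z))
  have h2p : (0:ℝ) < (2^(d+2))⁻¹ := by positivity
  constructor
  · intro x
    rw [abs_mul, abs_of_pos h2p, one_mul]
    by_cases hx : x ∈ ball z r
    · have := hw x hx; have := h1 x; nlinarith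
    · rw [h0 x hx]; simp; exact (hwp x).le
  · intro x y
    rw [← mul_sub, abs_mul, abs_of_pos h2p, one_mul, mul_comm]
    by_cases hx : x ∈ ball z r
    · have := hw x hx
      exact mul_le_mul (hL x y) (by linarith [hwp y]) h2p.le (by positivity)
    by_cases hy : y ∈ ball z r
    · have := hw y hy
      exact mul_le_mul (hL x y) (by linarith [hwp x]) h2p.le (by positivity)
    rw [h0 x hx, h0 y hy]; simp
    have := hwp x; have := hwp y
    positivity

/-- property of a grand maximal majorant -/
structure Grand (d : ℕ) (R : ℝ) (f : E d → ℝ) (G : E d → ℝ≥0∞) : Prop where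
  lsc : LowerSemicontinuous G
  bump : ∀ (r L : ℝ) (z : E d) (b : E d → ℝ), 0 < r → r ≤ R → 0 ≤ L → (∀ x, |b x| ≤ L) →
    (∀ x, x ∉ ball z r → b x = 0) → (∀ x y, |b x - b y| ≤ L * (‖x - y‖/r)) →
    ENNReal.ofReal |∫ x, f x * b x| ≤ ENNReal.ofReal (L * r^d) * G z
  ae : ∀ᵐ x, ENNReal.ofReal |f x| ≤ G x

lemma hat_props (d : ℕ) (z : E d) {r : ℝ} (hr : 0 < r) :
    (∀ x, |max 0 (1 - ‖x - z‖/r)| ≤ 1) ∧ (∀ x, x ∉ ball z r → max 0 (1 - ‖x - z‖/r) = 0) ∧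
    (∀ x y : E d, |max 0 (1 - ‖x - z‖/r) - max 0 (1 - ‖y - z‖/r)| ≤ ‖x - y‖/r) := by
  refine ⟨fun x => ?_, fun x hx => ?_, fun x y => ?_⟩
  · rw [abs_of_nonneg (le_max_left _ _)]
    apply max_le zero_le_one
    have : 0 ≤ ‖x - z‖/r := by positivity
    linarith
  · apply max_eq_left
    rw [mem_ball, dist_eq_norm] at hx
    push Not at hx
    have : 1 ≤ ‖x - z‖/r := (one_le_div hr).2 hx
    linarith
  · refine (abs_max_sub_max_le_max _ _ _ _).trans ?_
    simp only [sub_self, abs_zero]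
    have e : 1 - ‖x - z‖ / r - (1 - ‖y - z‖ / r) = (‖y - z‖ - ‖x - z‖)/r := by ring
    rw [max_eq_right (abs_nonneg _), e, abs_div, abs_of_pos hr]
    gcongr
    have := abs_norm_sub_norm_le (y - z) (x - z)
    rw [sub_sub_sub_cancel_right, norm_sub_rev y x] at this
    exact this

lemma grand_ae (d : ℕ) {R : ℝ} (hR : 0 < R) {f : E d → ℝ} (hf : Integrable f) {G : E d → ℝ≥0∞}
    (hb : ∀ (r : ℝ) (z : E d) (b : E d → ℝ), 0 < r → r ≤ R → (∀ x, |b x| ≤ 1) →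
    (∀ x, x ∉ ball z r → b x = 0) → (∀ x y, |b x - b y| ≤ (‖x - y‖/r)) →
    ENNReal.ofReal |∫ x, f x * b x| ≤ ENNReal.ofReal (r^d) * G z) :
    ∀ᵐ x, ENNReal.ofReal |f x| ≤ ENNReal.ofReal (2^(d+1)) * (VD d)⁻¹ * G x := by
  have hV0 := VD_ne_zero d
  have hVt := VD_ne_top d
  set v := (VD d).toReal with hv
  have hv0 : 0 < v := ENNReal.toReal_pos hV0 hVt
  have hvol : ∀ (x : E d) {r : ℝ}, 0 < r → volume.real (ball x r) = r^d * v := by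
    intro x r hr
    rw [Measure.real, vol_ball d x hr, ENNReal.toReal_mul, ENNReal.toReal_ofReal (by positivity)]; rfl
  filter_upwards [IsUnifLocDoublingMeasure.ae_tendsto_average_norm_sub volume hf.locallyIntegrable 1] with x hx
  rcases eq_or_ne (G x) ∞ with hG | hG
  · rw [hG, ENNReal.mul_top]
    · exact le_top
    · exact mul_ne_zero (by simp) (ENNReal.inv_ne_zero.2 hVt)
  set r : ℕ → ℝ := fun j => R / (j+1) with hr
  have hr0 : ∀ j, 0 < r j := fun j => by simp only [hr]; positivity
  have hrR : ∀ j, r j ≤ R := fun j => div_le_self hR.le (by linarith [(Nat.cast_nonneg j : (0:ℝ) ≤ j)])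
  have hrt : Tendsto r atTop (𝓝[>] 0) := by
    refine tendsto_nhdsWithin_iff.2 ⟨?_, Eventually.of_forall hr0⟩
    have := (tendsto_one_div_add_atTop_nhds_zero_nat (𝕜 := ℝ)).const_mul R
    simpa [hr, div_eq_mul_inv] using this
  have h1 := hx (fun _ => x) r hrt (Eventually.of_forall fun j => mem_closedBall_self (by simpa using (hr0 j).le))
  clear_value r
  have hvolc : ∀ (x : E d) {r : ℝ}, 0 < r → volume.real (closedBall x r) = r^d * v := by
    intro x r hr
    rw [Measure.real, Measure.addHaar_closedBall _ _ hr.le, ENNReal.toReal_mul, ENNReal.toReal_ofReal (by positivity)]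
    simp only [finrank_euclideanSpace, Fintype.card_fin]; rfl
  have main : ∀ j, |f x| * ((2^(d+1))⁻¹ * v) ≤ (G x).toReal + v * ⨍ y in closedBall x (r j), ‖f y - f x‖ := by
    intro j
    obtain ⟨p1, p2, p3⟩ := hat_props d x (hr0 j)
    set b : E d → ℝ := fun y => max 0 (1 - ‖y - x‖/(r j)) with hbd
    have hbc : Continuous b := by rw [hbd]; fun_prop
    have hb0 : ∀ y, 0 ≤ b y := fun y => le_max_left _ _
    have h2 := hb (r j) x b (hr0 j) (hrR j) p1 p2 p3
    have h2' : |∫ y, f y * b y| ≤ (r j)^d * (G x).toReal := by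
      have := ENNReal.toReal_mono (ENNReal.mul_ne_top ENNReal.ofReal_ne_top hG) h2
      rwa [ENNReal.toReal_ofReal (abs_nonneg _), ENNReal.toReal_mul, ENNReal.toReal_ofReal (pow_nonneg (hr0 j).le _)] at this
    have hbi : Integrable b := by
      refine hbc.integrable_of_hasCompactSupport ?_
      refine HasCompactSupport.intro (isCompact_closedBall x (r j)) fun y hy => p2 y fun h => hy (ball_subset_closedBall h)
    have hfb : Integrable (fun y => f y * b y) := hf.mul_bdd (c := 1) hbc.aestronglyMeasurable (Eventually.of_forall p1)
    have e1 : f x * ∫ y, b y = (∫ y, f y * b y) - ∫ y, (f y - f x) * b y := by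
      have : ∀ y, (f y - f x) * b y = f y * b y - f x * b y := fun y => by ring
      simp_rw [this]
      rw [integral_sub hfb (hbi.const_mul _), integral_const_mul]; ring
    have h3 : (r j)^d * ((2^(d+1))⁻¹ * v) ≤ ∫ y, b y := by
      have : ∫ y in ball x (r j/2), (1/2:ℝ) ≤ ∫ y, b y := by
        rw [← integral_indicator measurableSet_ball]
        refine integral_mono_of_nonneg ?_ hbi ?_
        · exact Eventually.of_forall fun y => Set.indicator_nonneg (fun _ _ => by norm_num) y
        · refine Eventually.of_forall fun y => ?_
          refine Set.indicator_le' (fun y hy => ?_) (fun y _ => hb0 y) y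
          refine le_trans ?_ (le_max_right _ _)
          rw [mem_ball, dist_eq_norm] at hy
          have : ‖y - x‖/(r j) ≤ 1/2 := by rw [div_le_iff₀ (hr0 j)]; linarith
          linarith
      refine le_trans (le_of_eq ?_) this
      rw [setIntegral_const, hvol x (by have := hr0 j; positivity), smul_eq_mul]
      rw [div_pow, pow_succ]; field_simp
    have h4 : |∫ y, (f y - f x) * b y| ≤ (r j)^d * (v * ⨍ y in closedBall x (r j), ‖f y - f x‖) := by
      have e2 : (r j)^d * (v * ⨍ y in closedBall x (r j), ‖f y - f x‖) = ∫ y in closedBall x (r j), ‖f y - f x‖ := by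
        rw [setAverage_eq, hvolc x (hr0 j), smul_eq_mul]
        have := hr0 j
        field_simp
      rw [e2, ← integral_indicator measurableSet_closedBall]
      have hii : IntegrableOn (fun y => ‖f y - f x‖) (closedBall x (r j)) :=
        (hf.integrableOn.sub (integrableOn_const (by exact measure_closedBall_lt_top.ne))).norm
      refine norm_integral_le_of_norm_le (f := fun y => (f y - f x) * b y) (hii.integrable_indicator measurableSet_closedBall) ?_
      refine Eventually.of_forall fun y => ?_
      by_cases hy : y ∈ closedBall x (r j)
      · rw [Set.indicator_of_mem hy, norm_mul]
        exact mul_le_of_le_one_right (norm_nonneg _) (p1 y)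
      · rw [Set.indicator_of_notMem hy]
        have : b y = 0 := p2 y fun h => hy (ball_subset_closedBall h)
        simp [this]
    have h5 : |f x| * ∫ y, b y ≤ (r j)^d * (G x).toReal + (r j)^d * (v * ⨍ y in closedBall x (r j), ‖f y - f x‖) := by
      have : |f x| * ∫ y, b y = |f x * ∫ y, b y| := by
        rw [abs_mul, abs_of_nonneg (integral_nonneg hb0)]
      rw [this, e1]
      exact (abs_sub _ _).trans (add_le_add h2' h4)
    have h6 := mul_le_mul_of_nonneg_left h3 (abs_nonneg (f x))
    have hrp : 0 < (r j)^d := pow_pos (hr0 j) _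
    have h7 : (r j)^d * (|f x| * ((2^(d+1))⁻¹ * v)) ≤ (r j)^d * ((G x).toReal + v * ⨍ y in closedBall x (r j), ‖f y - f x‖) := by
      linarith
    exact le_of_mul_le_mul_left h7 hrp
  have hlim := (h1.const_mul v).const_add (G x).toReal
  rw [mul_zero, add_zero] at hlim
  have hfin := ge_of_tendsto' hlim main
  have hGe : G x = ENNReal.ofReal (G x).toReal := (ENNReal.ofReal_toReal hG).symm
  have hVe : VD d = ENNReal.ofReal v := (ENNReal.ofReal_toReal hVt).symm
  rw [hGe, hVe, ← ENNReal.ofReal_inv_of_pos hv0, ← ENNReal.ofReal_mul (by positivity), ← ENNReal.ofReal_mul (by positivity)]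
  apply ENNReal.ofReal_le_ofReal
  have : |f x| = 2^(d+1) * v⁻¹ * (|f x| * ((2^(d+1))⁻¹ * v)) := by field_simp
  rw [this]
  gcongr

lemma exists_grand (d : ℕ) : ∃ C : ℝ≥0∞, C ≠ ∞ ∧ ∀ (n : ℤ) (f : E d → ℝ), Integrable f →
    ∃ G : E d → ℝ≥0∞, Grand d (RR n) f G ∧ ∫⁻ x, G x ≤ C * h1nNorm d n f := by
  obtain ⟨C, θ, hC, hθ, hU⟩ := uch d
  obtain ⟨C2, hC2, hS⟩ := HL_strong d hθ
  set c1 : ℝ≥0∞ := ENNReal.ofReal (2^(d+2)) * C with hc1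
  have hc1t : c1 ≠ ∞ := ENNReal.mul_ne_top ENNReal.ofReal_ne_top hC
  set c2 : ℝ≥0∞ := 1 + ENNReal.ofReal (2^(d+1)) * (VD d)⁻¹ with hc2
  have hc2t : c2 ≠ ∞ := ENNReal.add_ne_top.2 ⟨by simp, ENNReal.mul_ne_top ENNReal.ofReal_ne_top (ENNReal.inv_ne_top.2 (VD_ne_zero d))⟩
  refine ⟨c2 * c1 * C2, ENNReal.mul_ne_top (ENNReal.mul_ne_top hc2t hc1t) hC2, fun n f hf => ?_⟩
  set g : E d → ℝ≥0∞ := fun x => (MnMax d n f x)^(1/(1+θ)) with hg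
  have hgm : Measurable g := (MnMax_lsc d n hf).measurable.pow_const _
  have hgp : ∀ x, g x ^ (1+θ) = MnMax d n f x := fun x => by
    rw [hg]; simp only
    rw [← ENNReal.rpow_mul, one_div, inv_mul_cancel₀ (by positivity), ENNReal.rpow_one]
  set G0 : E d → ℝ≥0∞ := fun z => c1 * (HL d g z)^(1+θ) with hG0
  have hb0 : ∀ (r : ℝ) (z : E d) (b : E d → ℝ), 0 < r → r ≤ RR n → (∀ x, |b x| ≤ 1) →
    (∀ x, x ∉ ball z r → b x = 0) → (∀ x y, |b x - b y| ≤ (‖x - y‖/r)) →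
    ENNReal.ofReal |∫ x, f x * b x| ≤ ENNReal.ofReal (r^d) * G0 z := by
    intro r z b hr hrR h1 h2 h3
    have h4 := hU n f hf r z _ hr hrR (bump_BC d z hr b h1 h2 h3)
    have e : ∫ x, f x * ((2^(d+2))⁻¹ * b x) = (2^(d+2))⁻¹ * ∫ x, f x * b x := by
      rw [← integral_const_mul]; congr 1; ext x; ring
    rw [e, abs_mul, abs_of_pos (by positivity), ENNReal.ofReal_mul (by positivity)] at h4
    have h5 := mul_le_mul_right h4 (ENNReal.ofReal (2^(d+2)))
    rw [← mul_assoc, ← ENNReal.ofReal_mul (by positivity), mul_inv_cancel₀ (by positivity), ENNReal.ofReal_one, one_mul] at h5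
    refine h5.trans (le_of_eq ?_)
    rw [hG0, hc1]; ring
  have hlsc0 : LowerSemicontinuous (fun z => (HL d g z)^(1+θ)) :=
    (ENNReal.continuous_rpow_const).comp_lowerSemicontinuous (HL_lsc d g) (ENNReal.monotone_rpow_of_nonneg (by positivity))
  refine ⟨fun z => c2 * G0 z, ⟨?_, ?_, ?_⟩, ?_⟩
  · have : (fun z => c2 * G0 z) = fun z => (c2 * c1) * (HL d g z)^(1+θ) := by ext z; rw [hG0]; ring
    rw [this]
    exact (ENNReal.continuous_const_mul (ENNReal.mul_ne_top hc2t hc1t)).comp_lowerSemicontinuous hlsc0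
      (fun a b hab => mul_le_mul_right hab _)
  · intro r L z b hr hrR hL h1 h2 h3
    rcases hL.eq_or_lt with rfl | hL0
    · have : ∀ x, b x = 0 := fun x => abs_nonpos_iff.1 (h1 x)
      simp [this]
    have h4 := hb0 r z (fun x => L⁻¹ * b x) hr hrR (fun x => by
        rw [abs_mul, abs_of_pos (by positivity), inv_mul_le_iff₀ hL0, mul_one]; exact h1 x)
      (fun x hx => by rw [h2 x hx, mul_zero]) (fun x y => by
        rw [← mul_sub, abs_mul, abs_of_pos (by positivity), inv_mul_le_iff₀ hL0]; exact h3 x y)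
    have e : ∫ x, f x * (L⁻¹ * b x) = L⁻¹ * ∫ x, f x * b x := by
      rw [← integral_const_mul]; congr 1; ext x; ring
    rw [e, abs_mul, abs_of_pos (by positivity), ENNReal.ofReal_mul (by positivity)] at h4
    have h5 := mul_le_mul_right h4 (ENNReal.ofReal L)
    rw [← mul_assoc, ← ENNReal.ofReal_mul (by positivity), mul_inv_cancel₀ hL0.ne', ENNReal.ofReal_one, one_mul] at h5
    refine h5.trans ?_
    rw [ENNReal.ofReal_mul hL, mul_assoc]
    have : G0 z ≤ c2 * G0 z := by
      rw [hc2, add_mul, one_mul]; exact le_self_add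
    gcongr
  · filter_upwards [grand_ae d (RR_pos n) hf hb0] with x hx
    refine hx.trans ?_
    rw [hc2, add_mul (a := 1)]
    exact le_add_self
  · have hm : Measurable (fun z => (HL d g z)^(1+θ)) := hlsc0.measurable
    have : ∀ z, c2 * G0 z = (c2 * c1) * (HL d g z)^(1+θ) := fun z => by rw [hG0]; ring
    simp_rw [this]
    rw [lintegral_const_mul _ hm, mul_assoc (c2*c1)]
    refine mul_le_mul_right ((hS g hgm).trans (le_of_eq ?_)) _
    simp_rw [hgp]; rfl

/-- hat profile -/
def hat (d : ℕ) (u : E d) : ℝ := max 0 (1 - ‖u‖)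
def kc (d : ℕ) : ℝ := ∫ u : E d, hat d u

lemma hat_nonneg (d : ℕ) (u : E d) : 0 ≤ hat d u := le_max_left _ _
lemma hat_continuous (d : ℕ) : Continuous (hat d) := by unfold hat; fun_prop
lemma hat_le_one (d : ℕ) (u : E d) : hat d u ≤ 1 :=
  max_le zero_le_one (by linarith [norm_nonneg u])
lemma hat_zero (d : ℕ) {u : E d} (hu : 1 ≤ ‖u‖) : hat d u = 0 := max_eq_left (by linarith)
lemma hat_support (d : ℕ) : HasCompactSupport (hat d) :=
  HasCompactSupport.intro (isCompact_closedBall 0 1) fun u hu => hat_zero d (by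
    simp at hu; exact hu.le)
lemma hat_integrable (d : ℕ) : Integrable (hat d) :=
  (hat_continuous d).integrable_of_hasCompactSupport (hat_support d)
lemma kc_pos (d : ℕ) : 0 < kc d := by
  unfold kc
  refine (hat_continuous d).integral_pos_of_hasCompactSupport_nonneg_nonzero (hat_support d) (hat_nonneg d) (x := 0) ?_
  simp [hat]

/-- normalized kernel at scale t -/
def KK (d : ℕ) (t : ℝ) (u : E d) : ℝ := (kc d)⁻¹ * ((t^d)⁻¹ * hat d (t⁻¹ • u))

lemma KK_nonneg (d : ℕ) {t : ℝ} (ht : 0 ≤ t) (u : E d) : 0 ≤ KK d t u := by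
  have := kc_pos d; have := hat_nonneg d (t⁻¹ • u); unfold KK; positivity

lemma KK_measurable (d : ℕ) : Measurable (fun q : ℝ × E d => KK d q.1 q.2) := by
  unfold KK
  have : Measurable (fun q : ℝ × E d => hat d (q.1⁻¹ • q.2)) :=
    (hat_continuous d).measurable.comp (measurable_fst.inv.smul measurable_snd)
  fun_prop

lemma KK_le (d : ℕ) {t a : ℝ} (ha : 0 < a) (hat' : a ≤ t) (u : E d) : KK d t u ≤ (kc d)⁻¹ * (a^d)⁻¹ := by
  have h1 := kc_pos d
  have h2 := hat_le_one d (t⁻¹ • u)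
  have h3 := hat_nonneg d (t⁻¹ • u)
  have h4 : (t^d)⁻¹ ≤ (a^d)⁻¹ := inv_anti₀ (by positivity) (pow_le_pow_left₀ ha.le hat' d)
  have ht : 0 < t := by linarith
  unfold KK
  gcongr
  calc _ ≤ (t^d)⁻¹ * 1 := by gcongr
    _ ≤ _ := by rw [mul_one]; exact h4

lemma KK_zero (d : ℕ) {t : ℝ} (ht : 0 < t) {u : E d} (hu : t ≤ ‖u‖) : KK d t u = 0 := by
  unfold KK
  rw [hat_zero d, mul_zero, mul_zero]
  rw [norm_smul, Real.norm_of_nonneg (by positivity), inv_mul_eq_div]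
  exact (one_le_div ht).2 hu

lemma KK_integrable (d : ℕ) {t : ℝ} (ht : 0 < t) (x : E d) : Integrable (fun v => KK d t (x - v)) := by
  unfold KK
  exact ((integrable_scaled (hat_integrable d) ht x).const_mul _).const_mul _

lemma KK_integral (d : ℕ) {t : ℝ} (ht : 0 < t) (x : E d) : ∫ v, KK d t (x - v) = 1 := by
  unfold KK
  rw [integral_const_mul, integral_const_mul, integral_scaled _ ht x]
  have := (kc_pos d).ne'
  have h2 : ∫ y, hat d y = kc d := rfl
  rw [h2]; field_simp

lemma KK_form (d : ℕ) {t : ℝ} (ht : 0 < t) (u : E d) :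
    KK d t u = (kc d)⁻¹ * ((t⁻¹)^(d+1) * max 0 (t - ‖u‖)) := by
  unfold KK hat
  have : max 0 (t - ‖u‖) = t * max 0 (1 - ‖t⁻¹ • u‖) := by
    rw [norm_smul, Real.norm_of_nonneg (by positivity), mul_max_of_nonneg _ _ ht.le]
    congr 1
    · simp
    · field_simp
  rw [this, pow_succ, inv_pow]
  generalize max 0 (1 - ‖t⁻¹ • u‖) = m
  field_simp

lemma KK_lip (d : ℕ) {a t t' : ℝ} (ha : 0 < a) (hat1 : a ≤ t) (hat2 : a ≤ t') (u u' : E d) :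
    |KK d t u - KK d t' u'| ≤ (kc d)⁻¹ * ((a⁻¹)^(d+1) * ((d+2) * |t - t'| + ‖u - u'‖)) := by
  have ht : 0 < t := by linarith
  have ht' : 0 < t' := by linarith
  have hk := kc_pos d
  rw [KK_form d ht, KK_form d ht', ← mul_sub, abs_mul, abs_of_pos (by positivity)]
  apply mul_le_mul_of_nonneg_left _ (by positivity)
  set p := max 0 (t - ‖u‖)
  set p' := max 0 (t' - ‖u'‖)
  have hp : |p - p'| ≤ |t - t'| + ‖u - u'‖ := by
    refine (abs_max_sub_max_le_max _ _ _ _).trans ?_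
    have h1 := abs_norm_sub_norm_le u u'
    have e : t - ‖u‖ - (t' - ‖u'‖) = (t - t') - (‖u‖ - ‖u'‖) := by ring
    rw [sub_self, abs_zero, max_eq_right (abs_nonneg _), e]
    exact (abs_sub _ _).trans (by linarith)
  have hp0 : 0 ≤ p := le_max_left _ _
  have hpt : p ≤ t := max_le ht.le (by linarith [norm_nonneg u])
  have hs : t⁻¹ ≤ a⁻¹ := inv_anti₀ ha hat1
  have hs' : t'⁻¹ ≤ a⁻¹ := inv_anti₀ ha hat2
  have h2 : |(t⁻¹)^(d+1) - (t'⁻¹)^(d+1)| ≤ |t⁻¹ - t'⁻¹| * (d+1) * (a⁻¹)^d := by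
    have := abs_pow_sub_pow_le (t⁻¹) (t'⁻¹) (d+1)
    simp only [Nat.add_sub_cancel, Nat.cast_add, Nat.cast_one] at this
    refine this.trans ?_
    gcongr
    rw [abs_of_pos (by positivity), abs_of_pos (by positivity)]
    exact max_le hs hs'
  have h3 : |t⁻¹ - t'⁻¹| * t ≤ a⁻¹ * |t - t'| := by
    have : t⁻¹ - t'⁻¹ = (t' - t) * (t⁻¹ * t'⁻¹) := by field_simp
    rw [this, abs_mul, abs_of_pos (by positivity : 0 < t⁻¹ * t'⁻¹), abs_sub_comm]
    calc _ = t'⁻¹ * |t - t'| := by field_simp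
      _ ≤ _ := by gcongr
  have e : (t⁻¹)^(d+1) * p - (t'⁻¹)^(d+1) * p' = ((t⁻¹)^(d+1) - (t'⁻¹)^(d+1)) * p + (t'⁻¹)^(d+1) * (p - p') := by ring
  rw [e]
  refine (abs_add_le _ _).trans ?_
  rw [abs_mul, abs_mul, abs_of_nonneg hp0, abs_of_pos (by positivity : 0 < (t'⁻¹)^(d+1))]
  have h4 : |(t⁻¹)^(d+1) - (t'⁻¹)^(d+1)| * p ≤ (a⁻¹)^(d+1) * ((d+1) * |t - t'|) := by
    calc _ ≤ (|t⁻¹ - t'⁻¹| * (d+1) * (a⁻¹)^d) * t := by gcongr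
      _ = (|t⁻¹ - t'⁻¹| * t) * ((d+1) * (a⁻¹)^d) := by ring
      _ ≤ (a⁻¹ * |t - t'|) * ((d+1) * (a⁻¹)^d) := by gcongr
      _ = _ := by rw [pow_succ]; ring
  have h5 : (t'⁻¹)^(d+1) * |p - p'| ≤ (a⁻¹)^(d+1) * (|t - t'| + ‖u - u'‖) := by gcongr
  linarith

/-- average of φ around x at scale t, including t = 0 -/
def Tav (d : ℕ) (φ : E d → ℝ) (t : ℝ) (x : E d) : ℝ := ∫ u, φ (x - t • u) * ((kc d)⁻¹ * hat d u)

lemma Tav_zero (d : ℕ) (φ : E d → ℝ) (x : E d) : Tav d φ 0 x = φ x := by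
  unfold Tav
  simp only [zero_smul, sub_zero]
  rw [integral_const_mul, integral_const_mul]
  have := (kc_pos d).ne'
  have h2 : ∫ y, hat d y = kc d := rfl
  rw [h2]; field_simp

lemma Tav_eq (d : ℕ) (φ : E d → ℝ) {t : ℝ} (ht : 0 < t) (x : E d) :
    Tav d φ t x = ∫ v, φ v * KK d t (x - v) := by
  have h := integral_scaled (fun u => φ (x - t • u) * ((kc d)⁻¹ * hat d u)) ht x
  unfold Tav
  have h2 : ∫ u, φ (x - t • u) * ((kc d)⁻¹ * hat d u) = (t^d)⁻¹ * (t^d * ∫ u, φ (x - t • u) * ((kc d)⁻¹ * hat d u)) := by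
    field_simp
  rw [h2, ← h, ← integral_const_mul]
  congr 1; ext v
  unfold KK
  rw [smul_smul, mul_inv_cancel₀ ht.ne', one_smul, _root_.sub_sub_cancel]; ring

lemma Tav_continuous (d : ℕ) {φ : E d → ℝ} (hφ : Continuous φ) {B : ℝ} (hB : ∀ x, |φ x| ≤ B) {τ : E d → ℝ} (hτ : Continuous τ) :
    Continuous (fun x => Tav d φ (τ x) x) := by
  unfold Tav
  have hk := kc_pos d
  refine continuous_of_dominated (bound := fun u => B * ((kc d)⁻¹ * hat d u)) ?_ ?_ ?_ ?_
  · intro x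
    refine Continuous.aestronglyMeasurable ?_
    have := hat_continuous d
    fun_prop
  · intro x
    filter_upwards with u
    rw [norm_mul, Real.norm_eq_abs, Real.norm_of_nonneg (mul_nonneg (by positivity) (hat_nonneg d u))]
    exact mul_le_mul_of_nonneg_right (hB _) (mul_nonneg (by positivity) (hat_nonneg d u))
  · exact ((hat_integrable d).const_mul _).const_mul _
  · filter_upwards with u
    fun_prop

lemma Tav_bdd (d : ℕ) {φ : E d → ℝ} {B : ℝ} (hB : ∀ x, |φ x| ≤ B) (t : ℝ) (x : E d) : |Tav d φ t x| ≤ B := by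
  have hk := kc_pos d
  unfold Tav
  have h := norm_integral_le_of_norm_le (f := fun u => φ (x - t • u) * ((kc d)⁻¹ * hat d u)) (g := fun u => B * ((kc d)⁻¹ * hat d u))
    (((hat_integrable d).const_mul _).const_mul _) (by
      filter_upwards with u
      rw [norm_mul, Real.norm_eq_abs, Real.norm_of_nonneg (mul_nonneg (by positivity) (hat_nonneg d u))]
      exact mul_le_mul_of_nonneg_right (hB _) (mul_nonneg (by positivity) (hat_nonneg d u)))
  refine h.trans (le_of_eq ?_)
  rw [integral_const_mul, integral_const_mul]
  have h2 : ∫ y, hat d y = kc d := rfl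
  rw [h2]; field_simp

/-- scale functions -/
structure Scale (d : ℕ) (τ : E d → ℝ) : Prop where
  nonneg : ∀ x, 0 ≤ τ x
  lip : ∀ x y, |τ x - τ y| ≤ ‖x - y‖ / 8

/-- oscillation bound with a constant per ball -/
structure Osc (d : ℕ) (φ : E d → ℝ) (B N : ℝ) : Prop where
  cont : Continuous φ
  bdd : ∀ x, |φ x| ≤ B
  N0 : 0 ≤ N
  osc : ∀ x r, 0 < r → ∃ c : ℝ, ∫ y in ball x r, |φ y - c| ≤ N * (r^d * (VD d).toReal)

section sc
variable {d : ℕ} {τ : E d → ℝ} {φ : E d → ℝ} {B N : ℝ}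

lemma Scale.continuous (h : Scale d τ) : Continuous τ := by
  have : LipschitzWith (1/8) τ := by
    apply LipschitzWith.of_dist_le_mul
    intro x y
    rw [Real.dist_eq, dist_eq_norm]
    refine (h.lip x y).trans (le_of_eq ?_)
    simp; ring
  exact this.continuous

lemma Scale.comp (h : Scale d τ) {x v : E d} (hx : ‖x - v‖ < 2 * τ v) : 3/4 * τ v ≤ τ x ∧ τ x ≤ 5/4 * τ v := by
  have h1 := abs_le.1 (h.lip x v)
  constructor <;> linarith

lemma Scale.near (h : Scale d τ) {x v : E d} (hx : ‖x - v‖ < τ x) : ‖x - v‖ < 8/7 * τ v ∧ 0 < τ v := by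
  have h1 := abs_le.1 (h.lip x v)
  constructor <;> linarith [norm_nonneg (x - v)]

lemma osc_integrable (hφ : Osc d φ B N) (c : ℝ) (x : E d) (r : ℝ) :
    IntegrableOn (fun y => |φ y - c|) (ball x r) := by
  have : Continuous (fun y => |φ y - c|) := (hφ.cont.sub continuous_const).abs
  exact (this.continuousOn.integrableOn_compact (isCompact_closedBall x r)).mono_set ball_subset_closedBall

lemma int_bound (hφ : Osc d φ B N) {c c' X : ℝ} {v : E d} {r : ℝ} (F : E d → ℝ)
    (hX : ∫ y in ball v r, |φ y - c| ≤ X) (hc' : 0 ≤ c')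
    (h1 : ∀ y ∈ ball v r, |F y| ≤ c' * |φ y - c|) (h0 : ∀ y ∉ ball v r, F y = 0) :
    |∫ y, F y| ≤ c' * X := by
  have hi : IntegrableOn (fun y => c' * |φ y - c|) (ball v r) := (osc_integrable hφ c v r).const_mul c'
  have := norm_integral_le_of_norm_le (f := F) (g := (ball v r).indicator fun y => c' * |φ y - c|)
    (hi.integrable_indicator measurableSet_ball) (by
      filter_upwards with y
      by_cases hy : y ∈ ball v r
      · rw [Set.indicator_of_mem hy]; exact h1 y hy
      · rw [Set.indicator_of_notMem hy, h0 y hy]; simp)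
  rw [integral_indicator measurableSet_ball, integral_const_mul] at this
  exact this.trans (mul_le_mul_of_nonneg_left hX hc')

lemma mul_KK_integrable (hφ : Osc d φ B N) {t : ℝ} (ht : 0 < t) (x : E d) :
    Integrable (fun v => φ v * KK d t (x - v)) := by
  refine (KK_integrable d ht x).bdd_mul (c := B) hφ.cont.aestronglyMeasurable ?_
  exact Eventually.of_forall hφ.bdd

lemma Tav_sub (hφ : Osc d φ B N) {t : ℝ} (ht : 0 < t) (x : E d) (c : ℝ) :
    Tav d φ t x - c = ∫ v, (φ v - c) * KK d t (x - v) := by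
  rw [Tav_eq d φ ht]
  simp_rw [sub_mul]
  rw [integral_sub (mul_KK_integrable hφ ht x) ((KK_integrable d ht x).const_mul c), integral_const_mul, KK_integral d ht]
  simp

/-- first constant -/
def C1 (d : ℕ) : ℝ := (kc d)⁻¹ * (2^d * (4^d * (VD d).toReal))

lemma C1_nonneg (d : ℕ) : 0 ≤ C1 d := by have := kc_pos d; unfold C1; positivity

lemma near_bound (hτ : Scale d τ) (hφ : Osc d φ B N) {v x : E d} {c : ℝ} (hv : 0 < τ v)
    (hc : ∫ y in ball v (4 * τ v), |φ y - c| ≤ N * ((4 * τ v)^d * (VD d).toReal)) (hx : ‖x - v‖ < 2 * τ v) :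
    |Tav d φ (τ x) x - c| ≤ C1 d * N := by
  obtain ⟨h1, h2⟩ := hτ.comp hx
  have hx0 : 0 < τ x := by linarith
  rw [Tav_sub hφ hx0 x c]
  have hk := kc_pos d
  refine (int_bound hφ (c' := (kc d)⁻¹ * ((τ v/2)^d)⁻¹) _ hc (by positivity) (fun y hy => ?_) (fun y hy => ?_)).trans (le_of_eq ?_)
  · rw [abs_mul, abs_of_nonneg (KK_nonneg d hx0.le _), mul_comm]
    exact mul_le_mul_of_nonneg_right (KK_le d (by linarith) (by linarith) _) (abs_nonneg _)
  · rw [KK_zero d hx0, mul_zero]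
    rw [mem_ball, dist_eq_norm] at hy
    have : ‖y - v‖ ≤ ‖x - y‖ + ‖x - v‖ := by
      rw [norm_sub_rev x y]; exact norm_sub_le_norm_sub_add_norm_sub y x v
    linarith
  · unfold C1
    rw [mul_pow, div_pow]; field_simp

/-- second constant -/
def C2 (d : ℕ) : ℝ := (kc d)⁻¹ * (2^(d+1) * (d + 3)) * (4^d * (VD d).toReal)

lemma C2_nonneg (d : ℕ) : 0 ≤ C2 d := by have := kc_pos d; unfold C2; positivity

lemma lip_bound (hτ : Scale d τ) (hφ : Osc d φ B N) {v x y : E d} (hv : 0 < τ v)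
    (hx : ‖x - v‖ < 2 * τ v) (hy : ‖y - v‖ < 2 * τ v) :
    |Tav d φ (τ x) x - Tav d φ (τ y) y| ≤ C2 d * N * (‖x - y‖ / τ v) := by
  obtain ⟨c, hc⟩ := hφ.osc v (4 * τ v) (by linarith)
  obtain ⟨h1, h2⟩ := hτ.comp hx
  obtain ⟨h1', h2'⟩ := hτ.comp hy
  have hx0 : 0 < τ x := by linarith
  have hy0 : 0 < τ y := by linarith
  have hk := kc_pos d
  have e : Tav d φ (τ x) x - Tav d φ (τ y) y = ∫ w, (φ w - c) * (KK d (τ x) (x - w) - KK d (τ y) (y - w)) := by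
    have : Tav d φ (τ x) x - Tav d φ (τ y) y = (Tav d φ (τ x) x - c) - (Tav d φ (τ y) y - c) := by ring
    rw [this, Tav_sub hφ hx0, Tav_sub hφ hy0, ← integral_sub]
    · congr 1; ext w; ring
    · simp_rw [sub_mul]; exact (mul_KK_integrable hφ hx0 x).sub ((KK_integrable d hx0 x).const_mul c)
    · simp_rw [sub_mul]; exact (mul_KK_integrable hφ hy0 y).sub ((KK_integrable d hy0 y).const_mul c)
  rw [e]
  refine (int_bound hφ (c' := (kc d)⁻¹ * (((τ v/2)⁻¹)^(d+1) * ((d+3) * ‖x - y‖))) _ hc (by positivity) (fun w hw => ?_) (fun w hw => ?_)).trans (le_of_eq ?_)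
  · rw [abs_mul, mul_comm]
    apply mul_le_mul_of_nonneg_right _ (abs_nonneg _)
    refine (KK_lip d (a := τ v/2) (by linarith) (by linarith) (by linarith) _ _).trans ?_
    gcongr
    rw [sub_sub_sub_cancel_right]
    have := hτ.lip x y
    nlinarith [norm_nonneg (x - y), (Nat.cast_nonneg d : (0:ℝ) ≤ d)]
  · rw [mem_ball, dist_eq_norm] at hw
    have t1 : ‖w - v‖ ≤ ‖x - w‖ + ‖x - v‖ := by
      rw [norm_sub_rev x w]; exact norm_sub_le_norm_sub_add_norm_sub w x v
    have t2 : ‖w - v‖ ≤ ‖y - w‖ + ‖y - v‖ := by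
      rw [norm_sub_rev y w]; exact norm_sub_le_norm_sub_add_norm_sub w y v
    rw [KK_zero d hx0, KK_zero d hy0, sub_self, mul_zero]
    · linarith
    · linarith
  · unfold C2
    rw [mul_pow, inv_div, div_pow, pow_succ (τ v)]; field_simp
end sc

section sc8
variable {d : ℕ} {τ : E d → ℝ} {φ : E d → ℝ} {B N : ℝ}

lemma KKτ_measurable (hτ : Scale d τ) : Measurable (fun q : E d × E d => KK d (τ q.1) (q.1 - q.2)) :=
  (KK_measurable d).comp (((hτ.continuous.measurable.comp measurable_fst)).prodMk (measurable_fst.sub measurable_snd))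

lemma KK_lintegral {t : ℝ} (ht : 0 < t) (x : E d) : ∫⁻ v, ENNReal.ofReal (KK d t (x - v)) = 1 := by
  rw [← ofReal_integral_eq_lintegral_ofReal (KK_integrable d ht x) (Eventually.of_forall fun v => KK_nonneg d ht.le _), KK_integral d ht]
  simp

lemma pos_measurable (hτ : Scale d τ) : MeasurableSet {x | 0 < τ x} :=
  (isOpen_lt continuous_const hτ.continuous).measurableSet

lemma insert_bound (hτ : Scale d τ) {H : E d → ℝ≥0∞} (hH : Measurable H) {A : ℝ}
    (h : ∀ v, 0 < τ v → ∫⁻ x in ball v (2 * τ v), H x ≤ ENNReal.ofReal (A * (τ v)^d)) :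
    ∫⁻ x in {x | 0 < τ x}, H x ≤ ENNReal.ofReal ((kc d)⁻¹ * (2^d * A)) * volume {x | 0 < τ x} := by
  have hk := kc_pos d
  have hO := pos_measurable hτ
  calc ∫⁻ x in {x | 0 < τ x}, H x = ∫⁻ x in {x | 0 < τ x}, ∫⁻ v, H x * ENNReal.ofReal (KK d (τ x) (x - v)) := by
        refine setLIntegral_congr_fun hO fun x hx => ?_
        have h1 := KK_lintegral (d := d) hx x
        have h2 : Measurable (fun v => ENNReal.ofReal (KK d (τ x) (x - v))) :=
          ((KKτ_measurable hτ).comp (measurable_const.prodMk measurable_id)).ennreal_ofReal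
        exact ((lintegral_const_mul _ h2).trans (by rw [h1, mul_one])).symm
    _ = ∫⁻ v, ∫⁻ x in {x | 0 < τ x}, H x * ENNReal.ofReal (KK d (τ x) (x - v)) := by
        refine lintegral_lintegral_swap ?_
        exact ((hH.comp measurable_fst).mul (KKτ_measurable hτ).ennreal_ofReal).aemeasurable
    _ ≤ ∫⁻ v, {x | 0 < τ x}.indicator (fun _ => ENNReal.ofReal ((kc d)⁻¹ * (2^d * A))) v := by
        refine lintegral_mono fun v => ?_
        by_cases hv : 0 < τ v
        · rw [Set.indicator_of_mem (show v ∈ {x | 0 < τ x} from hv)]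
          calc _ ≤ ∫⁻ x in {x | 0 < τ x}, (ball v (2 * τ v)).indicator (fun x => ENNReal.ofReal ((kc d)⁻¹ * ((τ v/2)^d)⁻¹) * H x) x := by
                refine setLIntegral_mono' hO fun x hx => ?_
                by_cases hxv : ‖x - v‖ < τ x
                · have := (hτ.near hxv).1
                  have hb : x ∈ ball v (2 * τ v) := by rw [mem_ball, dist_eq_norm]; linarith
                  rw [Set.indicator_of_mem hb, mul_comm]
                  gcongr
                  have := (hτ.comp (by rw [mem_ball, dist_eq_norm] at hb; exact hb)).1
                  exact KK_le d (by linarith) (by linarith) _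
                · rw [KK_zero d hx (not_lt.1 hxv)]; simp
            _ ≤ ∫⁻ x, (ball v (2 * τ v)).indicator (fun x => ENNReal.ofReal ((kc d)⁻¹ * ((τ v/2)^d)⁻¹) * H x) x := setLIntegral_le_lintegral _ _
            _ = ∫⁻ x in ball v (2 * τ v), ENNReal.ofReal ((kc d)⁻¹ * ((τ v/2)^d)⁻¹) * H x := lintegral_indicator measurableSet_ball _
            _ = ENNReal.ofReal ((kc d)⁻¹ * ((τ v/2)^d)⁻¹) * ∫⁻ x in ball v (2 * τ v), H x := lintegral_const_mul _ hH
            _ ≤ ENNReal.ofReal ((kc d)⁻¹ * ((τ v/2)^d)⁻¹) * ENNReal.ofReal (A * (τ v)^d) := by gcongr; exact h v hv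
            _ = _ := by
                rw [← ENNReal.ofReal_mul (by positivity)]; congr 1
                rw [div_pow]; field_simp
        · rw [Set.indicator_of_notMem (show v ∉ {x | 0 < τ x} from hv)]
          refine le_of_eq ?_
          rw [setLIntegral_congr_fun (g := fun _ => 0) hO fun x hx => ?_, lintegral_zero]
          have : ¬ ‖x - v‖ < τ x := fun hxv => hv (hτ.near hxv).2
          show H x * ENNReal.ofReal (KK d (τ x) (x - v)) = 0
          rw [KK_zero d hx (not_lt.1 this)]; simp
    _ = _ := by rw [lintegral_indicator hO]; simp

/-- third constant -/
def C3 (d : ℕ) : ℝ := (kc d)⁻¹ * (2^d * (4^d * (VD d).toReal + C1 d * (2^d * (VD d).toReal)))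
lemma C3_nonneg (d : ℕ) : 0 ≤ C3 d := by have := kc_pos d; have := C1_nonneg d; unfold C3; positivity

lemma W1 (hτ : Scale d τ) (hφ : Osc d φ B N) :
    ∫⁻ x in {x | 0 < τ x}, ENNReal.ofReal |φ x - Tav d φ (τ x) x| ≤ ENNReal.ofReal (C3 d * N) * volume {x | 0 < τ x} := by
  have hC := C1_nonneg d
  have hN := hφ.N0
  have hT := Tav_continuous d hφ.cont hφ.bdd hτ.continuous
  have hH : Measurable fun x => ENNReal.ofReal |φ x - Tav d φ (τ x) x| :=
    ((hφ.cont.sub hT).abs).measurable.ennreal_ofReal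
  refine (insert_bound hτ hH (A := (4^d * (VD d).toReal + C1 d * (2^d * (VD d).toReal)) * N) fun v hv => ?_).trans (le_of_eq ?_)
  · obtain ⟨c, hc⟩ := hφ.osc v (4 * τ v) (by linarith)
    have m1 : Measurable fun x => ENNReal.ofReal |φ x - c| := ((hφ.cont.sub continuous_const).abs).measurable.ennreal_ofReal
    calc _ ≤ ∫⁻ x in ball v (2 * τ v), (ENNReal.ofReal |φ x - c| + ENNReal.ofReal (C1 d * N)) := by
          refine setLIntegral_mono' measurableSet_ball fun x hx => ?_
          rw [mem_ball, dist_eq_norm] at hx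
          have := near_bound hτ hφ hv hc hx
          rw [← ENNReal.ofReal_add (abs_nonneg _) (by positivity)]
          apply ENNReal.ofReal_le_ofReal
          have := abs_sub_le (φ x) c (Tav d φ (τ x) x)
          rw [abs_sub_comm c] at this
          linarith
      _ = (∫⁻ x in ball v (2 * τ v), ENNReal.ofReal |φ x - c|) + ENNReal.ofReal (C1 d * N) * volume (ball v (2 * τ v)) := by
          rw [lintegral_add_left m1]; simp
      _ ≤ ENNReal.ofReal (N * ((4 * τ v)^d * (VD d).toReal)) + ENNReal.ofReal (C1 d * N) * ENNReal.ofReal ((2 * τ v)^d * (VD d).toReal) := by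
          gcongr
          · refine (lintegral_mono_set (ball_subset_ball (by linarith : 2 * τ v ≤ 4 * τ v))).trans ?_
            rw [← ofReal_integral_eq_lintegral_ofReal (osc_integrable hφ c v _) (Eventually.of_forall fun v => abs_nonneg _)]
            exact ENNReal.ofReal_le_ofReal hc
          · rw [vol_ball d v (by linarith), ENNReal.ofReal_mul (by positivity), ENNReal.ofReal_toReal (VD_ne_top d)]; rfl
      _ = _ := by
          rw [← ENNReal.ofReal_mul (by positivity), ← ENNReal.ofReal_add (by positivity) (by positivity)]
          congr 1; rw [mul_pow, mul_pow]; ring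
  · congr 2; unfold C3; ring
end sc8

/-- scale function of a set -/
def tau {d : ℕ} (R : ℝ) (Ω : Set (E d)) (x : E d) : ℝ := (1/8) * min (infDist x Ωᶜ) (R/8)

section sc9
variable {d : ℕ} {R : ℝ} {Ω Ω' : Set (E d)} {φ f : E d → ℝ} {G : E d → ℝ≥0∞} {B N lam : ℝ}

lemma tau_scale (hR : 0 < R) : Scale d (tau R Ω) := by
  constructor
  · intro x; have : 0 ≤ infDist x Ωᶜ := infDist_nonneg
    unfold tau; positivity
  · intro x y
    unfold tau
    rw [← mul_sub, abs_mul, abs_of_pos (by norm_num : (0:ℝ) < 1/8)]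
    have h1 := abs_min_sub_min_le_max (infDist x Ωᶜ) (R/8) (infDist y Ωᶜ) (R/8)
    rw [sub_self, abs_zero, max_eq_left (abs_nonneg _)] at h1
    have h2 : |infDist x Ωᶜ - infDist y Ωᶜ| ≤ ‖x - y‖ := by
      rw [← Real.dist_eq, ← dist_eq_norm]
      simpa using (lipschitz_infDist_pt Ωᶜ).dist_le_mul x y
    linarith

lemma tau_pos (hR : 0 < R) (ho : IsOpen Ω) (hne : Ωᶜ.Nonempty) {x : E d} (hx : x ∈ Ω) : 0 < tau R Ω x := by
  have h := (ho.isClosed_compl.notMem_iff_infDist_pos hne).1 (show x ∉ Ωᶜ from fun h => h hx)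
  have h2 : 0 < min (infDist x Ωᶜ) (R/8) := lt_min h (by linarith)
  unfold tau; linarith

lemma tau_zero (hR : 0 < R) {x : E d} (hx : x ∉ Ω) : tau R Ω x = 0 := by
  unfold tau
  rw [infDist_zero_of_mem (show x ∈ Ωᶜ from hx), min_eq_left (by linarith), mul_zero]

lemma tau_set (hR : 0 < R) (ho : IsOpen Ω) (hne : Ωᶜ.Nonempty) : {x | 0 < tau R Ω x} = Ω := by
  ext x
  refine ⟨fun h => ?_, fun h => tau_pos hR ho hne h⟩
  by_contra hx
  have h' : 0 < tau R Ω x := h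
  rw [tau_zero hR hx] at h'; exact lt_irrefl _ h'

lemma tau_mono (hne : Ωᶜ.Nonempty) (hs : Ω' ⊆ Ω) (x : E d) : tau R Ω' x ≤ tau R Ω x := by
  have := infDist_le_infDist_of_subset (x := x) (Set.compl_subset_compl.2 hs) hne
  unfold tau; gcongr

lemma KK_zero' (hd : d ≠ 0) {t : ℝ} (ht : 0 ≤ t) {u : E d} (hu : t ≤ ‖u‖) : KK d t u = 0 := by
  rcases ht.eq_or_lt with h | h
  · subst h; unfold KK; simp [hd]
  · exact KK_zero d h hu

lemma glue {b : E d → ℝ} {v : E d} {t M L : ℝ} (ht : 0 < t) (hM : M * (7/6) ≤ L) (hM0 : 0 ≤ M)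
    (h0 : ∀ x, 8/7 * t ≤ ‖x - v‖ → b x = 0) (h1 : ∀ x, ‖x - v‖ < 2 * t → |b x| ≤ M)
    (h2 : ∀ x y, ‖x - v‖ < 2 * t → ‖y - v‖ < 2 * t → |b x - b y| ≤ L * (‖x - y‖ / t)) (x y : E d) :
    |b x - b y| ≤ L * (‖x - y‖ / t) := by
  have key : ∀ x y, ‖x - v‖ < 8/7 * t → 2 * t ≤ ‖y - v‖ → |b x| ≤ L * (‖x - y‖ / t) := by
    intro x y hx hy
    have e : ‖y - v‖ ≤ ‖x - y‖ + ‖x - v‖ := by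
      rw [norm_sub_rev x y]; exact norm_sub_le_norm_sub_add_norm_sub y x v
    have e2 : 6/7 ≤ ‖x - y‖ / t := by rw [le_div_iff₀ ht]; linarith
    have := h1 x (by linarith)
    nlinarith
  by_cases hx : ‖x - v‖ < 2 * t
  · by_cases hy : ‖y - v‖ < 2 * t
    · exact h2 x y hx hy
    · rw [h0 y (by linarith), sub_zero]
      by_cases hx' : ‖x - v‖ < 8/7 * t
      · exact key x y hx' (not_lt.1 hy)
      · rw [h0 x (not_lt.1 hx'), abs_zero]; have : 0 ≤ L := by linarith
        positivity
  · rw [h0 x (by linarith), zero_sub, abs_neg]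
    by_cases hy' : ‖y - v‖ < 8/7 * t
    · rw [norm_sub_rev]; exact key y x hy' (not_lt.1 hx)
    · rw [h0 y (not_lt.1 hy'), abs_zero]; have : 0 ≤ L := by linarith
      positivity

/-- difference of averages -/
def DD (φ : E d → ℝ) (τ' τ : E d → ℝ) (x : E d) : ℝ := Tav d φ (τ' x) x - Tav d φ (τ x) x

/-- step constant -/
def C4 (d : ℕ) : ℝ := 18 * 18^d * ((kc d)⁻¹ * 2^d) * (2*(d+3) * (1 + 4 * C2 d) + 2 * C2 d)
lemma C4_nonneg (d : ℕ) : 0 ≤ C4 d := by have := kc_pos d; have := C2_nonneg d; unfold C4; positivity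

lemma bump_est (hd : d ≠ 0) (hR : 0 < R) (hG : Grand d R f G) (hφ : Osc d φ B N) (ho' : IsOpen Ω') (hs : Ω' ⊆ Ω)
    (hne : Ωᶜ.Nonempty) (hl : 0 ≤ lam) (hlam : ∀ x ∉ Ω', G x ≤ ENNReal.ofReal lam) {v : E d} (hv : v ∈ Ω') :
    ENNReal.ofReal |∫ x, f x * (DD φ (tau R Ω') (tau R Ω) x * KK d (tau R Ω' x) (x - v))| ≤
      ENNReal.ofReal (C4 d * (|DD φ (tau R Ω') (tau R Ω) v| + N) * lam) := by
  have hne' : Ω'ᶜ.Nonempty := hne.mono (Set.compl_subset_compl.2 hs)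
  have s : Scale d (tau R Ω) := tau_scale hR
  have s' : Scale d (tau R Ω') := tau_scale hR
  have hmono := tau_mono (R := R) hne hs
  have ht0 := tau_pos hR ho' hne' hv
  have hC2 := C2_nonneg d
  have hk := kc_pos d
  have hN := hφ.N0
  set D := DD φ (tau R Ω') (tau R Ω) with hD
  set b : E d → ℝ := fun x => D x * KK d (tau R Ω' x) (x - v) with hb
  have b0 : ∀ x, 8/7 * tau R Ω' v ≤ ‖x - v‖ → b x = 0 := by
    intro x hx
    have : ¬ ‖x - v‖ < tau R Ω' x := fun h => by have := (s'.near h).1; linarith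
    simp only [hb]; rw [KK_zero' hd (s'.nonneg x) (not_lt.1 this), mul_zero]
  by_cases hbig : R/4 ≤ infDist v Ω'ᶜ
  · have : ∀ x, b x = 0 := by
      intro x
      by_cases hx : 8/7 * tau R Ω' v ≤ ‖x - v‖
      · exact b0 x hx
      have ht1 : tau R Ω' v ≤ R/64 := by
        have := min_le_right (infDist v Ω'ᶜ) (R/8); unfold tau; linarith
      have e1 : R/8 ≤ infDist x Ω'ᶜ := by
        have := infDist_le_infDist_add_dist (s := Ω'ᶜ) (x := v) (y := x)
        rw [dist_comm, dist_eq_norm] at this; linarith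
      have e2 : R/8 ≤ infDist x Ωᶜ := e1.trans (infDist_le_infDist_of_subset (Set.compl_subset_compl.2 hs) hne)
      have : D x = 0 := by
        simp only [hD, DD, tau]; rw [min_eq_right e1, min_eq_right e2, sub_self]
      simp only [hb]; rw [this, zero_mul]
    have e : (fun x => f x * b x) = fun _ => 0 := by ext x; rw [this, mul_zero]
    rw [e]; simp
  obtain ⟨z, hz, hdist⟩ := ho'.isClosed_compl.exists_infDist_eq_dist hne' v
  have hGz := hlam z hz
  have htdef : tau R Ω' v = (1/8) * min (infDist v Ω'ᶜ) (R/8) := rfl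
  have hδ : 0 < infDist v Ω'ᶜ := (ho'.isClosed_compl.notMem_iff_infDist_pos hne').1 (fun h => h hv)
  set t := tau R Ω' v with ht
  set δ := infDist v Ω'ᶜ
  set r := δ + 2 * t with hr
  have hr1 : r ≤ R := by have := min_le_left δ (R/8); linarith
  have hr2 : r ≤ 18 * t := by
    rcases min_cases δ (R/8) with h | h <;> linarith
  have hr0 : 0 < r := by linarith
  clear_value t δ r
  have DLip : ∀ x y, ‖x - v‖ < 2 * t → ‖y - v‖ < 2 * t → |D x - D y| ≤ 2 * C2 d * N * (‖x - y‖ / t) := by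
    intro x y hx hy
    have hm : t ≤ tau R Ω v := ht ▸ hmono v
    have l1 := lip_bound s' hφ (v := v) (x := x) (y := y) (by rw [← ht]; exact ht0) (by rw [← ht]; exact hx) (by rw [← ht]; exact hy)
    have l2 := lip_bound s hφ (v := v) (x := x) (y := y) (by linarith) (by linarith) (by linarith)
    rw [← ht] at l1
    have l3 : ‖x - y‖ / tau R Ω v ≤ ‖x - y‖ / t := by gcongr
    have l4 : C2 d * N * (‖x - y‖ / tau R Ω v) ≤ C2 d * N * (‖x - y‖ / t) := by gcongr
    have e : D x - D y = (Tav d φ (tau R Ω' x) x - Tav d φ (tau R Ω' y) y) - (Tav d φ (tau R Ω x) x - Tav d φ (tau R Ω y) y) := by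
      simp only [hD, DD]; ring
    rw [e]; refine (abs_sub _ _).trans ?_
    linarith
  set S := |D v| + 4 * C2 d * N with hS
  have hS0 : 0 ≤ S := by positivity
  have DS : ∀ x, ‖x - v‖ < 2 * t → |D x| ≤ S := by
    intro x hx
    have := DLip x v hx (by simp; exact ht0)
    have h2 : ‖x - v‖ / t ≤ 2 := by rw [div_le_iff₀ ht0]; linarith
    have h3 : 2 * C2 d * N * (‖x - v‖ / t) ≤ 2 * C2 d * N * 2 := by gcongr
    have h4 := abs_sub_abs_le_abs_sub (D x) (D v)
    linarith
  set A := (kc d)⁻¹ * ((t/2)^d)⁻¹ with hA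
  have hA0 : 0 < A := by positivity
  have near : ∀ x, ‖x - v‖ < 2 * t → t/2 ≤ tau R Ω' x := by
    intro x hx
    have := (s'.comp (x := x) (v := v) (by rw [← ht]; exact hx)).1
    rw [← ht] at this; linarith
  have KA : ∀ x, ‖x - v‖ < 2 * t → |KK d (tau R Ω' x) (x - v)| ≤ A := by
    intro x hx
    rw [abs_of_nonneg (KK_nonneg d (s'.nonneg x) _)]
    exact KK_le d (by linarith) (near x hx) _
  have KL : ∀ x y, ‖x - v‖ < 2 * t → ‖y - v‖ < 2 * t →
      |KK d (tau R Ω' x) (x - v) - KK d (tau R Ω' y) (y - v)| ≤ A * (2 * (d+3)) * (‖x - y‖ / t) := by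
    intro x y hx hy
    refine (KK_lip d (by linarith : 0 < t/2) (near x hx) (near y hy) _ _).trans ?_
    have := s'.lip x y
    rw [sub_sub_sub_cancel_right]
    calc _ ≤ (kc d)⁻¹ * (((t/2)⁻¹)^(d+1) * ((d+3) * ‖x - y‖)) := by
          gcongr; nlinarith [norm_nonneg (x - y), (Nat.cast_nonneg d : (0:ℝ) ≤ d)]
      _ = _ := by rw [hA, pow_succ, inv_pow]; field_simp
  set L := A * (S * (2 * (d+3)) + 2 * C2 d * N) with hL
  have hSA : 0 ≤ A * S := by positivity
  have hdn : (0:ℝ) ≤ d := Nat.cast_nonneg d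
  have hML : A * S * (7/6) ≤ L := by
    have h1 : 0 ≤ A * (2 * C2 d * N) := by positivity
    have h2 : 0 ≤ A * S * d := by positivity
    have : L = A * S * d * 2 + A * S * 6 + A * (2 * C2 d * N) := by rw [hL]; ring
    linarith
  have hL0 : 0 ≤ L := by linarith
  have bM : ∀ x, ‖x - v‖ < 2 * t → |b x| ≤ A * S := by
    intro x hx
    simp only [hb]; rw [abs_mul, mul_comm A]
    exact mul_le_mul (DS x hx) (KA x hx) (abs_nonneg _) hS0
  have bL := glue ht0 hML hSA b0 bM (by
    intro x y hx hy
    have e : b x - b y = D x * (KK d (tau R Ω' x) (x - v) - KK d (tau R Ω' y) (y - v)) + (D x - D y) * KK d (tau R Ω' y) (y - v) := by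
      simp only [hb]; ring
    rw [e]; refine (abs_add_le _ _).trans ?_
    rw [abs_mul, abs_mul]
    calc _ ≤ S * (A * (2 * (d+3)) * (‖x - y‖ / t)) + 2 * C2 d * N * (‖x - y‖ / t) * A := by
          gcongr
          · exact DS x hx
          · exact KL x y hx hy
          · exact DLip x y hx hy
          · exact KA y hy
      _ = _ := by rw [hL]; ring)
  have hbump := hG.bump r (18 * L) z b hr0 hr1 (by positivity) (fun x => ?_) (fun x hx => ?_) (fun x y => ?_)
  · refine hbump.trans ?_
    refine (mul_le_mul_right hGz _).trans ?_
    rw [← ENNReal.ofReal_mul (by positivity)]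
    apply ENNReal.ofReal_le_ofReal
    apply mul_le_mul_of_nonneg_right _ hl
    calc 18 * L * r^d ≤ 18 * L * (18 * t)^d := by gcongr
      _ = 18 * 18^d * ((kc d)⁻¹ * 2^d) * (S * (2 * (d+3)) + 2 * C2 d * N) := by
          rw [hL, hA, mul_pow, div_pow]; field_simp
      _ ≤ 18 * 18^d * ((kc d)⁻¹ * 2^d) * ((2*(d+3) * (1 + 4 * C2 d) + 2 * C2 d) * (|D v| + N)) := by
          gcongr
          have h1 : 0 ≤ |D v| := abs_nonneg _
          have : 0 ≤ 2 * ((d:ℝ)+3) * N + 2 * (d+3) * (4 * C2 d) * |D v| + 2 * C2 d * |D v| := by positivity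
          rw [hS]; linarith
      _ = _ := by unfold C4; ring
  · by_cases hx : ‖x - v‖ < 2 * t
    · have := bM x hx; linarith
    · rw [b0 x (by linarith), abs_zero]; positivity
  · apply b0
    by_contra h
    apply hx
    rw [mem_ball]
    have := dist_triangle x v z
    rw [dist_eq_norm x v] at this; linarith
  · refine (bL x y).trans ?_
    calc L * (‖x - y‖ / t) ≤ L * (‖x - y‖ / (r/18)) := by gcongr; linarith
      _ = _ := by field_simp
end sc9

section sc10
variable {d : ℕ} {R : ℝ} {Ω Ω' : Set (E d)} {φ f : E d → ℝ} {G : E d → ℝ≥0∞} {B N lam : ℝ}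

lemma DD_continuous (hR : 0 < R) (hφ : Osc d φ B N) : Continuous (DD φ (tau R Ω') (tau R Ω)) :=
  (Tav_continuous d hφ.cont hφ.bdd (tau_scale hR).continuous).sub (Tav_continuous d hφ.cont hφ.bdd (tau_scale hR).continuous)

lemma fDD_integrable (hR : 0 < R) (hφ : Osc d φ B N) (hf : Integrable f) : Integrable (fun x => f x * DD φ (tau R Ω') (tau R Ω) x) := by
  refine hf.mul_bdd (c := 2 * B) (DD_continuous hR hφ).aestronglyMeasurable (Eventually.of_forall fun x => ?_)
  refine (abs_sub _ _).trans ?_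
  have := Tav_bdd d hφ.bdd (tau R Ω' x) x
  have := Tav_bdd d hφ.bdd (tau R Ω x) x
  linarith

lemma DD_lint (hR : 0 < R) (hφ : Osc d φ B N) (ho : IsOpen Ω) (ho' : IsOpen Ω') (hs : Ω' ⊆ Ω) (hne : Ωᶜ.Nonempty) :
    ∫⁻ x in Ω', ENNReal.ofReal |DD φ (tau R Ω') (tau R Ω) x| ≤ ENNReal.ofReal (2 * C3 d * N) * volume Ω := by
  have hne' : Ω'ᶜ.Nonempty := hne.mono (Set.compl_subset_compl.2 hs)
  have w := W1 (tau_scale (Ω := Ω) hR) hφ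
  have w' := W1 (tau_scale (Ω := Ω') hR) hφ
  rw [tau_set hR ho hne] at w
  rw [tau_set hR ho' hne'] at w'
  have hc := C3_nonneg d
  have hN := hφ.N0
  have m : Measurable fun x => ENNReal.ofReal |φ x - Tav d φ (tau R Ω' x) x| :=
    ((hφ.cont.sub (Tav_continuous d hφ.cont hφ.bdd (tau_scale hR).continuous)).abs).measurable.ennreal_ofReal
  calc _ ≤ ∫⁻ x in Ω', (ENNReal.ofReal |φ x - Tav d φ (tau R Ω' x) x| + ENNReal.ofReal |φ x - Tav d φ (tau R Ω x) x|) := by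
        refine lintegral_mono fun x => ?_
        rw [← ENNReal.ofReal_add (abs_nonneg _) (abs_nonneg _)]
        apply ENNReal.ofReal_le_ofReal
        have := abs_sub (φ x - Tav d φ (tau R Ω x) x) (φ x - Tav d φ (tau R Ω' x) x)
        rw [_root_.sub_sub_sub_cancel_left] at this
        simp only [DD]; linarith
    _ = (∫⁻ x in Ω', ENNReal.ofReal |φ x - Tav d φ (tau R Ω' x) x|) + ∫⁻ x in Ω', ENNReal.ofReal |φ x - Tav d φ (tau R Ω x) x| := lintegral_add_left m _
    _ ≤ ENNReal.ofReal (C3 d * N) * volume Ω + ENNReal.ofReal (C3 d * N) * volume Ω := by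
        gcongr
        · exact w'.trans (by gcongr)
        · exact (lintegral_mono_set hs).trans w
    _ = _ := by rw [← add_mul, ← ENNReal.ofReal_add (by positivity) (by positivity)]; congr 2; ring

lemma outer_part (hR : 0 < R) (hG : Grand d R f G) (hφ : Osc d φ B N) (ho : IsOpen Ω) (ho' : IsOpen Ω')
    (hne : Ωᶜ.Nonempty) (hlam : ∀ x ∉ Ω', G x ≤ ENNReal.ofReal lam) :
    ENNReal.ofReal |∫ x in Ω'ᶜ, f x * DD φ (tau R Ω') (tau R Ω) x| ≤ ENNReal.ofReal lam * (ENNReal.ofReal (C3 d * N) * volume Ω) := by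
  have w := W1 (tau_scale (Ω := Ω) hR) hφ
  rw [tau_set hR ho hne] at w
  have m : Measurable fun x => ENNReal.ofReal |φ x - Tav d φ (tau R Ω x) x| :=
    ((hφ.cont.sub (Tav_continuous d hφ.cont hφ.bdd (tau_scale hR).continuous)).abs).measurable.ennreal_ofReal
  rw [← Real.enorm_eq_ofReal_abs]
  refine (enorm_integral_le_lintegral_enorm _).trans ?_
  calc _ ≤ ∫⁻ x in Ω'ᶜ, Ω.indicator (fun x => ENNReal.ofReal lam * ENNReal.ofReal |φ x - Tav d φ (tau R Ω x) x|) x := by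
        refine lintegral_mono_ae ?_
        filter_upwards [ae_restrict_of_ae hG.ae, ae_restrict_mem ho'.measurableSet.compl] with x h1 h2
        simp only [DD]
        rw [tau_zero hR h2, Tav_zero]
        by_cases hx : x ∈ Ω
        · rw [Set.indicator_of_mem hx, enorm_mul, Real.enorm_eq_ofReal_abs, Real.enorm_eq_ofReal_abs]
          exact mul_le_mul_left (h1.trans (hlam x h2)) _
        · rw [tau_zero hR hx, Tav_zero]; simp
    _ ≤ ∫⁻ x, Ω.indicator (fun x => ENNReal.ofReal lam * ENNReal.ofReal |φ x - Tav d φ (tau R Ω x) x|) x := setLIntegral_le_lintegral _ _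
    _ = ENNReal.ofReal lam * ∫⁻ x in Ω, ENNReal.ofReal |φ x - Tav d φ (tau R Ω x) x| := by
        rw [lintegral_indicator ho.measurableSet]; exact lintegral_const_mul _ m
    _ ≤ _ := by gcongr

lemma inner_eq (hd : d ≠ 0) (hR : 0 < R) (hφ : Osc d φ B N) (hf : Integrable f) (ho' : IsOpen Ω') (hne' : Ω'ᶜ.Nonempty) :
    ∫ x in Ω', f x * DD φ (tau R Ω') (tau R Ω) x =
      ∫ v, ∫ x, f x * (DD φ (tau R Ω') (tau R Ω) x * KK d (tau R Ω' x) (x - v)) := by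
  set D := DD φ (tau R Ω') (tau R Ω) with hD
  have s' : Scale d (tau R Ω') := tau_scale hR
  have hDc : Continuous D := DD_continuous hR hφ
  have hfD : Integrable (fun x => f x * D x) := fDD_integrable hR hφ hf
  have k0 : ∀ x ∉ Ω', ∀ v, KK d (tau R Ω' x) (x - v) = 0 := fun x hx v => by
    rw [tau_zero hR hx]; exact KK_zero' hd le_rfl (norm_nonneg _)
  have ki : ∀ x, Integrable fun v => KK d (tau R Ω' x) (x - v) := by
    intro x
    by_cases hx : x ∈ Ω'
    · exact KK_integrable d (tau_pos hR ho' hne' hx) x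
    · simp_rw [k0 x hx]; exact integrable_zero _ _ _
  have kint : ∀ x, ∫ v, KK d (tau R Ω' x) (x - v) = Ω'.indicator (fun _ => 1) x := by
    intro x
    by_cases hx : x ∈ Ω'
    · rw [Set.indicator_of_mem hx]; exact KK_integral d (tau_pos hR ho' hne' hx) x
    · simp_rw [k0 x hx]; rw [Set.indicator_of_notMem hx]; simp
  have e1 : ∀ x, ∫ v, f x * (D x * KK d (tau R Ω' x) (x - v)) = Ω'.indicator (fun x => f x * D x) x := by
    intro x
    rw [integral_const_mul, integral_const_mul, kint]
    by_cases hx : x ∈ Ω' <;> simp [hx]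
  have e2 : ∀ x, ∫ v, ‖f x * (D x * KK d (tau R Ω' x) (x - v))‖ = Ω'.indicator (fun x => ‖f x * D x‖) x := by
    intro x
    have : ∀ v, ‖f x * (D x * KK d (tau R Ω' x) (x - v))‖ = ‖f x * D x‖ * KK d (tau R Ω' x) (x - v) := fun v => by
      rw [← mul_assoc, norm_mul, Real.norm_of_nonneg (KK_nonneg d (s'.nonneg x) _)]
    simp_rw [this]
    rw [integral_const_mul, kint]
    by_cases hx : x ∈ Ω' <;> simp [hx]
  rw [← integral_integral_swap]
  · simp_rw [e1]; rw [integral_indicator ho'.measurableSet]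
  · have ms : AEStronglyMeasurable (fun q : E d × E d => f q.1 * (D q.1 * KK d (tau R Ω' q.1) (q.1 - q.2))) (volume.prod volume) := by
      refine hf.1.comp_fst.mul ?_
      exact ((hDc.measurable.comp measurable_fst).mul (KKτ_measurable s')).aestronglyMeasurable
    show Integrable (fun q : E d × E d => f q.1 * (D q.1 * KK d (tau R Ω' q.1) (q.1 - q.2))) (volume.prod volume)
    rw [integrable_prod_iff ms]
    refine ⟨Eventually.of_forall fun x => ((ki x).const_mul (D x)).const_mul (f x), ?_⟩
    simp_rw [e2]
    exact hfD.norm.indicator ho'.measurableSet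

/-- final step constant -/
def C5 (d : ℕ) : ℝ := C4 d * (2 * C3 d + 1) + C3 d
lemma C5_nonneg (d : ℕ) : 0 ≤ C5 d := by have := C4_nonneg d; have := C3_nonneg d; unfold C5; positivity

lemma step (hd : d ≠ 0) (hR : 0 < R) (hf : Integrable f) (hG : Grand d R f G) (hφ : Osc d φ B N) (ho : IsOpen Ω) (ho' : IsOpen Ω')
    (hs : Ω' ⊆ Ω) (hne : Ωᶜ.Nonempty) (hl : 0 ≤ lam) (hlam : ∀ x ∉ Ω', G x ≤ ENNReal.ofReal lam) :
    ENNReal.ofReal |∫ x, f x * DD φ (tau R Ω') (tau R Ω) x| ≤ ENNReal.ofReal (C5 d * N) * (ENNReal.ofReal lam * volume Ω) := by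
  have hne' : Ω'ᶜ.Nonempty := hne.mono (Set.compl_subset_compl.2 hs)
  have h3 := C3_nonneg d
  have h4 := C4_nonneg d
  have hN := hφ.N0
  rw [← integral_add_compl ho'.measurableSet (fDD_integrable hR hφ hf)]
  have h1 := outer_part hR hG hφ ho ho' hne hlam
  have h2 : ENNReal.ofReal |∫ x in Ω', f x * DD φ (tau R Ω') (tau R Ω) x| ≤
      ENNReal.ofReal (C4 d * (2 * C3 d + 1) * N) * (ENNReal.ofReal lam * volume Ω) := by
    rw [inner_eq hd hR hφ hf ho' hne', ← Real.enorm_eq_ofReal_abs]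
    refine (enorm_integral_le_lintegral_enorm _).trans ?_
    calc _ ≤ ∫⁻ v, Ω'.indicator (fun v => ENNReal.ofReal (C4 d * lam) * (ENNReal.ofReal |DD φ (tau R Ω') (tau R Ω) v| + ENNReal.ofReal N)) v := by
          refine lintegral_mono fun v => ?_
          by_cases hv : v ∈ Ω'
          · rw [Set.indicator_of_mem hv, Real.enorm_eq_ofReal_abs]
            refine (bump_est hd hR hG hφ ho' hs hne hl hlam hv).trans (le_of_eq ?_)
            rw [← ENNReal.ofReal_add (abs_nonneg _) hN, ← ENNReal.ofReal_mul (by positivity)]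
            congr 1; ring
          · rw [Set.indicator_of_notMem hv]
            have : ∀ x, f x * (DD φ (tau R Ω') (tau R Ω) x * KK d (tau R Ω' x) (x - v)) = 0 := by
              intro x
              have hx : ¬ ‖x - v‖ < tau R Ω' x := fun h => by
                have := ((tau_scale hR).near h).2; rw [tau_zero hR hv] at this; exact lt_irrefl _ this
              rw [KK_zero' hd ((tau_scale hR).nonneg x) (not_lt.1 hx), mul_zero, mul_zero]
            simp_rw [this]; simp
      _ = ENNReal.ofReal (C4 d * lam) * ∫⁻ v in Ω', (ENNReal.ofReal |DD φ (tau R Ω') (tau R Ω) v| + ENNReal.ofReal N) := by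
          rw [lintegral_indicator ho'.measurableSet]
          exact lintegral_const_mul _ ((DD_continuous hR hφ).abs.measurable.ennreal_ofReal.add_const _)
      _ ≤ ENNReal.ofReal (C4 d * lam) * (ENNReal.ofReal (2 * C3 d * N) * volume Ω + ENNReal.ofReal N * volume Ω) := by
          gcongr
          rw [lintegral_add_right _ measurable_const]
          gcongr
          · exact DD_lint hR hφ ho ho' hs hne
          · simp; gcongr
      _ = _ := by
          rw [← add_mul, ← ENNReal.ofReal_add (by positivity) hN, ← mul_assoc, ← mul_assoc, ← ENNReal.ofReal_mul (by positivity), ← ENNReal.ofReal_mul (by positivity)]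
          congr 2; ring
  calc _ ≤ ENNReal.ofReal (|∫ x in Ω', f x * DD φ (tau R Ω') (tau R Ω) x| + |∫ x in Ω'ᶜ, f x * DD φ (tau R Ω') (tau R Ω) x|) :=
        ENNReal.ofReal_le_ofReal (abs_add_le _ _)
    _ = _ := ENNReal.ofReal_add (abs_nonneg _) (abs_nonneg _)
    _ ≤ _ := add_le_add h2 h1
    _ = ENNReal.ofReal (C4 d * (2 * C3 d + 1) * N) * (ENNReal.ofReal lam * volume Ω) + ENNReal.ofReal (C3 d * N) * (ENNReal.ofReal lam * volume Ω) := by ring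
    _ = _ := by rw [← add_mul, ← ENNReal.ofReal_add (by positivity) (by positivity)]; congr 2; unfold C5; ring
end sc10

section sc11
variable {d : ℕ} {R : ℝ} {φ f : E d → ℝ} {G : E d → ℝ≥0∞} {B N A : ℝ}

/-- level sets -/
def Lv (G : E d → ℝ≥0∞) (k : ℤ) : Set (E d) := {x | (2:ℝ≥0∞)^k < G x}

lemma Lv_open (hG : LowerSemicontinuous G) (k : ℤ) : IsOpen (Lv G k) := hG.isOpen_preimage _

lemma Lv_anti (G : E d → ℝ≥0∞) (k : ℤ) : Lv G (k+1) ⊆ Lv G k := fun x hx =>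
  lt_of_le_of_lt (ENNReal.zpow_le_of_le (by norm_num) (by omega)) (show (2:ℝ≥0∞)^(k+1) < G x from hx)

lemma two_zpow_ne_top (k : ℤ) : (2:ℝ≥0∞)^k ≠ ∞ := ENNReal.zpow_ne_top (by norm_num) (by norm_num) k
lemma two_zpow_ne_zero (k : ℤ) : (2:ℝ≥0∞)^k ≠ 0 := (ENNReal.zpow_pos (by norm_num) (by norm_num) k).ne'

lemma Lv_compl (hd : d ≠ 0) (hG : LowerSemicontinuous G) (hI : ∫⁻ x, G x ≠ ∞) (k : ℤ) : (Lv G k)ᶜ.Nonempty := by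
  by_contra h
  rw [Set.not_nonempty_iff_eq_empty, Set.compl_empty_iff] at h
  have h1 := mul_meas_ge_le_lintegral (μ := volume) hG.measurable ((2:ℝ≥0∞)^k)
  have h2 : volume {x | (2:ℝ≥0∞)^k ≤ G x} = ∞ := by
    have : Nonempty (Fin d) := ⟨⟨0, Nat.pos_of_ne_zero hd⟩⟩
    have : volume (Set.univ : Set (E d)) = ∞ := measure_univ_of_isAddLeftInvariant _
    refine measure_mono_top (fun x _ => ?_) this
    have : x ∈ Lv G k := by rw [h]; trivial
    exact le_of_lt (show (2:ℝ≥0∞)^k < G x from this)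
  rw [h2, ENNReal.mul_top (two_zpow_ne_zero k)] at h1
  exact hI (top_le_iff.1 h1)

lemma Lv_sum (hG : LowerSemicontinuous G) : ∑' k : ℤ, (2:ℝ≥0∞)^k * volume (Lv G k) ≤ 2 * ∫⁻ x, G x := by
  have hm := hG.measurable
  calc ∑' k : ℤ, (2:ℝ≥0∞)^k * volume (Lv G k) = ∑' k : ℤ, ∫⁻ x, (Lv G k).indicator (fun _ => (2:ℝ≥0∞)^k) x := by
        congr 1; ext k; rw [lintegral_indicator (Lv_open hG k).measurableSet]; simp
    _ = ∫⁻ x, ∑' k : ℤ, (Lv G k).indicator (fun _ => (2:ℝ≥0∞)^k) x := by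
        rw [lintegral_tsum]
        intro k; exact (measurable_const.indicator (Lv_open hG k).measurableSet).aemeasurable
    _ ≤ ∫⁻ x, 2 * G x := by
        refine lintegral_mono fun x => ?_
        have h := ennreal_geo one_pos (G x)
        have e : (1 - (2:ℝ≥0∞)^(-(1:ℝ)))⁻¹ = 2 := by
          rw [ENNReal.rpow_neg, ENNReal.rpow_one, ENNReal.one_sub_inv_two, inv_inv]
        rw [e, ENNReal.rpow_one] at h
        refine le_trans (le_of_eq ?_) h
        congr 1; ext k
        by_cases hx : (2:ℝ≥0∞)^k < G x
        · rw [if_pos hx, Set.indicator_of_mem (show x ∈ Lv G k from hx), ENNReal.rpow_one]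
        · rw [if_neg hx, Set.indicator_of_notMem (show x ∉ Lv G k from hx)]
    _ = _ := lintegral_const_mul _ hm

lemma step_k (hd : d ≠ 0) (hR : 0 < R) (hf : Integrable f) (hG : Grand d R f G) (hI : ∫⁻ x, G x ≠ ∞) (hφ : Osc d φ B N) (k : ℤ) :
    ENNReal.ofReal |∫ x, f x * DD φ (tau R (Lv G (k+1))) (tau R (Lv G k)) x| ≤ ENNReal.ofReal (C5 d * N) * (2 * ((2:ℝ≥0∞)^k * volume (Lv G k))) := by
  have h := step (lam := ((2:ℝ≥0∞)^(k+1)).toReal) hd hR hf hG hφ (Lv_open hG.lsc k) (Lv_open hG.lsc (k+1)) (Lv_anti G k) (Lv_compl hd hG.lsc hI k) ENNReal.toReal_nonneg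
    (fun x hx => by rw [ENNReal.ofReal_toReal (two_zpow_ne_top _)]; exact not_lt.1 hx)
  refine h.trans (le_of_eq ?_)
  rw [ENNReal.ofReal_toReal (two_zpow_ne_top _), ENNReal.zpow_add (by norm_num) (by norm_num), zpow_one]
  ring

lemma fT_integrable (hR : 0 < R) (hφ : Osc d φ B N) (hf : Integrable f) (Ω : Set (E d)) : Integrable (fun x => f x * Tav d φ (tau R Ω x) x) :=
  hf.mul_bdd (c := B) (Tav_continuous d hφ.cont hφ.bdd (tau_scale hR).continuous).aestronglyMeasurable (Eventually.of_forall fun x => Tav_bdd d hφ.bdd _ x)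

lemma telescope (hd : d ≠ 0) (hR : 0 < R) (hf : Integrable f) (hG : Grand d R f G) (hI : ∫⁻ x, G x ≠ ∞) (hφ : Osc d φ B N) (k : ℤ) (n : ℕ) :
    ENNReal.ofReal |(∫ x, f x * Tav d φ (tau R (Lv G (k+n)) x) x) - ∫ x, f x * Tav d φ (tau R (Lv G k) x) x| ≤
      ENNReal.ofReal (C5 d * N) * (2 * ∑ i ∈ Finset.range n, ((2:ℝ≥0∞)^(k+i) * volume (Lv G (k+i)))) := by
  induction n with
  | zero => simp
  | succ n ih =>
    have h := step_k hd hR hf hG hI hφ (k+n)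
    have e : ∫ x, f x * DD φ (tau R (Lv G (k+n+1))) (tau R (Lv G (k+n))) x =
        (∫ x, f x * Tav d φ (tau R (Lv G (k+n+1)) x) x) - ∫ x, f x * Tav d φ (tau R (Lv G (k+n)) x) x := by
      rw [← integral_sub (fT_integrable hR hφ hf _) (fT_integrable hR hφ hf _)]
      congr 1; ext x; unfold DD; ring
    rw [e] at h
    rw [Finset.sum_range_succ, mul_add, mul_add]
    refine le_trans ?_ (add_le_add ih h)
    rw [← ENNReal.ofReal_add (abs_nonneg _) (abs_nonneg _)]
    apply ENNReal.ofReal_le_ofReal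
    rw [add_comm |_|]
    push_cast
    rw [← add_assoc]
    exact abs_sub_le _ _ _

lemma zpow_large {a : ℝ≥0∞} (ha : a ≠ ∞) : ∀ᶠ K : ℕ in atTop, a ≤ (2:ℝ≥0∞)^(K:ℤ) := by
  have h : Tendsto (fun K : ℕ => (2:ℝ≥0∞)^K) atTop (𝓝 ∞) := ENNReal.tendsto_pow_atTop_nhds_top_iff.2 (by norm_num)
  filter_upwards [h.eventually (lt_mem_nhds (lt_top_iff_ne_top.2 ha))] with K hK
  simpa using hK.le

lemma zpow_small {a : ℝ≥0∞} (ha : a ≠ 0) : ∀ᶠ K : ℕ in atTop, (2:ℝ≥0∞)^(-(K:ℤ)) ≤ a := by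
  filter_upwards [zpow_large (ENNReal.inv_ne_top.2 ha)] with K hK
  rw [ENNReal.zpow_neg]
  exact ENNReal.inv_le_iff_inv_le.1 hK

lemma lim_up (hR : 0 < R) (hf : Integrable f) (hG : Grand d R f G) (hI : ∫⁻ x, G x ≠ ∞) (hφ : Osc d φ B N) :
    Tendsto (fun K : ℕ => ∫ x, f x * Tav d φ (tau R (Lv G K) x) x) atTop (𝓝 (∫ x, f x * φ x)) := by
  refine tendsto_integral_of_dominated_convergence (fun x => |f x| * B) (fun K => (fT_integrable hR hφ hf _).1) (hf.norm.mul_const B) ?_ ?_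
  · intro K
    filter_upwards with x
    rw [norm_mul]
    exact mul_le_mul_of_nonneg_left (Tav_bdd d hφ.bdd _ x) (abs_nonneg _)
  · filter_upwards [ae_lt_top hG.lsc.measurable hI] with x hx
    refine tendsto_const_nhds.congr' ?_
    filter_upwards [zpow_large hx.ne] with K hK
    rw [tau_zero hR (show x ∉ Lv G K from not_lt.2 hK), Tav_zero]

lemma lim_down (hd : d ≠ 0) (hR : 0 < R) (hf : Integrable f) (hG : Grand d R f G) (hI : ∫⁻ x, G x ≠ ∞) (hpos : ∀ x, G x ≠ 0) (hφ : Osc d φ B N) :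
    Tendsto (fun K : ℕ => ∫ x, f x * Tav d φ (tau R (Lv G (-(K:ℤ))) x) x) atTop (𝓝 (∫ x, f x * Tav d φ (R/64) x)) := by
  refine tendsto_integral_of_dominated_convergence (fun x => |f x| * B) (fun K => (fT_integrable hR hφ hf _).1) (hf.norm.mul_const B) ?_ ?_
  · intro K
    filter_upwards with x
    rw [norm_mul]
    exact mul_le_mul_of_nonneg_left (Tav_bdd d hφ.bdd _ x) (abs_nonneg _)
  · filter_upwards with x
    refine tendsto_const_nhds.congr' ?_
    obtain ⟨y, hy, hmin⟩ := LowerSemicontinuousOn.exists_isMinOn (s := closedBall x (R/8)) (f := G) ⟨x, mem_closedBall_self (by linarith)⟩ (isCompact_closedBall x (R/8)) (hG.lsc.lowerSemicontinuousOn _)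
    obtain ⟨a, ha0, hay⟩ := exists_between (pos_iff_ne_zero.2 (hpos y))
    filter_upwards [zpow_small ha0.ne'] with K hK
    have hsub : closedBall x (R/8) ⊆ Lv G (-(K:ℤ)) := fun z hz => (hK.trans_lt hay).trans_le (hmin hz)
    have : R/8 ≤ infDist x (Lv G (-(K:ℤ)))ᶜ := by
      refine (le_infDist (Lv_compl hd hG.lsc hI _)).2 fun z hz => ?_
      by_contra h
      exact hz (hsub (mem_closedBall'.2 (not_le.1 h).le))
    rw [tau, min_eq_right this]; congr 2; ring

lemma pairing_pos (hd : d ≠ 0) (hR : 0 < R) (hf : Integrable f) (hG : Grand d R f G) (hI : ∫⁻ x, G x ≠ ∞) (hpos : ∀ x, G x ≠ 0)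
    (hφ : Osc d φ B N) (hA : 0 ≤ A) (hT : ∀ x, |Tav d φ (R/64) x| ≤ A * N) :
    |∫ x, f x * φ x| ≤ (4 * C5 d + A) * N * (∫⁻ x, G x).toReal := by
  have h5 := C5_nonneg d
  have hN := hφ.N0
  have h1 : ∀ K : ℕ, |(∫ x, f x * Tav d φ (tau R (Lv G K) x) x) - ∫ x, f x * Tav d φ (tau R (Lv G (-(K:ℤ))) x) x| ≤ 4 * C5 d * N * (∫⁻ x, G x).toReal := by
    intro K
    have h := telescope hd hR hf hG hI hφ (-(K:ℤ)) (2 * K)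
    rw [show (-(K:ℤ) + ((2 * K : ℕ) : ℤ)) = K by push_cast; ring] at h
    have h2 : ∑ i ∈ Finset.range (2*K), ((2:ℝ≥0∞)^(-(K:ℤ)+i) * volume (Lv G (-(K:ℤ)+i))) ≤ 2 * ∫⁻ x, G x := by
      refine le_trans ?_ (Lv_sum hG.lsc)
      have hinj : Function.Injective (fun i : ℕ => -(K:ℤ) + i) := fun i j hij => by simpa using hij
      refine (ENNReal.sum_le_tsum _).trans ?_
      exact ENNReal.tsum_comp_le_tsum_of_injective hinj (fun k : ℤ => (2:ℝ≥0∞)^k * volume (Lv G k))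
    have h3 := h.trans (mul_le_mul_right (mul_le_mul_right h2 2) _)
    have h4 := ENNReal.toReal_mono (by finiteness) h3
    rw [ENNReal.toReal_ofReal (abs_nonneg _)] at h4
    refine h4.trans (le_of_eq ?_)
    simp only [ENNReal.toReal_mul, ENNReal.toReal_ofReal (mul_nonneg h5 hN), ENNReal.toReal_ofNat]; ring
  have h2 := le_of_tendsto' ((lim_up hR hf hG hI hφ).sub (lim_down hd hR hf hG hI hpos hφ)).abs h1
  have hf1 : ∫ x, |f x| ≤ (∫⁻ x, G x).toReal := by
    rw [integral_eq_lintegral_of_nonneg_ae (Eventually.of_forall fun x => abs_nonneg _) hf.norm.1]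
    exact ENNReal.toReal_mono hI (lintegral_mono_ae hG.ae)
  have h3 : |∫ x, f x * Tav d φ (R/64) x| ≤ A * N * (∫⁻ x, G x).toReal := by
    have := norm_integral_le_of_norm_le (f := fun x => f x * Tav d φ (R/64) x) (g := fun x => |f x| * (A * N)) (hf.norm.mul_const _) (by
      filter_upwards with x
      rw [norm_mul]; exact mul_le_mul_of_nonneg_left (hT x) (abs_nonneg _))
    refine this.trans ?_
    rw [integral_mul_const, mul_comm]
    gcongr
  have h4 := abs_sub_abs_le_abs_sub (∫ x, f x * φ x) (∫ x, f x * Tav d φ (R/64) x)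
  linarith

lemma pairing (hd : d ≠ 0) (hR : 0 < R) (hf : Integrable f) (hG : Grand d R f G) (hI : ∫⁻ x, G x ≠ ∞)
    (hφ : Osc d φ B N) (hA : 0 ≤ A) (hT : ∀ x, |Tav d φ (R/64) x| ≤ A * N) :
    |∫ x, f x * φ x| ≤ (4 * C5 d + A) * N * (∫⁻ x, G x).toReal := by
  have hw := wt_integrable d (le_refl (d+1))
  have hJ : ∫⁻ x, ENNReal.ofReal (wt d (d+1) x) ≠ ∞ := by
    rw [← ofReal_integral_eq_lintegral_ofReal hw (Eventually.of_forall fun x => (wt_pos d _ x).le)]; exact ENNReal.ofReal_ne_top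
  have key : ∀ ε : ℝ≥0, 0 < ε → |∫ x, f x * φ x| ≤ (4 * C5 d + A) * N * ((∫⁻ x, G x).toReal + ε * (∫⁻ x, ENNReal.ofReal (wt d (d+1) x)).toReal) := by
    intro ε hε
    have hc : Continuous fun x => (ε:ℝ≥0∞) * ENNReal.ofReal (wt d (d+1) x) :=
      ENNReal.continuous_const_mul (by simp) |>.comp (ENNReal.continuous_ofReal.comp (wt_continuous d _))
    have hle : ∀ x, G x ≤ G x + ε * ENNReal.ofReal (wt d (d+1) x) := fun x => le_self_add
    have hG' : Grand d R f (fun x => G x + ε * ENNReal.ofReal (wt d (d+1) x)) := by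
      refine ⟨hG.lsc.add hc.lowerSemicontinuous, fun r L z b h1 h2 h3 h4 h5 h6 => ?_, ?_⟩
      · exact (hG.bump r L z b h1 h2 h3 h4 h5 h6).trans (mul_le_mul_right (hle z) _)
      · filter_upwards [hG.ae] with x hx using hx.trans (hle x)
    have e : ∫⁻ x, (G x + ε * ENNReal.ofReal (wt d (d+1) x)) = (∫⁻ x, G x) + ε * ∫⁻ x, ENNReal.ofReal (wt d (d+1) x) := by
      rw [lintegral_add_left hG.lsc.measurable]
      congr 1; exact lintegral_const_mul _ (wt_continuous d _).measurable.ennreal_ofReal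
    have h := pairing_pos hd hR hf hG' (by rw [e]; finiteness) (fun x => by
      have h1 : 0 < ENNReal.ofReal (wt d (d+1) x) := ENNReal.ofReal_pos.2 (wt_pos d _ x)
      have h2 : (0:ℝ≥0∞) < ε := by exact_mod_cast hε
      exact (lt_of_lt_of_le (ENNReal.mul_pos h2.ne' h1.ne') le_add_self).ne') hφ hA hT
    rw [e, ENNReal.toReal_add hI (by finiteness), ENNReal.toReal_mul] at h
    exact h
  have hlim : Tendsto (fun ε : ℝ≥0 => (4 * C5 d + A) * N * ((∫⁻ x, G x).toReal + ε * (∫⁻ x, ENNReal.ofReal (wt d (d+1) x)).toReal)) (𝓝[>] 0) (𝓝 ((4 * C5 d + A) * N * ((∫⁻ x, G x).toReal + (0:ℝ≥0) * (∫⁻ x, ENNReal.ofReal (wt d (d+1) x)).toReal))) := by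
    refine Tendsto.mono_left (Continuous.tendsto (by fun_prop) 0) nhdsWithin_le_nhds
  have := ge_of_tendsto hlim (by filter_upwards [self_mem_nhdsWithin] with ε hε using key ε hε)
  simpa using this
end sc11

section sc12
variable {d : ℕ} {n : ℤ} {φ f : E d → ℝ} {B : ℝ}

lemma vol_toReal (x : E d) {r : ℝ} (hr : 0 < r) : (volume (ball x r)).toReal = r^d * (VD d).toReal := by
  rw [vol_ball d x hr, ENNReal.toReal_mul, ENNReal.toReal_ofReal (by positivity)]; rfl

lemma vol_toReal_pos (x : E d) {r : ℝ} (hr : 0 < r) : 0 < (volume (ball x r)).toReal :=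
  ENNReal.toReal_pos (vol_ball_ne_zero d x hr) (vol_ball_ne_top d x r)

lemma ballAvg_abs_le (x : E d) {r : ℝ} (hr : 0 < r) (h : ∀ y, |φ y| ≤ B) : |ballAvg d φ x r| ≤ B := by
  unfold ballAvg
  have hv := vol_toReal_pos x hr
  have := norm_setIntegral_le_of_norm_le_const (μ := volume) (s := ball x r) (f := φ) (C := B) measure_ball_lt_top fun y _ => h y
  rw [abs_mul, abs_of_pos (by positivity), inv_mul_le_iff₀ hv, mul_comm _ B]
  exact this

lemma bmon_le (n : ℤ) (h : ∀ y, |φ y| ≤ B) : bmonNorm d n φ ≤ ENNReal.ofReal (3 * B) := by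
  have hB : 0 ≤ B := (abs_nonneg _).trans (h 0)
  have e : ENNReal.ofReal (3 * B) = ENNReal.ofReal (2 * B) + ENNReal.ofReal B := by
    rw [← ENNReal.ofReal_add (by positivity) hB]; congr 1; ring
  rw [e]
  unfold bmonNorm bmoNormE
  refine add_le_add (iSup_le fun x => iSup_le fun r => iSup_le fun hr => ?_) (iSup_le fun x => iSup_le fun r => iSup_le fun hr => ?_)
  · apply ENNReal.ofReal_le_ofReal
    refine (le_abs_self _).trans (ballAvg_abs_le x hr fun y => ?_)
    rw [abs_abs]
    refine (abs_sub _ _).trans ?_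
    have := ballAvg_abs_le x hr h
    have := h y; linarith
  · apply ENNReal.ofReal_le_ofReal
    have hr0 : 0 < r := lt_of_lt_of_le (by positivity) hr
    exact (le_abs_self _).trans (ballAvg_abs_le x hr0 fun y => by rw [abs_abs]; exact h y)

lemma bmon_osc (hc : Continuous φ) (h : ∀ y, |φ y| ≤ B) : Osc d φ B (bmonNorm d n φ).toReal := by
  have hfin : bmonNorm d n φ ≠ ∞ := ((bmon_le n h).trans_lt ENNReal.ofReal_lt_top).ne
  refine ⟨hc, h, ENNReal.toReal_nonneg, fun x r hr => ⟨ballAvg d φ x r, ?_⟩⟩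
  have h1 : oscB d φ x r ≤ (bmonNorm d n φ).toReal := by
    rw [← ENNReal.ofReal_le_iff_le_toReal hfin]
    refine le_trans ?_ le_self_add
    exact le_iSup_of_le x (le_iSup_of_le r (le_iSup_of_le hr le_rfl))
  have hv := vol_toReal_pos x hr
  unfold oscB at h1
  rw [ballAvg, inv_mul_le_iff₀ hv, vol_toReal x hr, mul_comm] at h1
  exact h1

lemma bmon_avg (h : ∀ y, |φ y| ≤ B) (x : E d) {r : ℝ} (hr : RR n ≤ r) :
    ∫ y in ball x r, |φ y| ≤ (bmonNorm d n φ).toReal * (r^d * (VD d).toReal) := by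
  have hfin : bmonNorm d n φ ≠ ∞ := ((bmon_le n h).trans_lt ENNReal.ofReal_lt_top).ne
  have hr0 : 0 < r := (RR_pos n).trans_le hr
  have h1 : ballAvg d (fun y => |φ y|) x r ≤ (bmonNorm d n φ).toReal := by
    rw [← ENNReal.ofReal_le_iff_le_toReal hfin]
    refine le_trans ?_ le_add_self
    exact le_iSup_of_le x (le_iSup_of_le r (le_iSup_of_le hr le_rfl))
  have hv := vol_toReal_pos x hr0
  rw [ballAvg, inv_mul_le_iff₀ hv, vol_toReal x hr0, mul_comm] at h1
  exact h1

/-- constant for the coarse average -/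
def C6 (d : ℕ) : ℝ := (kc d)⁻¹ * (64^d * (VD d).toReal)

lemma Tav_coarse (hc : Continuous φ) (h : ∀ y, |φ y| ≤ B) (x : E d) :
    |Tav d φ (RR n/64) x| ≤ C6 d * (bmonNorm d n φ).toReal := by
  have hR := RR_pos n
  have hk := kc_pos d
  rw [Tav_eq d φ (by positivity)]
  refine (int_bound (bmon_osc (n := n) hc h) (c := 0) (c' := (kc d)⁻¹ * ((RR n/64)^d)⁻¹) (v := x) (r := RR n) _ (by simpa using bmon_avg (n := n) h x le_rfl) (by positivity) (fun y hy => ?_) (fun y hy => ?_)).trans (le_of_eq ?_)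
  · rw [sub_zero, abs_mul, abs_of_nonneg (KK_nonneg d (by positivity) _), mul_comm]
    exact mul_le_mul_of_nonneg_right (KK_le d (by positivity) le_rfl _) (abs_nonneg _)
  · rw [KK_zero d (by positivity), mul_zero]
    rw [mem_ball, dist_comm, dist_eq_norm] at hy; linarith
  · unfold C6; rw [div_pow]; field_simp

lemma part_a (hd : d ≠ 0) : ∃ C : ℝ, 0 < C ∧ ∀ (n : ℤ) (f : E d → ℝ), Memh1n d n f →
    ∀ (φ : E d → ℝ) (B : ℝ), Continuous φ → (∀ x, |φ x| ≤ B) →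
      |∫ x, f x * φ x| ≤ C * (h1nNorm d n f).toReal * (bmonNorm d n φ).toReal := by
  obtain ⟨C, hC, h⟩ := exists_grand d
  have h5 := C5_nonneg d
  have h6 : 0 ≤ C6 d := by have := kc_pos d; unfold C6; positivity
  refine ⟨(4 * C5 d + C6 d) * C.toReal + 1, by positivity, fun n f hf φ B hc hB => ?_⟩
  obtain ⟨G, hG, hGi⟩ := h n f hf.1
  have hfin : C * h1nNorm d n f ≠ ∞ := ENNReal.mul_ne_top hC hf.2.ne
  have hp := pairing hd (RR_pos n) hf.1 hG (ne_top_of_le_ne_top hfin hGi) (bmon_osc (n := n) hc hB) h6 (Tav_coarse hc hB)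
  have h7 := ENNReal.toReal_mono hfin hGi
  rw [ENNReal.toReal_mul] at h7
  have hN : 0 ≤ (bmonNorm d n φ).toReal := ENNReal.toReal_nonneg
  have hH : 0 ≤ (h1nNorm d n f).toReal := ENNReal.toReal_nonneg
  refine hp.trans ?_
  calc _ ≤ (4 * C5 d + C6 d) * (bmonNorm d n φ).toReal * (C.toReal * (h1nNorm d n f).toReal) := by gcongr
    _ ≤ _ := by nlinarith [mul_nonneg hN hH]
end sc12

section sc13
variable {d : ℕ}

lemma wt_form {t : ℝ} (ht : 0 < t) (u : E d) : (t^d)⁻¹ * wt d (d+1) (t⁻¹ • u) = t / (t + ‖u‖)^(d+1) := by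
  unfold wt
  rw [norm_smul, Real.norm_of_nonneg (by positivity)]
  have : 1 + t⁻¹ * ‖u‖ = (t + ‖u‖) / t := by field_simp
  rw [this, div_pow]
  have : 0 < t + ‖u‖ := by positivity
  rw [pow_succ t]
  field_simp

/-- far constant -/
def C7 (d : ℕ) : ℝ := 2 * (CG d (d+1) * 4^(d+1))
lemma C7_pos (d : ℕ) : 0 < C7 d := by have := CG_pos d (d+1); unfold C7; positivity
/-- far majorant -/
def Hf (d : ℕ) (ρ : ℝ) (z x : E d) : ℝ := C7 d * ((ρ^d)⁻¹ * wt d (d+1) (ρ⁻¹ • (z - x)))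

lemma Hf_eq {ρ : ℝ} (hρ : 0 < ρ) (z x : E d) : Hf d ρ z x = C7 d * (ρ / (ρ + ‖x - z‖)^(d+1)) := by
  unfold Hf; rw [wt_form hρ, norm_sub_rev]

lemma Hf_integrable {ρ : ℝ} (hρ : 0 < ρ) (z : E d) : Integrable (Hf d ρ z) :=
  ((integrable_scaled (wt_integrable d le_rfl) hρ z).const_mul _).const_mul _

lemma Hf_nonneg {ρ : ℝ} (hρ : 0 < ρ) (z x : E d) : 0 ≤ Hf d ρ z x := by
  have := C7_pos d; rw [Hf_eq hρ]; positivity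

lemma Hf_integral {ρ : ℝ} (hρ : 0 < ρ) (z : E d) : ∫ x, Hf d ρ z x = C7 d * JJ d := by
  unfold Hf
  rw [integral_const_mul, integral_const_mul, integral_scaled _ hρ z]
  unfold JJ; field_simp

lemma pk_far {t ρ : ℝ} (ht : 0 < t) (htρ : t ≤ ρ) {x y z : E d} (hx : 2 * ρ ≤ ‖x - z‖) (hy : ‖y - z‖ < ρ) :
    pk d t (x - y) ≤ Hf d ρ z x / 2 := by
  have hρ : 0 < ρ := by linarith
  have hC := CG_pos d (d+1)
  have h1 : ‖x - z‖ ≤ ‖x - y‖ + ‖y - z‖ := norm_sub_le_norm_sub_add_norm_sub x y z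
  refine (pk_le d (d+1) ht _).trans ?_
  rw [wt_form ht, Hf_eq hρ]
  have h2 : t / (t + ‖x - y‖)^(d+1) ≤ 4^(d+1) * (ρ / (ρ + ‖x - z‖)^(d+1)) := by
    calc t / (t + ‖x - y‖)^(d+1) ≤ ρ / ((ρ + ‖x - z‖)/4)^(d+1) := by
          have : 0 < (ρ + ‖x - z‖)/4 := by positivity
          gcongr
          linarith
      _ = _ := by rw [div_pow]; field_simp
  calc _ ≤ CG d (d+1) * (4^(d+1) * (ρ / (ρ + ‖x - z‖)^(d+1))) := by gcongr
    _ = _ := by unfold C7; ring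

lemma pk_far_diff {t ρ : ℝ} (ht : 0 < t) (hρ : 0 < ρ) {x y z : E d} (hx : 2 * ρ ≤ ‖x - z‖) (hy : ‖y - z‖ < ρ) :
    |pk d t (x - y) - pk d t (x - z)| ≤ Hf d ρ z x := by
  have hC := CG_pos d (d+1)
  rcases le_or_gt t ρ with h | h
  · have h1 := pk_far ht h hx hy
    have h2 := pk_far (y := z) ht h hx (by simpa using hρ)
    have h3 := pk_nonneg d ht (x - y)
    have h4 := pk_nonneg d ht (x - z)
    rw [abs_le]; constructor <;> linarith
  · have e : ‖(x - z) - (x - y)‖ = ‖y - z‖ := by congr 1; abel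
    have h1 := pk_lip d (d+1) ht (x - z) (x - y) (by rw [e]; linarith)
    rw [e, wt_form ht] at h1
    rw [abs_sub_comm]
    refine h1.trans ?_
    rw [Hf_eq hρ]
    calc _ = CG d (d+1) * (‖y - z‖ / (t + ‖x - z‖)^(d+1)) := by field_simp
      _ ≤ CG d (d+1) * (ρ / (ρ + ‖x - z‖)^(d+1)) := by gcongr
      _ ≤ _ := by
          have : CG d (d+1) ≤ C7 d := by
            unfold C7
            have : (1:ℝ) ≤ 4^(d+1) := one_le_pow₀ (by norm_num)
            nlinarith
          gcongr

open BoundedContinuousFunction in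
/-- selected Gauss kernels -/
structure GK (d : ℕ) (R : ℝ) (w : E d → (E d →ᵇ ℝ)) : Prop where
  sm : StronglyMeasurable w
  form : ∀ x, ∃ t σ : ℝ, 0 < t ∧ t < R ∧ |σ| ≤ 1 ∧ ∀ y, w x y = σ * pk d t (x - y)
  bdd : ∃ b, ∀ x, ‖w x‖ ≤ b

open BoundedContinuousFunction
variable {R : ℝ} {w : E d → (E d →ᵇ ℝ)}

lemma GK.meas2 (h : GK d R w) : Measurable (fun q : E d × E d => w q.1 q.2) := by
  have : StronglyMeasurable (fun q : E d × E d => (w q.1, q.2)) :=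
    (h.sm.comp_measurable measurable_fst).prodMk measurable_snd.stronglyMeasurable
  exact (continuous_eval.comp_stronglyMeasurable this).measurable

lemma GK.int (h : GK d R w) (y : E d) {S : Set (E d)} (hS : volume S < ∞) : IntegrableOn (fun x => w x y) S := by
  obtain ⟨b, hb⟩ := h.bdd
  refine Measure.integrableOn_of_bounded (M := b) hS.ne (h.meas2.comp (measurable_id.prodMk measurable_const)).aestronglyMeasurable ?_
  filter_upwards with x
  exact ((w x).norm_coe_le_norm y).trans (hb x)

lemma GK.lint (h : GK d R w) (x : E d) : ∫⁻ y, ‖w x y‖ₑ ≤ 1 := by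
  obtain ⟨t, σ, ht, _, hσ, hw⟩ := h.form x
  calc _ ≤ ∫⁻ y, ENNReal.ofReal (pk d t (x - y)) := by
        refine lintegral_mono fun y => ?_
        rw [hw, Real.enorm_eq_ofReal_abs]
        apply ENNReal.ofReal_le_ofReal
        rw [abs_mul, abs_of_nonneg (pk_nonneg d ht _)]
        exact mul_le_of_le_one_left (pk_nonneg d ht _) hσ
    _ = 1 := by
        rw [← ofReal_integral_eq_lintegral_ofReal (pk_integrable d ht x) (Eventually.of_forall fun y => pk_nonneg d ht _), pk_integral d ht]; simp

/-- constant for the kernel average -/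
def C8 (d : ℕ) : ℝ := 2^d + C7 d * JJ d
lemma C8_nonneg (d : ℕ) : 0 ≤ C8 d := by have := C7_pos d; have := JJ_nonneg d; unfold C8; positivity

lemma GK.near (h : GK d R w) {K : Set (E d)} (z : E d) {ρ : ℝ} (hρ : 0 < ρ) :
    ∫⁻ y in ball z ρ, ‖∫ x in K ∩ ball z (2 * ρ), w x y‖ₑ ≤ ENNReal.ofReal (2^d * (ρ^d * (VD d).toReal)) := by
  calc _ ≤ ∫⁻ y in ball z ρ, ∫⁻ x in K ∩ ball z (2 * ρ), ‖w x y‖ₑ := lintegral_mono fun y => enorm_integral_le_lintegral_enorm _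
    _ = ∫⁻ x in K ∩ ball z (2 * ρ), ∫⁻ y in ball z ρ, ‖w x y‖ₑ := by
        refine lintegral_lintegral_swap ?_
        exact (h.meas2.comp measurable_swap).enorm.aemeasurable
    _ ≤ ∫⁻ x in K ∩ ball z (2 * ρ), 1 := lintegral_mono fun x => (setLIntegral_le_lintegral _ _).trans (h.lint x)
    _ ≤ volume (ball z (2 * ρ)) := by simp; exact measure_mono Set.inter_subset_right
    _ = _ := by
        rw [← ENNReal.ofReal_toReal (vol_ball_ne_top d z (2*ρ)), vol_toReal z (by linarith), mul_pow, mul_assoc]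

lemma GK.far (h : GK d R w) {K : Set (E d)} (hK : MeasurableSet K) (hKf : volume K < ∞) (z : E d) {ρ : ℝ} (hρ : 0 < ρ) {y : E d} (hy : y ∈ ball z ρ) :
    |(∫ x in K \ ball z (2 * ρ), w x y) - ∫ x in K \ ball z (2 * ρ), w x z| ≤ C7 d * JJ d ∧
    (R ≤ ρ → |∫ x in K \ ball z (2 * ρ), w x y| ≤ C7 d * JJ d) := by
  have hf : volume (K \ ball z (2 * ρ)) < ∞ := (measure_mono Set.sdiff_subset).trans_lt hKf
  have hm : MeasurableSet (K \ ball z (2 * ρ)) := hK.diff measurableSet_ball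
  rw [mem_ball, dist_eq_norm] at hy
  have hle : ∫ x in K \ ball z (2 * ρ), Hf d ρ z x ≤ C7 d * JJ d := by
    rw [← Hf_integral hρ z]
    exact setIntegral_le_integral (Hf_integrable hρ z) (Eventually.of_forall fun x => Hf_nonneg hρ z x)
  constructor
  · rw [← integral_sub (h.int y hf) (h.int z hf)]
    refine (norm_integral_le_of_norm_le (f := fun x => w x y - w x z) (g := Hf d ρ z) (Hf_integrable hρ z).integrableOn ?_).trans hle
    filter_upwards [ae_restrict_mem hm] with x hx
    obtain ⟨t, σ, ht, _, hσ, hw⟩ := h.form x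
    rw [hw, hw, ← mul_sub, norm_mul]
    have hx' : 2 * ρ ≤ ‖x - z‖ := by have := hx.2; rw [mem_ball, dist_eq_norm] at this; exact not_lt.1 this
    exact (mul_le_of_le_one_left (norm_nonneg _) hσ).trans (pk_far_diff ht hρ hx' hy)
  · intro hR
    refine (norm_integral_le_of_norm_le (f := fun x => w x y) (g := Hf d ρ z) (Hf_integrable hρ z).integrableOn ?_).trans hle
    filter_upwards [ae_restrict_mem hm] with x hx
    obtain ⟨t, σ, ht, htR, hσ, hw⟩ := h.form x
    rw [hw, norm_mul]
    have hx' : 2 * ρ ≤ ‖x - z‖ := by have := hx.2; rw [mem_ball, dist_eq_norm] at this; exact not_lt.1 this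
    refine (mul_le_of_le_one_left (norm_nonneg _) hσ).trans ?_
    rw [Real.norm_of_nonneg (pk_nonneg d ht _)]
    have := pk_far ht (by linarith) hx' hy
    have := Hf_nonneg hρ z x
    linarith

/-- combining near and far parts -/
lemma GK.osc (h : GK d R w) {K : Set (E d)} (hKf : volume K < ∞) (z : E d) {ρ : ℝ} (hρ : 0 < ρ) (c : ℝ)
    (hc : ∀ y ∈ ball z ρ, |(∫ x in K \ ball z (2 * ρ), w x y) - c| ≤ C7 d * JJ d) :
    ∫⁻ y in ball z ρ, ENNReal.ofReal |(∫ x in K, w x y) - c| ≤ ENNReal.ofReal (C8 d * (ρ^d * (VD d).toReal)) := by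
  have h7 := C7_pos d
  have hJ := JJ_nonneg d
  calc _ ≤ ∫⁻ y in ball z ρ, (‖∫ x in K ∩ ball z (2 * ρ), w x y‖ₑ + ENNReal.ofReal (C7 d * JJ d)) := by
        refine setLIntegral_mono' measurableSet_ball fun y hy => ?_
        rw [Real.enorm_eq_ofReal_abs, ← ENNReal.ofReal_add (abs_nonneg _) (by positivity)]
        apply ENNReal.ofReal_le_ofReal
        rw [← integral_inter_add_sdiff (measurableSet_ball (x := z) (ε := 2 * ρ)) (h.int y hKf), add_sub_assoc]
        exact (abs_add_le _ _).trans (by linarith [hc y hy])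
    _ = (∫⁻ y in ball z ρ, ‖∫ x in K ∩ ball z (2 * ρ), w x y‖ₑ) + ENNReal.ofReal (C7 d * JJ d) * volume (ball z ρ) := by
        rw [lintegral_add_right _ measurable_const]; simp
    _ ≤ ENNReal.ofReal (2^d * (ρ^d * (VD d).toReal)) + ENNReal.ofReal (C7 d * JJ d * (ρ^d * (VD d).toReal)) := by
        refine add_le_add (h.near z hρ) (le_of_eq ?_)
        rw [← vol_toReal z hρ, ENNReal.ofReal_mul (p := C7 d * JJ d) (by positivity), ENNReal.ofReal_toReal (vol_ball_ne_top d z ρ)]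
    _ = _ := by rw [← ENNReal.ofReal_add (by positivity) (by positivity)]; congr 1; unfold C8; ring
end sc13

section sc14
variable {d : ℕ} {n : ℤ} {φ ψ : E d → ℝ}

lemma cio (hc : Continuous φ) (x : E d) (r : ℝ) : IntegrableOn φ (ball x r) :=
  (hc.continuousOn.integrableOn_compact (isCompact_closedBall x r)).mono_set ball_subset_closedBall

lemma ballAvg_add (hc : Continuous φ) (hc' : Continuous ψ) (x : E d) (r : ℝ) :
    ballAvg d (fun y => φ y + ψ y) x r = ballAvg d φ x r + ballAvg d ψ x r := by
  unfold ballAvg; rw [integral_add (cio hc x r) (cio hc' x r), mul_add]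

lemma ballAvg_mono (hc : Continuous φ) (hc' : Continuous ψ) (x : E d) (r : ℝ) (h : ∀ y, φ y ≤ ψ y) :
    ballAvg d φ x r ≤ ballAvg d ψ x r := by
  unfold ballAvg
  exact mul_le_mul_of_nonneg_left (setIntegral_mono (cio hc x r) (cio hc' x r) h) (by positivity)

lemma ballAvg_smul (c : ℝ) (φ : E d → ℝ) (x : E d) (r : ℝ) : ballAvg d (fun y => c * φ y) x r = c * ballAvg d φ x r := by
  unfold ballAvg; rw [integral_const_mul]; ring

lemma ballAvg_nonneg (x : E d) (r : ℝ) (h : ∀ y, 0 ≤ φ y) : 0 ≤ ballAvg d φ x r := by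
  unfold ballAvg
  exact mul_nonneg (by positivity) (integral_nonneg h)

lemma bmon_smul {c : ℝ} (hc : 0 ≤ c) (φ : E d → ℝ) : bmonNorm d n (fun y => c * φ y) = ENNReal.ofReal c * bmonNorm d n φ := by
  unfold bmonNorm bmoNormE
  simp only [mul_add, ENNReal.mul_iSup, ← ENNReal.ofReal_mul hc]
  congr 1
  · refine iSup_congr fun x => iSup_congr fun r => iSup_congr fun _ => ?_
    congr 1
    unfold oscB
    rw [← ballAvg_smul]
    congr 1
    ext y
    rw [ballAvg_smul, ← mul_sub, abs_mul, abs_of_nonneg hc]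
  · refine iSup_congr fun x => iSup_congr fun r => iSup_congr fun _ => ?_
    congr 1
    rw [← ballAvg_smul]
    congr 1
    ext y
    rw [abs_mul, abs_of_nonneg hc]

lemma bmon_add (hc : Continuous φ) (hc' : Continuous ψ) :
    bmonNorm d n (fun y => φ y + ψ y) ≤ bmonNorm d n φ + bmonNorm d n ψ := by
  unfold bmonNorm bmoNormE
  rw [add_add_add_comm]
  refine add_le_add (iSup_le fun x => iSup_le fun r => iSup_le fun hr => ?_) (iSup_le fun x => iSup_le fun r => iSup_le fun hr => ?_)
  · refine le_trans ?_ (add_le_add (le_iSup_of_le x (le_iSup_of_le r (le_iSup_of_le hr le_rfl))) (le_iSup_of_le x (le_iSup_of_le r (le_iSup_of_le hr le_rfl))))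
    unfold oscB
    rw [← ENNReal.ofReal_add (ballAvg_nonneg _ _ fun _ => abs_nonneg _) (ballAvg_nonneg _ _ fun _ => abs_nonneg _)]
    apply ENNReal.ofReal_le_ofReal
    rw [← ballAvg_add (by fun_prop) (by fun_prop)]
    refine ballAvg_mono (by fun_prop) (by fun_prop) _ _ fun y => ?_
    rw [ballAvg_add hc hc', add_sub_add_comm]
    exact abs_add_le _ _
  · refine le_trans ?_ (add_le_add (le_iSup_of_le x (le_iSup_of_le r (le_iSup_of_le hr le_rfl))) (le_iSup_of_le x (le_iSup_of_le r (le_iSup_of_le hr le_rfl))))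
    rw [← ENNReal.ofReal_add (ballAvg_nonneg _ _ fun _ => abs_nonneg _) (ballAvg_nonneg _ _ fun _ => abs_nonneg _)]
    apply ENNReal.ofReal_le_ofReal
    rw [← ballAvg_add (by fun_prop) (by fun_prop)]
    exact ballAvg_mono (by fun_prop) (by fun_prop) _ _ fun y => abs_add_le _ _

lemma avg_of_lint (hc : Continuous φ) {X : ℝ} (hX : 0 ≤ X) (x : E d) {r : ℝ} (hr : 0 < r) (c : ℝ)
    (h : ∫⁻ y in ball x r, ENNReal.ofReal |φ y - c| ≤ ENNReal.ofReal (X * (r^d * (VD d).toReal))) :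
    ballAvg d (fun y => |φ y - c|) x r ≤ X := by
  have hv := vol_toReal_pos x hr
  unfold ballAvg
  rw [inv_mul_le_iff₀ hv, mul_comm, vol_toReal x hr]
  rw [← ofReal_integral_eq_lintegral_ofReal (cio (by fun_prop) x r) (Eventually.of_forall fun _ => abs_nonneg _)] at h
  exact (ENNReal.ofReal_le_ofReal_iff (by positivity)).1 h

lemma bmon_of_osc (hc : Continuous φ) {X : ℝ} (hX : 0 ≤ X)
    (h1 : ∀ (x : E d) (r : ℝ), 0 < r → ∃ c, ∫⁻ y in ball x r, ENNReal.ofReal |φ y - c| ≤ ENNReal.ofReal (X * (r^d * (VD d).toReal)))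
    (h2 : ∀ (x : E d) (r : ℝ), RR n ≤ r → ∫⁻ y in ball x r, ENNReal.ofReal |φ y - 0| ≤ ENNReal.ofReal (X * (r^d * (VD d).toReal))) :
    bmonNorm d n φ ≤ ENNReal.ofReal (3 * X) := by
  have e : ENNReal.ofReal (3 * X) = ENNReal.ofReal (2 * X) + ENNReal.ofReal X := by
    rw [← ENNReal.ofReal_add (by positivity) hX]; congr 1; ring
  rw [e]
  unfold bmonNorm bmoNormE
  refine add_le_add (iSup_le fun x => iSup_le fun r => iSup_le fun hr => ?_) (iSup_le fun x => iSup_le fun r => iSup_le fun hr => ?_)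
  · apply ENNReal.ofReal_le_ofReal
    obtain ⟨c, h⟩ := h1 x r hr
    have h3 := avg_of_lint hc hX x hr c h
    have hk : ∀ a : ℝ, ballAvg d (fun _ => a) x r = a := fun a => by
      have hv := vol_toReal_pos x hr
      unfold ballAvg
      rw [setIntegral_const, smul_eq_mul, measureReal_def, ← mul_assoc, inv_mul_cancel₀ hv.ne', one_mul]
    have h4 : |ballAvg d φ x r - c| ≤ X := by
      rw [abs_le]
      constructor
      · have := ballAvg_mono (φ := fun y => c + (-1) * |φ y - c|) (by fun_prop) hc x r fun y => by
          have := neg_abs_le (φ y - c); linarith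
        rw [ballAvg_add (by fun_prop) (by fun_prop), ballAvg_smul, hk] at this
        linarith
      · have := ballAvg_mono (ψ := fun y => c + |φ y - c|) hc (by fun_prop) x r fun y => by
          have := le_abs_self (φ y - c); linarith
        rw [ballAvg_add (by fun_prop) (by fun_prop), hk] at this
        linarith
    have h5 := ballAvg_mono (φ := fun y => |φ y - ballAvg d φ x r|) (ψ := fun y => |φ y - c| + X) (by fun_prop) (by fun_prop) x r fun y => by
      have := abs_sub_le (φ y) c (ballAvg d φ x r)
      rw [abs_sub_comm c] at this; linarith
    rw [ballAvg_add (by fun_prop) (by fun_prop), hk] at h5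
    unfold oscB; linarith
  · apply ENNReal.ofReal_le_ofReal
    have := avg_of_lint hc hX x ((RR_pos n).trans_le hr) 0 (h2 x r hr)
    simpa using this

open BoundedContinuousFunction
variable {w : E d → (E d →ᵇ ℝ)}

lemma GK.bmon (h : GK d (RR n) w) {K : Set (E d)} (hK : MeasurableSet K) (hKf : volume K < ∞) (hc : Continuous fun y => ∫ x in K, w x y) :
    bmonNorm d n (fun y => ∫ x in K, w x y) ≤ ENNReal.ofReal (3 * C8 d) := by
  refine bmon_of_osc hc (C8_nonneg d) (fun z ρ hρ => ⟨_, h.osc hKf z hρ (∫ x in K \ ball z (2 * ρ), w x z) fun y hy => (h.far hK hKf z hρ hy).1⟩) (fun z ρ hρ => ?_)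
  have h0 := (RR_pos n).trans_le hρ
  refine h.osc hKf z h0 0 fun y hy => ?_
  rw [sub_zero]
  exact (h.far hK hKf z h0 hy).2 hρ

/-- Hahn–Banach extension to bounded continuous functions -/
lemma hb_ext {T : (E d → ℝ) → ℝ} {M : ℝ} (hM : 0 ≤ M)
    (hadd : ∀ φ ψ : E d → ℝ, ContDiff ℝ (⊤ : ℕ∞) φ → HasCompactSupport φ →
          ContDiff ℝ (⊤ : ℕ∞) ψ → HasCompactSupport ψ → T (φ + ψ) = T φ + T ψ)
    (hsm : ∀ (c : ℝ) (φ : E d → ℝ), ContDiff ℝ (⊤ : ℕ∞) φ → HasCompactSupport φ → T (c • φ) = c * T φ)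
    (hb : ∀ φ : E d → ℝ, ContDiff ℝ (⊤ : ℕ∞) φ → HasCompactSupport φ → |T φ| ≤ M * (bmonNorm d n φ).toReal) :
    ∃ L : (E d →ᵇ ℝ) →L[ℝ] ℝ, (∀ φ : E d →ᵇ ℝ, L φ ≤ M * (bmonNorm d n φ).toReal) ∧
      ∀ φ : E d →ᵇ ℝ, ContDiff ℝ (⊤ : ℕ∞) φ → HasCompactSupport φ → L φ = T φ := by
  let S : Submodule ℝ (E d →ᵇ ℝ) :=
    { carrier := {φ | ContDiff ℝ (⊤ : ℕ∞) φ ∧ HasCompactSupport φ}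
      add_mem' := fun {a b} ha hb => ⟨ha.1.add hb.1, ha.2.add hb.2⟩
      zero_mem' := ⟨contDiff_const, HasCompactSupport.zero⟩
      smul_mem' := fun c a ha => ⟨contDiff_const.smul ha.1, ha.2.smul_left (f := fun _ => c)⟩ }
  let f : (E d →ᵇ ℝ) →ₗ.[ℝ] ℝ :=
    { domain := S
      toFun :=
        { toFun := fun φ => T φ.1
          map_add' := fun a b => hadd _ _ a.2.1 a.2.2 b.2.1 b.2.2
          map_smul' := fun c a => hsm c _ a.2.1 a.2.2 } }
  have hfin : ∀ φ : E d →ᵇ ℝ, bmonNorm d n φ ≤ ENNReal.ofReal (3 * ‖φ‖) := fun φ => bmon_le n φ.norm_coe_le_norm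
  have hft : ∀ φ : E d →ᵇ ℝ, bmonNorm d n φ ≠ ∞ := fun φ => ((hfin φ).trans_lt ENNReal.ofReal_lt_top).ne
  obtain ⟨g, hg1, hg2⟩ := exists_extension_of_le_sublinear f (fun φ => M * (bmonNorm d n φ).toReal)
    (fun c hc φ => by
      have := bmon_smul (n := n) hc.le φ
      show M * (bmonNorm d n (fun y => c * φ y)).toReal = _
      rw [this, ENNReal.toReal_mul, ENNReal.toReal_ofReal hc.le]; ring)
    (fun φ ψ => by
      have := bmon_add (n := n) φ.continuous ψ.continuous
      have := ENNReal.toReal_mono (ENNReal.add_ne_top.2 ⟨hft φ, hft ψ⟩) this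
      rw [ENNReal.toReal_add (hft φ) (hft ψ)] at this
      rw [← mul_add]
      exact mul_le_mul_of_nonneg_left this hM)
    (fun φ => (le_abs_self _).trans (hb _ φ.2.1 φ.2.2))
  have hle : ∀ φ, g φ ≤ M * 3 * ‖φ‖ := fun φ => by
    refine (hg2 φ).trans ?_
    rw [mul_assoc]
    refine mul_le_mul_of_nonneg_left ?_ hM
    exact ENNReal.toReal_le_of_le_ofReal (by positivity) (hfin φ)
  refine ⟨g.mkContinuous (M * 3) fun φ => ?_, hg2, fun φ h1 h2 => hg1 ⟨φ, h1, h2⟩⟩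
  rw [Real.norm_eq_abs, abs_le]
  refine ⟨?_, hle φ⟩
  have := hle (-φ)
  rw [map_neg, norm_neg] at this; linarith
end sc14

section sc15
open BoundedContinuousFunction
variable {d : ℕ} {n : ℤ}

/-- Gauss kernel centred at x as a bounded continuous function -/
def PB (d : ℕ) (t : ℝ) (x : E d) : E d →ᵇ ℝ :=
  if ht : 0 < t then BoundedContinuousFunction.ofNormedAddCommGroup (fun y => pk d t (x - y))
    ((pk_continuous d t).comp (by fun_prop)) (CG d 0 * (t^d)⁻¹)
    (fun y => by rw [Real.norm_of_nonneg (pk_nonneg d ht _)]; exact pk_bdd d ht _) else 0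

lemma PB_apply {t : ℝ} (ht : 0 < t) (x y : E d) : PB d t x y = pk d t (x - y) := by
  unfold PB; rw [dif_pos ht]; rfl

lemma PB_norm {t : ℝ} (ht : 0 < t) (x : E d) : ‖PB d t x‖ ≤ CG d 0 * (t^d)⁻¹ := by
  have := CG_pos d 0
  refine (BoundedContinuousFunction.norm_le (by positivity)).2 fun y => ?_
  rw [PB_apply ht, Real.norm_of_nonneg (pk_nonneg d ht _)]; exact pk_bdd d ht _

lemma PB_continuous {t : ℝ} (ht : 0 < t) : Continuous (PB d t) := by
  have hC := CG_pos d 0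
  rw [continuous_iff_continuousAt]
  intro x
  refine tendsto_iff_norm_sub_tendsto_zero.2 ?_
  refine squeeze_zero' (g := fun a => CG d 0 * (‖x - a‖/t) * (t^d)⁻¹) (Eventually.of_forall fun _ => norm_nonneg _) ?_ ?_
  · filter_upwards [ball_mem_nhds x ht] with a ha
    rw [mem_ball, dist_comm, dist_eq_norm] at ha
    refine (BoundedContinuousFunction.norm_le (by positivity)).2 fun y => ?_
    rw [BoundedContinuousFunction.sub_apply, PB_apply ht, PB_apply ht, norm_sub_rev, Real.norm_eq_abs]
    have e : x - y - (a - y) = x - a := by abel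
    have := pk_lip d 0 ht (x - y) (a - y) (by rw [e]; exact ha.le)
    rw [e] at this
    refine this.trans ?_
    have h1 := wt_le_one d 0 (t⁻¹ • (x - y))
    have : (t^d)⁻¹ * wt d 0 (t⁻¹ • (x - y)) ≤ (t^d)⁻¹ := mul_le_of_le_one_right (by positivity) h1
    gcongr
  · have : Continuous fun a : E d => CG d 0 * (‖x - a‖/t) * (t^d)⁻¹ := by fun_prop
    have := this.tendsto x
    simpa using this

lemma PB_sm {t : ℝ} (ht : 0 < t) : StronglyMeasurable (PB d t) := (PB_continuous ht).stronglyMeasurable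

variable (L : (E d →ᵇ ℝ) →L[ℝ] ℝ)

lemma u_meas {t : ℝ} (ht : 0 < t) : Continuous fun x => L (PB d t x) := L.continuous.comp (PB_continuous ht)

lemma sel {R : ℝ} (hR : 0 < R) {ts : ℕ → ℝ} (hts : ∀ i, 0 < ts i ∧ ts i < R) (k : ℕ) :
    ∃ w, GK d R w ∧ ∀ x, 0 ≤ L (w x) ∧ ∀ i < k, |L (PB d (ts i) x)| ≤ L (w x) := by
  induction k with
  | zero => exact ⟨fun _ => 0, ⟨stronglyMeasurable_const, fun x => ⟨R/2, 0, by linarith, by linarith, by simp, by simp⟩, ⟨0, by simp⟩⟩, by simp⟩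
  | succ k ih =>
    obtain ⟨w, hw, hwi⟩ := ih
    obtain ⟨b, hb⟩ := hw.bdd
    obtain ⟨ht, htR⟩ := hts k
    set t := ts k with htd
    have hu := (u_meas L ht).measurable
    have hLw : Measurable fun x => L (w x) := (L.continuous.comp_stronglyMeasurable hw.sm).measurable
    let σ : E d → ℝ := fun x => if 0 ≤ L (PB d t x) then 1 else -1
    have hσ : Measurable σ := Measurable.ite (measurableSet_le measurable_const hu) measurable_const measurable_const
    have hσ1 : ∀ x, |σ x| ≤ 1 := fun x => by simp only [σ]; split_ifs <;> simp
    have hσL : ∀ x, L (σ x • PB d t x) = |L (PB d t x)| := fun x => by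
      simp only [σ]
      split_ifs with h
      · rw [one_smul, abs_of_nonneg h]
      · rw [map_smul, abs_of_neg (not_le.1 h), smul_eq_mul]; ring
    classical
    refine ⟨fun x => if L (w x) < |L (PB d t x)| then σ x • PB d t x else w x, ⟨?_, ?_, ?_⟩, ?_⟩
    · exact StronglyMeasurable.ite (measurableSet_lt hLw hu.abs) (hσ.stronglyMeasurable.smul (PB_sm ht)) hw.sm
    · intro x
      by_cases h : L (w x) < |L (PB d t x)|
      · simp only [if_pos h]
        exact ⟨t, σ x, ht, htR, hσ1 x, fun y => by rw [BoundedContinuousFunction.smul_apply, PB_apply ht, smul_eq_mul]⟩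
      · simp only [if_neg h]; exact hw.form x
    · refine ⟨max b (CG d 0 * (t^d)⁻¹), fun x => ?_⟩
      by_cases h : L (w x) < |L (PB d t x)|
      · simp only [if_pos h]
        rw [norm_smul]
        exact ((mul_le_of_le_one_left (norm_nonneg _) (hσ1 x)).trans (PB_norm ht x)).trans (le_max_right _ _)
      · simp only [if_neg h]; exact (hb x).trans (le_max_left _ _)
    · intro x
      by_cases h : L (w x) < |L (PB d t x)|
      · simp only [if_pos h, hσL]
        refine ⟨abs_nonneg _, fun i hi => ?_⟩
        rcases Nat.lt_succ_iff_lt_or_eq.1 hi with h' | rfl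
        · exact ((hwi x).2 i h').trans h.le
        · exact le_rfl
      · simp only [if_neg h]
        refine ⟨(hwi x).1, fun i hi => ?_⟩
        rcases Nat.lt_succ_iff_lt_or_eq.1 hi with h' | rfl
        · exact (hwi x).2 i h'
        · exact not_lt.1 h

variable {L} {M : ℝ}

lemma sel_int (hM : 0 ≤ M) (hL : ∀ φ : E d →ᵇ ℝ, L φ ≤ M * (bmonNorm d n φ).toReal) {w : E d → (E d →ᵇ ℝ)}
    (hw : GK d (RR n) w) (h0 : ∀ x, 0 ≤ L (w x)) {K : Set (E d)} (hK : MeasurableSet K) (hKf : volume K < ∞) :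
    ∫⁻ x in K, ENNReal.ofReal (L (w x)) ≤ ENNReal.ofReal (3 * C8 d * M) := by
  obtain ⟨b, hb⟩ := hw.bdd
  have hi : IntegrableOn w K := Measure.integrableOn_of_bounded (M := b) hKf.ne hw.sm.aestronglyMeasurable (Eventually.of_forall hb)
  have hΦ : (fun y => ∫ x in K, w x y) = (∫ x in K, w x : E d →ᵇ ℝ) := by
    ext y
    exact (BoundedContinuousFunction.evalCLM ℝ y).integral_comp_comm hi
  have hC8 := C8_nonneg d
  have h1 := hw.bmon hK hKf (by rw [hΦ]; exact BoundedContinuousFunction.continuous _)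
  rw [hΦ] at h1
  rw [← ofReal_integral_eq_lintegral_ofReal (L.integrable_comp hi) (Eventually.of_forall h0), L.integral_comp_comm hi]
  apply ENNReal.ofReal_le_ofReal
  refine (hL _).trans ?_
  rw [mul_comm]
  exact mul_le_mul_of_nonneg_right (ENNReal.toReal_le_of_le_ofReal (by positivity) h1) hM

/-- maximal function of the functional along a sequence -/
def mx (L : (E d →ᵇ ℝ) →L[ℝ] ℝ) (ts : ℕ → ℝ) (x : E d) : ℝ≥0∞ := ⨆ i, ENNReal.ofReal |L (PB d (ts i) x)|

lemma mx_meas {R : ℝ} {ts : ℕ → ℝ} (hts : ∀ i, 0 < ts i ∧ ts i < R) : Measurable (mx L ts) :=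
  Measurable.iSup fun i => (u_meas L (hts i).1).abs.measurable.ennreal_ofReal

lemma mx_int (hM : 0 ≤ M) (hL : ∀ φ : E d →ᵇ ℝ, L φ ≤ M * (bmonNorm d n φ).toReal) {ts : ℕ → ℝ} (hts : ∀ i, 0 < ts i ∧ ts i < RR n) :
    ∫⁻ x, mx L ts x ≤ ENNReal.ofReal (3 * C8 d * M) := by
  let F : ℕ → E d → ℝ≥0∞ := fun k => (ball (0 : E d) k).indicator fun x => ⨆ i, ⨆ _ : i < k, ENNReal.ofReal |L (PB d (ts i) x)|
  have hmeas : ∀ k, Measurable (F k) := fun k =>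
    (Measurable.iSup fun i => Measurable.iSup_Prop _ ((u_meas L (hts i).1).abs.measurable.ennreal_ofReal)).indicator measurableSet_ball
  have hmono : Monotone F := by
    intro k l hkl x
    have hs : ball (0 : E d) k ⊆ ball (0 : E d) l := ball_subset_ball (by exact_mod_cast hkl)
    simp only [F]
    refine (Set.indicator_le_indicator_of_subset hs (fun _ => zero_le) x).trans ?_
    refine Set.indicator_le_indicator ?_
    exact iSup_mono fun i => iSup_const_mono fun h => h.trans_le hkl
  have hle : ∀ x, mx L ts x ≤ ⨆ k, F k x := by
    intro x
    refine iSup_le fun i => ?_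
    obtain ⟨k, hk⟩ := exists_nat_gt (max (i:ℝ) ‖x‖)
    refine le_iSup_of_le k ?_
    have hx : x ∈ ball (0 : E d) k := by rw [mem_ball_zero_iff]; exact (le_max_right _ _).trans_lt hk
    have hi : i < k := by exact_mod_cast (le_max_left _ _).trans_lt hk
    simp only [F]
    rw [Set.indicator_of_mem hx]
    exact le_iSup₂ (f := fun i (_ : i < k) => ENNReal.ofReal |L (PB d (ts i) x)|) i hi
  refine (lintegral_mono hle).trans ?_
  rw [lintegral_iSup hmeas hmono]
  refine iSup_le fun k => ?_
  obtain ⟨w, hw, hwi⟩ := sel L (RR_pos n) hts k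
  simp only [F]
  rw [lintegral_indicator measurableSet_ball]
  refine (lintegral_mono fun x => ?_).trans (sel_int hM hL hw (fun x => (hwi x).1) measurableSet_ball measure_ball_lt_top)
  exact iSup₂_le fun i hi => ENNReal.ofReal_le_ofReal ((hwi x).2 i hi)
end sc15

section sc16
open BoundedContinuousFunction
variable {d : ℕ} {n : ℤ} {L : (E d →ᵇ ℝ) →L[ℝ] ℝ}

lemma norm_mul_pk {t : ℝ} (ht : 0 < t) (u : E d) :
    ‖u‖ * pk d t u ≤ CG d (d+2) * t * ((t^d)⁻¹ * wt d (d+1) (t⁻¹ • u)) := by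
  have hC := CG_pos d (d+2)
  have h1 := pk_le d (d+2) ht u
  have h2 : ‖u‖ * wt d (d+2) (t⁻¹ • u) ≤ t * wt d (d+1) (t⁻¹ • u) := by
    have e : ‖u‖ = t * ‖t⁻¹ • u‖ := by
      rw [norm_smul, Real.norm_of_nonneg (by positivity)]; field_simp
    rw [e]
    unfold wt
    set v := ‖t⁻¹ • u‖ with hv
    have hv0 : 0 ≤ v := norm_nonneg _
    clear_value v
    rw [mul_assoc]
    refine mul_le_mul_of_nonneg_left ?_ ht.le
    rw [← div_eq_mul_inv, div_le_iff₀ (by positivity), pow_succ (1+v) (d+1), ← mul_assoc, inv_mul_cancel₀ (by positivity)]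
    linarith
  calc _ ≤ ‖u‖ * (CG d (d+2) * ((t^d)⁻¹ * wt d (d+2) (t⁻¹ • u))) := by gcongr
    _ = CG d (d+2) * (t^d)⁻¹ * (‖u‖ * wt d (d+2) (t⁻¹ • u)) := by ring
    _ ≤ CG d (d+2) * (t^d)⁻¹ * (t * wt d (d+1) (t⁻¹ • u)) := by gcongr
    _ = _ := by ring

lemma conv_close {φ : E d →ᵇ ℝ} (hs : HasCompactSupport φ) {K : ℝ≥0} (hK : LipschitzWith K φ) {t : ℝ} (ht : 0 < t) :
    Integrable (fun x => φ x • PB d t x) ∧ ‖φ - ∫ x, φ x • PB d t x‖ ≤ K * (CG d (d+2) * t * JJ d) := by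
  have hC := CG_pos d (d+2)
  have hJ := JJ_nonneg d
  have hi : Integrable (fun x => φ x • PB d t x) :=
    (φ.continuous.smul (PB_continuous ht)).integrable_of_hasCompactSupport hs.smul_right
  refine ⟨hi, (BoundedContinuousFunction.norm_le (by positivity)).2 fun y => ?_⟩
  have e1 : (∫ x, φ x • PB d t x) y = ∫ x, φ x * pk d t (y - x) := by
    rw [← BoundedContinuousFunction.evalCLM_apply ℝ, ← ContinuousLinearMap.integral_comp_comm _ hi]
    congr 1; ext x
    rw [BoundedContinuousFunction.evalCLM_apply, BoundedContinuousFunction.smul_apply, PB_apply ht, ← pk_symm, neg_sub, smul_eq_mul]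
  have hi2 : Integrable (fun x => φ x * pk d t (y - x)) := by
    refine ((pk_integrable d ht y).const_mul ‖φ‖).mono' ((φ.continuous.mul ((pk_continuous d t).comp (by fun_prop))).aestronglyMeasurable) (Eventually.of_forall fun x => ?_)
    rw [norm_mul, Real.norm_of_nonneg (pk_nonneg d ht _)]
    exact mul_le_mul_of_nonneg_right (φ.norm_coe_le_norm x) (pk_nonneg d ht _)
  have e2 : φ y = ∫ x, φ y * pk d t (y - x) := by rw [integral_const_mul, pk_integral d ht, mul_one]
  rw [BoundedContinuousFunction.sub_apply, e1, e2, ← integral_sub ((pk_integrable d ht y).const_mul _) hi2]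
  have e3 : ∫ x, K * (CG d (d+2) * t * ((t^d)⁻¹ * wt d (d+1) (t⁻¹ • (y - x)))) = K * (CG d (d+2) * t * JJ d) := by
    simp only [integral_const_mul]
    rw [integral_scaled _ ht y]
    unfold JJ; field_simp
  rw [← e3]
  refine norm_integral_le_of_norm_le (((((integrable_scaled (wt_integrable d le_rfl) ht y).const_mul _).const_mul _).const_mul _)) (Eventually.of_forall fun x => ?_)
  rw [← sub_mul, norm_mul, Real.norm_of_nonneg (pk_nonneg d ht _)]
  have h1 := hK.norm_sub_le y x
  have h2 := pk_nonneg d ht (y - x)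
  calc _ ≤ K * ‖y - x‖ * pk d t (y - x) := by gcongr
    _ = K * (‖y - x‖ * pk d t (y - x)) := by ring
    _ ≤ _ := mul_le_mul_of_nonneg_left (norm_mul_pk ht _) K.2

lemma L_le_mx {R : ℝ} {ts : ℕ → ℝ} (hts : ∀ i, 0 < ts i ∧ ts i < R) (hsm : ∀ ε > 0, ∃ i, ts i < ε)
    {φ : E d →ᵇ ℝ} (hφ : ContDiff ℝ (⊤ : ℕ∞) φ) (hs : HasCompactSupport φ) :
    ENNReal.ofReal |L φ| ≤ ∫⁻ x, ‖φ x‖ₑ * mx L ts x := by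
  obtain ⟨K, hK⟩ := ContDiff.lipschitzWith_of_hasCompactSupport hs hφ (by simp)
  have hC := CG_pos d (d+2)
  have hJ := JJ_nonneg d
  refine ENNReal.le_of_forall_pos_le_add fun ε hε _ => ?_
  set c := ‖L‖ * (K * (CG d (d+2) * JJ d)) + 1 with hc
  have hc0 : 0 < c := by positivity
  obtain ⟨i, hi⟩ := hsm (ε / c) (by positivity)
  obtain ⟨ht, _⟩ := hts i
  obtain ⟨h1, h2⟩ := conv_close hs hK ht
  have h3 : |L φ| ≤ |L (∫ x, φ x • PB d (ts i) x)| + ε := by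
    have h4 : |L (φ - ∫ x, φ x • PB d (ts i) x)| ≤ ε := by
      refine (L.le_opNorm _).trans ?_
      calc _ ≤ ‖L‖ * (K * (CG d (d+2) * ts i * JJ d)) := by gcongr
        _ ≤ c * ts i := by rw [hc]; nlinarith
        _ ≤ ε := by rw [lt_div_iff₀ hc0] at hi; linarith
    rw [map_sub] at h4
    have := abs_sub_abs_le_abs_sub (L φ) (L (∫ x, φ x • PB d (ts i) x))
    linarith
  refine (ENNReal.ofReal_le_ofReal h3).trans ?_
  rw [ENNReal.ofReal_add (abs_nonneg _) (NNReal.coe_nonneg ε), ENNReal.ofReal_coe_nnreal]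
  gcongr
  rw [← L.integral_comp_comm h1, ← Real.enorm_eq_ofReal_abs]
  refine (enorm_integral_le_lintegral_enorm _).trans (lintegral_mono fun x => ?_)
  rw [map_smul, smul_eq_mul, enorm_mul]
  gcongr
  rw [Real.enorm_eq_ofReal_abs]
  exact le_iSup (fun i => ENNReal.ofReal |L (PB d (ts i) x)|) i
end sc16

section sc17
open BoundedContinuousFunction
variable {d : ℕ} {L : (E d →ᵇ ℝ) →L[ℝ] ℝ}

/-- test functions -/
def SS (d : ℕ) : Submodule ℝ (E d →ᵇ ℝ) where
  carrier := {φ | ContDiff ℝ (⊤ : ℕ∞) φ ∧ HasCompactSupport φ}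
  add_mem' := fun ha hb => ⟨ha.1.add hb.1, ha.2.add hb.2⟩
  zero_mem' := ⟨contDiff_const, HasCompactSupport.zero⟩
  smul_mem' := fun c _ ha => ⟨contDiff_const.smul ha.1, ha.2.smul_left (f := fun _ => c)⟩

lemma rep_abs {V H : Type*} [AddCommGroup V] [Module ℝ V] [NormedAddCommGroup H] [InnerProductSpace ℝ H] [CompleteSpace H]
    (J : V →ₗ[ℝ] H) (l : V →ₗ[ℝ] ℝ) {c : ℝ} (hb : ∀ v, |l v| ≤ c * ‖J v‖) : ∃ k : H, ∀ v, l v = inner ℝ k (J v) := by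
  obtain ⟨s, hs⟩ := J.rangeRestrict.exists_rightInverse_of_surjective (LinearMap.range_rangeRestrict J)
  have hs' : ∀ v, J (s v) = v.1 := fun v => congrArg Subtype.val (LinearMap.congr_fun hs v)
  let G : LinearMap.range J →L[ℝ] ℝ := (l ∘ₗ s).mkContinuous c fun v => by
    have := hb (s v)
    rw [hs'] at this
    exact this
  obtain ⟨g, hg, _⟩ := exists_extension_norm_eq (LinearMap.range J) G
  refine ⟨(InnerProductSpace.toDual ℝ H).symm g, fun v => ?_⟩
  rw [InnerProductSpace.toDual_symm_apply]
  have h1 := hg ⟨J v, LinearMap.mem_range_self J v⟩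
  refine Eq.trans ?_ h1.symm
  show l v = l (s ⟨J v, _⟩)
  have h2 := hb (s ⟨J v, LinearMap.mem_range_self J v⟩ - v)
  rw [map_sub, map_sub J, hs', sub_self, norm_zero, mul_zero] at h2
  exact (sub_eq_zero.1 (abs_nonpos_iff.1 h2)).symm

lemma rep_L2 {μ : Measure (E d)} [IsFiniteMeasure μ]
    (h : ∀ φ ∈ SS d, ENNReal.ofReal |L φ| ≤ ∫⁻ x, ‖φ x‖ₑ ∂μ) :
    ∃ g : E d → ℝ, Integrable g μ ∧ ∀ φ ∈ SS d, L φ = ∫ x, g x * φ x ∂μ := by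
  let J : SS d →ₗ[ℝ] Lp ℝ 2 μ := (BoundedContinuousFunction.toLp 2 μ ℝ).toLinearMap ∘ₗ (SS d).subtype
  have hJ : ∀ φ : SS d, (J φ : E d → ℝ) =ᵐ[μ] φ.1 := fun φ => BoundedContinuousFunction.coeFn_toLp (p := 2) (𝕜 := ℝ) μ φ.1
  set c : ℝ := (μ Set.univ ^ (1 / (1:ℝ≥0∞).toReal - 1 / (2:ℝ≥0∞).toReal)).toReal with hc
  have hct : μ Set.univ ^ (1 / (1:ℝ≥0∞).toReal - 1 / (2:ℝ≥0∞).toReal) ≠ ∞ := by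
    refine ENNReal.rpow_ne_top_of_nonneg (by norm_num) (measure_ne_top _ _)
  have hb : ∀ φ : SS d, |L φ.1| ≤ c * ‖J φ‖ := by
    intro φ
    have h1 := h φ.1 φ.2
    rw [← eLpNorm_one_eq_lintegral_enorm] at h1
    have h2 := eLpNorm_le_eLpNorm_mul_rpow_measure_univ (μ := μ) (p := 1) (q := 2) (by norm_num) φ.1.continuous.aestronglyMeasurable
    have h3 : eLpNorm φ.1 2 μ = ENNReal.ofReal ‖J φ‖ := by
      rw [Lp.norm_def, ENNReal.ofReal_toReal (Lp.eLpNorm_ne_top _), eLpNorm_congr_ae (hJ φ)]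
    rw [h3, ← ENNReal.ofReal_toReal hct, ← ENNReal.ofReal_mul (norm_nonneg _)] at h2
    have := (ENNReal.ofReal_le_ofReal_iff (by positivity)).1 (h1.trans h2)
    rw [mul_comm]; exact this
  obtain ⟨k, hk⟩ := rep_abs J (l := L.toLinearMap ∘ₗ (SS d).subtype) (c := c) (fun v => hb v)
  refine ⟨k, (Lp.memLp k).integrable (by norm_num), fun φ hφ => ?_⟩
  let ψ : SS d := ⟨φ, hφ⟩
  have e1 : L φ = _ := hk ψ
  rw [e1, L2.inner_def]
  refine integral_congr_ae ?_
  filter_upwards [hJ ψ] with x hx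
  rw [hx]
  simp [ψ, mul_comm]

lemma rep_f {m : E d → ℝ≥0∞} (hm : Measurable m) (hf : ∫⁻ x, m x ≠ ∞)
    (h : ∀ φ ∈ SS d, ENNReal.ofReal |L φ| ≤ ∫⁻ x, ‖φ x‖ₑ * m x) :
    ∃ f : E d → ℝ, Integrable f ∧ ∀ φ ∈ SS d, L φ = ∫ x, f x * φ x := by
  have hfin : ∀ᵐ x, m x < ∞ := ae_lt_top hm hf
  have : IsFiniteMeasure (volume.withDensity m) := isFiniteMeasure_withDensity hf
  obtain ⟨g, hg, hgL⟩ := rep_L2 (L := L) (μ := volume.withDensity m) fun φ hφ => by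
    refine (h φ hφ).trans (le_of_eq ?_)
    rw [lintegral_withDensity_eq_lintegral_mul _ hm φ.continuous.measurable.enorm]
    simp [mul_comm]
  refine ⟨fun x => (m x).toReal * g x, ?_, fun φ hφ => ?_⟩
  · exact (integrable_withDensity_iff_integrable_smul' hm hfin).1 hg
  · rw [hgL φ hφ, integral_withDensity_eq_integral_toReal_smul hm hfin]
    simp [mul_assoc]
end sc17

section sc18
open BoundedContinuousFunction
variable {d : ℕ} {n : ℤ} {L : (E d →ᵇ ℝ) →L[ℝ] ℝ}

lemma PB_contDiff {t : ℝ} (ht : 0 < t) (x : E d) : ContDiff ℝ (⊤ : ℕ∞) (PB d t x) := by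
  have e : (PB d t x : E d → ℝ) = fun y => t ^ (-(d:ℝ)) * ((4 * π) ^ (-(d:ℝ)/2) * Real.exp (-(‖t⁻¹ • (x - y)‖^2)/4)) := by
    ext y; rw [PB_apply ht]; rfl
  rw [e]
  have h0 : ContDiff ℝ (⊤ : ℕ∞) fun y : E d => t⁻¹ • (x - y) := by fun_prop
  have h : ContDiff ℝ (⊤ : ℕ∞) fun y : E d => ‖t⁻¹ • (x - y)‖^2 := (contDiff_norm_sq ℝ).comp h0
  exact contDiff_const.mul (contDiff_const.mul (h.neg.div_const 4).exp)

lemma PB_approx {t : ℝ} (ht : 0 < t) (x : E d) {ε : ℝ} (hε : 0 < ε) : ∃ φ ∈ SS d, ‖φ - PB d t x‖ ≤ ε := by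
  have hC := CG_pos d 1
  obtain ⟨j, hj⟩ := exists_nat_gt (‖x‖ + t * (CG d 1 * (t^d)⁻¹ / ε))
  have hj0 : (0:ℝ) < j := lt_of_le_of_lt (by positivity) hj
  let χ : ContDiffBump (0 : E d) := ⟨j, j + 1, hj0, by linarith⟩
  have hcont : Continuous fun y => χ y * PB d t x y := χ.continuous.mul (PB d t x).continuous
  have hbd : ∀ y, ‖χ y * PB d t x y‖ ≤ ‖PB d t x‖ := fun y => by
    rw [norm_mul, Real.norm_of_nonneg χ.nonneg]
    exact (mul_le_of_le_one_left (norm_nonneg _) χ.le_one).trans ((PB d t x).norm_coe_le_norm y)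
  refine ⟨BoundedContinuousFunction.ofNormedAddCommGroup (fun y => χ y * PB d t x y) hcont _ hbd, ⟨χ.contDiff.mul (PB_contDiff ht x), χ.hasCompactSupport.mul_right⟩, ?_⟩
  refine (BoundedContinuousFunction.norm_le hε.le).2 fun y => ?_
  show ‖χ y * PB d t x y - PB d t x y‖ ≤ ε
  by_cases hy : ‖y‖ ≤ j
  · rw [χ.one_of_mem_closedBall (by rw [mem_closedBall_zero_iff]; exact hy)]
    simpa using hε.le
  · have e : χ y * PB d t x y - PB d t x y = -((1 - χ y) * PB d t x y) := by ring
    rw [e, norm_neg, norm_mul, Real.norm_of_nonneg (by linarith [χ.le_one (x := y)])]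
    refine (mul_le_of_le_one_left (norm_nonneg _) (by linarith [χ.nonneg (x := y)])).trans ?_
    rw [PB_apply ht, Real.norm_of_nonneg (pk_nonneg d ht _)]
    refine (pk_le d 1 ht _).trans ?_
    unfold wt
    rw [norm_smul, Real.norm_of_nonneg (by positivity), pow_one, ← mul_assoc, ← div_eq_mul_inv, div_le_iff₀ (by positivity)]
    have h1 : ‖y‖ ≤ ‖x‖ + ‖x - y‖ := by
      have := norm_sub_norm_le y x; rw [norm_sub_rev] at this; linarith
    have h2 : t * (CG d 1 * (t^d)⁻¹ / ε) ≤ ‖x - y‖ := by linarith [not_le.1 hy]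
    have h3 : CG d 1 * (t^d)⁻¹ / ε ≤ t⁻¹ * ‖x - y‖ := by
      rw [le_inv_mul_iff₀ ht]; exact h2
    rw [div_le_iff₀ hε] at h3
    nlinarith

lemma L_PB {f : E d → ℝ} (hf : Integrable f) (h : ∀ φ ∈ SS d, L φ = ∫ x, f x * φ x) {t : ℝ} (ht : 0 < t) (x : E d) :
    L (PB d t x) = Pf d t f x := by
  have hi : ∀ φ : E d →ᵇ ℝ, Integrable fun y => f y * φ y := fun φ =>
    (hf.mul_bdd φ.continuous.aestronglyMeasurable (Eventually.of_forall φ.norm_coe_le_norm))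
  have e : Pf d t f x = ∫ y, f y * PB d t x y := by
    unfold Pf; congr 1; ext y; rw [PB_apply ht, mul_comm]
  rw [e]
  set c := ‖L‖ + (∫ y, ‖f y‖) + 1 with hc
  have hI : 0 ≤ ∫ y, ‖f y‖ := integral_nonneg fun _ => norm_nonneg _
  have hc0 : 0 < c := by positivity
  refine eq_of_forall_dist_le fun ε hε => ?_
  obtain ⟨φ, hφ, hφε⟩ := PB_approx ht x (div_pos hε hc0)
  have h1 : |L φ - L (PB d t x)| ≤ ‖L‖ * (ε / c) := by
    rw [← map_sub]
    exact (L.le_opNorm _).trans (by gcongr)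
  have h2 : |(∫ y, f y * φ y) - ∫ y, f y * PB d t x y| ≤ (∫ y, ‖f y‖) * (ε / c) := by
    rw [← integral_sub (hi _) (hi _), ← integral_mul_const]
    refine norm_integral_le_of_norm_le (f := fun y => f y * φ y - f y * PB d t x y) (hf.norm.mul_const _) (Eventually.of_forall fun y => ?_)
    rw [← mul_sub, norm_mul]
    exact mul_le_mul_of_nonneg_left (((φ - PB d t x).norm_coe_le_norm y).trans hφε) (norm_nonneg _)
  rw [h φ hφ] at h1
  rw [Real.dist_eq]
  have h3 := abs_sub_le (L (PB d t x)) (∫ y, f y * φ y) (∫ y, f y * PB d t x y)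
  rw [abs_sub_comm (L (PB d t x)) (∫ y, f y * φ y)] at h3
  have h4 : c * (ε / c) = ε := by field_simp
  have h5 : 0 < ε / c := by positivity
  clear_value c
  have h6 : (‖L‖ + (∫ y, ‖f y‖) + 1) * (ε / c) = ε := by rw [← hc]; exact h4
  linarith

lemma Pf_cont_t {f : E d → ℝ} (hf : Integrable f) {t : ℝ} (ht : 0 < t) (x : E d) : ContinuousAt (fun s => Pf d s f x) t := by
  have hC := CG_pos d 0
  unfold Pf
  refine continuousAt_of_dominated (bound := fun z => CG d 0 * ((t/2)^d)⁻¹ * ‖f z‖) ?_ ?_ (hf.norm.const_mul _) (Eventually.of_forall fun z => ?_)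
  · filter_upwards with s
    exact ((pk_continuous d s).comp (by fun_prop : Continuous fun z => x - z)).aestronglyMeasurable.mul hf.aestronglyMeasurable
  · filter_upwards [Ioi_mem_nhds (show t/2 < t by linarith)] with s hs
    have hs' : t/2 < s := hs
    have hs0 : 0 < s := by linarith
    filter_upwards with z
    rw [norm_mul, Real.norm_of_nonneg (pk_nonneg d hs0 _)]
    refine mul_le_mul_of_nonneg_right ((pk_bdd d hs0 _).trans ?_) (norm_nonneg _)
    gcongr
  · refine ContinuousAt.mul ?_ continuousAt_const
    unfold pk
    refine ContinuousAt.mul (continuousAt_id.rpow_const (Or.inl ht.ne')) ?_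
    exact (gauss_continuous d).continuousAt.comp ((continuousAt_id.inv₀ ht.ne').smul continuousAt_const)

lemma Mn_le_mx {f : E d → ℝ} (hf : Integrable f) (h : ∀ φ ∈ SS d, L φ = ∫ x, f x * φ x) {ts : ℕ → ℝ}
    (hts : ∀ i, 0 < ts i ∧ ts i < RR n) (hD : Set.Ioo 0 (RR n) ⊆ closure (Set.range ts)) (x : E d) :
    MnMax d n f x ≤ mx L ts x := by
  refine iSup_le fun t => iSup_le fun ht => ?_
  have h1 : Tendsto (fun s => ENNReal.ofReal |Pf d s f x|) (𝓝 t) (𝓝 (ENNReal.ofReal |Pf d t f x|)) :=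
    (ENNReal.continuous_ofReal.tendsto _).comp (Pf_cont_t hf ht.1 x).abs
  refine le_of_tendsto_of_frequently h1 ((mem_closure_iff_frequently.1 (hD ht)).mono ?_)
  rintro _ ⟨i, rfl⟩
  rw [← L_PB hf h (hts i).1]
  exact le_iSup (fun i => ENNReal.ofReal |L (PB d (ts i) x)|) i

lemma part_b {T : (E d → ℝ) → ℝ} {M : ℝ} (hM : 0 ≤ M)
    (hadd : ∀ φ ψ : E d → ℝ, ContDiff ℝ (⊤ : ℕ∞) φ → HasCompactSupport φ →
          ContDiff ℝ (⊤ : ℕ∞) ψ → HasCompactSupport ψ → T (φ + ψ) = T φ + T ψ)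
    (hsm : ∀ (c : ℝ) (φ : E d → ℝ), ContDiff ℝ (⊤ : ℕ∞) φ → HasCompactSupport φ → T (c • φ) = c * T φ)
    (hb : ∀ φ : E d → ℝ, ContDiff ℝ (⊤ : ℕ∞) φ → HasCompactSupport φ → |T φ| ≤ M * (bmonNorm d n φ).toReal) :
    ∃ f : E d → ℝ, Memh1n d n f ∧ (h1nNorm d n f).toReal ≤ 3 * C8 d * M ∧
          ∀ φ : E d → ℝ, ContDiff ℝ (⊤ : ℕ∞) φ → HasCompactSupport φ → T φ = ∫ x, f x * φ x := by
  obtain ⟨L, hL, hLT⟩ := hb_ext hM hadd hsm hb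
  have hR := RR_pos n
  have hC8 := C8_nonneg d
  have : Nonempty (Set.Ioo 0 (RR n)) := ⟨⟨RR n/2, by constructor <;> linarith⟩⟩
  let ts : ℕ → ℝ := fun i => (TopologicalSpace.denseSeq (Set.Ioo 0 (RR n)) i).1
  have hts : ∀ i, 0 < ts i ∧ ts i < RR n := fun i => (TopologicalSpace.denseSeq (Set.Ioo 0 (RR n)) i).2
  have hD : Set.Ioo 0 (RR n) ⊆ closure (Set.range ts) := by
    have := Subtype.dense_iff.1 (TopologicalSpace.denseRange_denseSeq (Set.Ioo 0 (RR n)))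
    rwa [← Set.range_comp] at this
  have hsmall : ∀ ε > 0, ∃ i, ts i < ε := by
    intro ε hε
    have h0 : 0 < min ε (RR n) / 2 := by positivity
    have h1 := min_le_right ε (RR n)
    have h2 := min_le_left ε (RR n)
    obtain ⟨_, ⟨i, rfl⟩, hi⟩ := Metric.mem_closure_iff.1 (hD (show min ε (RR n) / 2 ∈ Set.Ioo 0 (RR n) from ⟨h0, by linarith⟩)) _ h0
    rw [Real.dist_eq, abs_lt] at hi
    exact ⟨i, by linarith⟩
  have hmi := mx_int hM hL hts
  obtain ⟨f, hf, hfL⟩ := rep_f (L := L) (mx_meas hts) (hmi.trans_lt ENNReal.ofReal_lt_top).ne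
    fun φ hφ => L_le_mx hts hsmall hφ.1 hφ.2
  have hle : h1nNorm d n f ≤ ENNReal.ofReal (3 * C8 d * M) := (lintegral_mono (Mn_le_mx hf hfL hts hD)).trans hmi
  refine ⟨f, ⟨hf, hle.trans_lt ENNReal.ofReal_lt_top⟩, ENNReal.toReal_le_of_le_ofReal (by positivity) hle, fun φ h1 h2 => ?_⟩
  obtain ⟨B, hB⟩ := h2.exists_bound_of_continuous h1.continuous
  let ψ : E d →ᵇ ℝ := BoundedContinuousFunction.ofNormedAddCommGroup φ h1.continuous B hB
  exact (hLT ψ h1 h2).symm.trans (hfL ψ ⟨h1, h2⟩)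

end sc18

/-- The duality between `h^1_n` and `vmo_n`, uniformly in `n`: pairing estimate and
representation of bounded linear functionals. -/
theorem stmt16 (d : ℕ) (hd : 3 ≤ d) :
    ∃ C : ℝ, 0 < C ∧ ∀ n : ℤ,
      (∀ f : E d → ℝ, Memh1n d n f →
        ∀ φ : E d → ℝ, ContDiff ℝ (⊤ : ℕ∞) φ → HasCompactSupport φ →
        |∫ x, f x * φ x| ≤ C * (h1nNorm d n f).toReal * (bmonNorm d n φ).toReal) ∧
      (∀ (T : (E d → ℝ) → ℝ) (M : ℝ), 0 ≤ M →
        (∀ φ ψ : E d → ℝ, ContDiff ℝ (⊤ : ℕ∞) φ → HasCompactSupport φ →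
          ContDiff ℝ (⊤ : ℕ∞) ψ → HasCompactSupport ψ → T (φ + ψ) = T φ + T ψ) →
        (∀ (c : ℝ) (φ : E d → ℝ), ContDiff ℝ (⊤ : ℕ∞) φ → HasCompactSupport φ →
          T (c • φ) = c * T φ) →
        (∀ φ : E d → ℝ, ContDiff ℝ (⊤ : ℕ∞) φ → HasCompactSupport φ →
          |T φ| ≤ M * (bmonNorm d n φ).toReal) →
        ∃ f : E d → ℝ, Memh1n d n f ∧ (h1nNorm d n f).toReal ≤ C * M ∧
          ∀ φ : E d → ℝ, ContDiff ℝ (⊤ : ℕ∞) φ → HasCompactSupport φ →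
            T φ = ∫ x, f x * φ x) := by
  obtain ⟨C, hC, hA⟩ := part_a (d := d) (by omega)
  have hC8 := C8_nonneg d
  refine ⟨C + 3 * C8 d, by positivity, fun n => ⟨fun f hf φ h1 h2 => ?_, fun T M hM hadd hsm hb => ?_⟩⟩
  · obtain ⟨B, hB⟩ := h2.exists_bound_of_continuous h1.continuous
    refine (hA n f hf φ B h1.continuous hB).trans ?_
    have h3 : 0 ≤ (bmonNorm d n φ).toReal := ENNReal.toReal_nonneg
    have h4 : 0 ≤ (h1nNorm d n f).toReal := ENNReal.toReal_nonneg
    gcongr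
    linarith
  · obtain ⟨f, h1, h2, h3⟩ := part_b hM hadd hsm hb
    exact ⟨f, h1, h2.trans (by nlinarith [mul_nonneg hC.le hM]), h3⟩
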